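/- Let ∼ be an equivalence relation on S² such that every equivalence class is compact and connected, the complement in S² of every equivalence class is connected (the classes do not separate the sphere), the family of equivalence classes is upper semicontinuous, and not all points of S² are equivalent. Then the quotient space S²/∼ (with the quotient topology) is homeomorphic to S². -/

import Mathlib

open Set Filter Topology

noncomputable section

abbrev Sph : Type := Metric.sphere (0 : EuclideanSpace ℝ (Fin 3)) 1

/-- A family `S` of subsets of a topological space is upper semicontinuous if for every `A ∈ S`
and every open `U ⊇ A` there is an open `V ⊇ A` such that every `B ∈ S` meeting `V` is
contained in `U`. -/
def USCFamily {Z : Type*} [TopologicalSpace Z] (S : Set (Set Z)) : Prop :=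
  ∀ A ∈ S, ∀ U : Set Z, IsOpen U → A ⊆ U →
    ∃ V : Set Z, IsOpen V ∧ A ⊆ V ∧ ∀ B ∈ S, (B ∩ V).Nonempty → B ⊆ U


namespace MQ

/-! Part 0 -/

lemma exp_const {X : Type*} [TopologicalSpace X] {S : Set X} (hS : IsPreconnected S) {k : X → ℂ}
    (hk : ContinuousOn k S) (h1 : ∀ x ∈ S, Complex.exp (k x) = 1) :
    ∀ x ∈ S, ∀ y ∈ S, k x = k y := by
  intro x hx y hy
  have hc : (range (fun n : ℤ => (n : ℂ) * (2 * Real.pi * Complex.I))).Countable :=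
    countable_range _
  refine hc.isTotallyDisconnected (k '' S) ?_ (hS.image k hk) (mem_image_of_mem _ hx)
    (mem_image_of_mem _ hy)
  rintro _ ⟨z, hz, rfl⟩
  obtain ⟨n, hn⟩ := Complex.exp_eq_one_iff.1 (h1 z hz)
  exact ⟨n, hn.symm⟩

lemma no_log {U : Set ℂ} (hb : Bornology.IsBounded U) {p : ℂ} (hp : p ∈ U)
    (hU : IsOpen U)
    {g : ℂ → ℂ} (hg : ContinuousOn g (frontier U))
    (h : ∀ z ∈ frontier U, Complex.exp (g z) = z - p) : False := by
  classical
  obtain ⟨G, hG⟩ := ContinuousMap.exists_restrict_eq (isClosed_frontier (s := U))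
    (⟨(frontier U).domRestrict g, hg.domRestrict⟩ : C(frontier U, ℂ))
  have hG' : ∀ z ∈ frontier U, G z = g z := fun z hz => by
    have := congrArg (fun f => f ⟨z, hz⟩) hG
    exact this
  set F : ℂ → ℂ := fun z => if z ∈ U then Complex.exp (G z) else z - p with hF
  have hFc : Continuous F := by
    refine Continuous.if ?_ (by fun_prop) (by fun_prop)
    intro a ha
    have ha' : a ∈ frontier U := ha
    rw [hG' a ha', h a ha']
  have hF0 : ∀ z, F z ≠ 0 := by
    intro z
    simp only [hF]
    split_ifs with hz
    · exact Complex.exp_ne_zero _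
    · intro h0
      exact hz (by rwa [sub_eq_zero.1 h0])
  have hsc : IsSimplyConnected (univ : Set ℂ) := by
    have : SimplyConnectedSpace (univ : Set ℂ) := by
      have : ContractibleSpace (univ : Set ℂ) := (Homeomorph.Set.univ ℂ).contractibleSpace
      infer_instance
    exact this
  obtain ⟨L, hL, hLe⟩ := Complex.exists_continuousOn_eqOn_exp_comp hsc isOpen_univ
    hFc.continuousOn (by rintro ⟨z, -, hz⟩; exact hF0 z hz)
  rw [continuousOn_univ] at hL
  obtain ⟨R, hR0, hR⟩ := hb.subset_ball_lt 0 p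
  set k : ℝ → ℂ := fun θ => L (p + R * Complex.exp (θ * Complex.I)) - θ * Complex.I - Complex.log R
    with hk
  have hRne : (R : ℂ) ≠ 0 := by exact_mod_cast hR0.ne'
  have hk1 : ∀ θ, Complex.exp (k θ) = 1 := by
    intro θ
    have h1 : (p + R * Complex.exp (θ * Complex.I)) ∉ U := by
      intro hz
      have := hR hz
      rw [mem_ball_iff_norm] at this
      simp [Complex.norm_exp_ofReal_mul_I, abs_of_pos hR0] at this
    have h2 := hLe (mem_univ (p + R * Complex.exp (θ * Complex.I)))
    simp only [Function.comp, hF, if_neg h1] at h2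
    simp only [hk]
    rw [Complex.exp_sub, Complex.exp_sub, h2, Complex.exp_log hRne]
    field_simp [Complex.exp_ne_zero]
    ring
  have hkc : Continuous k := by simp only [hk]; fun_prop
  have := exp_const isPreconnected_univ hkc.continuousOn (fun x _ => hk1 x) 0 trivial (2 * Real.pi)
    trivial
  simp only [hk] at this
  have e2 : Complex.exp (((2 * Real.pi : ℝ) : ℂ) * Complex.I) = 1 := by
    push_cast
    exact Complex.exp_two_pi_mul_I
  rw [e2] at this
  simp at this
  have h3 : (2 : ℂ) * Real.pi * Complex.I = 0 := by linear_combination this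
  simp [Real.pi_ne_zero] at h3

def Jn {X : Type*} [TopologicalSpace X] (K : Set X) (p q : X) : Prop :=
  ∃ C, IsPreconnected C ∧ p ∈ C ∧ q ∈ C ∧ C ⊆ Kᶜ

section
variable {X : Type*} [TopologicalSpace X]

lemma Jn.symm {K : Set X} {p q : X} : Jn K p q → Jn K q p := fun ⟨C, h, hp, hq, hC⟩ =>
  ⟨C, h, hq, hp, hC⟩

lemma Jn.refl {K : Set X} {p : X} (h : p ∉ K) : Jn K p p :=
  ⟨{p}, isPreconnected_singleton, rfl, rfl, by simpa using h⟩

lemma Jn.trans {K : Set X} {p q r : X} : Jn K p q → Jn K q r → Jn K p r :=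
  fun ⟨C, h, hp, hq, hC⟩ ⟨D, h', hp', hq', hC'⟩ =>
  ⟨C ∪ D, h.union q hq hp' h', Or.inl hp, Or.inr hq', union_subset hC hC'⟩

lemma Jn.mono {K L : Set X} {p q : X} (hKL : K ⊆ L) : Jn L p q → Jn K p q :=
  fun ⟨C, h, hp, hq, hC⟩ => ⟨C, h, hp, hq, hC.trans (compl_subset_compl.2 hKL)⟩

lemma Jn.left {K : Set X} {p q : X} : Jn K p q → p ∉ K := fun ⟨_, _, hp, _, hC⟩ => hC hp
lemma Jn.right {K : Set X} {p q : X} : Jn K p q → q ∉ K := fun h => h.symm.left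

lemma Jn_of_mem_comp {K : Set X} {p q : X} (h : q ∈ connectedComponentIn Kᶜ p) : Jn K p q := by
  by_cases hp : p ∈ Kᶜ
  · exact ⟨_, isPreconnected_connectedComponentIn, mem_connectedComponentIn hp, h,
      connectedComponentIn_subset _ _⟩
  · rw [connectedComponentIn_eq_empty hp] at h
    exact h.elim

lemma Jn_iff {K : Set X} {p q : X} : Jn K p q ↔ q ∈ connectedComponentIn Kᶜ p :=
  ⟨fun ⟨_, h, hp, hq, hC⟩ => h.subset_connectedComponentIn hp hC hq, Jn_of_mem_comp⟩

lemma frontier_comp [LocallyConnectedSpace X] {K : Set X} (hK : IsClosed K) (p : X) :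
    frontier (connectedComponentIn Kᶜ p) ⊆ K := by
  intro x hx
  by_contra hxK
  have ho := hK.isOpen_compl.connectedComponentIn (x := x)
  have hop := hK.isOpen_compl.connectedComponentIn (x := p)
  rw [hop.frontier_eq] at hx
  obtain ⟨y, hy, hy'⟩ := mem_closure_iff.1 hx.1 _ ho (mem_connectedComponentIn hxK)
  exact hx.2 (Jn_iff.1 ((Jn_of_mem_comp hy').trans (Jn_of_mem_comp hy).symm))

def HasLog (e : X → ℂ) (A : Set X) (p : X) : Prop :=
  ∃ g : X → ℂ, ContinuousOn g A ∧ ∀ z ∈ A, Complex.exp (g z) = e z - e p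

lemma one_sub_slit {w : ℂ} (h : ‖w‖ < 1) : 1 - w ∈ Complex.slitPlane := by
  left
  have := (Complex.abs_re_le_norm w).trans_lt h
  have := (abs_lt.1 this).2
  simp; linarith

lemma hasLog_of_Jn [CompactSpace X] [T2Space X] (e : OpenPartialHomeomorph X ℂ) {q : X}
    (hs : e.source = {q}ᶜ) (ht : e.target = univ)
    {A : Set X} (hA : IsClosed A) {p : X} (hpq : p ≠ q) (h : Jn A p q) : HasLog e A p := by
  have hqA := h.right
  obtain ⟨C, hC, hp, hq, hCA⟩ := h
  have hAs : A ⊆ e.source := by rw [hs]; rintro x hx rfl; exact hqA hx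
  have heA : ContinuousOn e A := e.continuousOn.mono hAs
  have hcA : IsCompact (e '' A) := hA.isCompact.image_of_continuousOn heA
  have key : ∀ x ∈ C, ∀ᶠ y in 𝓝[C] x, ((x = q ∨ HasLog e A x) → (y = q ∨ HasLog e A y)) ∧
      ((y = q ∨ HasLog e A y) → (x = q ∨ HasLog e A x)) := by
    intro x hx
    by_cases hxq : x = q
    · subst hxq
      obtain ⟨M, hM0, hM⟩ := hcA.isBounded.subset_ball_lt 0 0
      have hcl : IsClosed (e.symm '' Metric.closedBall 0 M) :=
        ((isCompact_closedBall (0 : ℂ) M).image_of_continuousOn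
          (e.symm.continuousOn.mono (by simp [ht]))).isClosed
      have hN : (e.symm '' Metric.closedBall 0 M)ᶜ ∈ 𝓝 x := by
        refine hcl.isOpen_compl.mem_nhds ?_
        rintro ⟨w, -, hw⟩
        have := e.map_target (x := w) (by simp [ht])
        rw [hw, hs] at this
        exact this rfl
      filter_upwards [mem_nhdsWithin_of_mem_nhds hN] with y hy
      refine ⟨fun _ => ?_, fun _ => Or.inl rfl⟩
      by_cases hyx : y = x
      · exact Or.inl hyx
      right
      have hyM : M < ‖e y‖ := by
        by_contra hh
        refine hy ⟨e y, by simpa using not_lt.1 hh, e.left_inv (by rw [hs]; exact hyx)⟩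
      have hy0 : e y ≠ 0 := by intro h0; rw [h0] at hyM; simp at hyM; linarith
      have hsm : ∀ z ∈ A, ‖e z / e y‖ < 1 := by
        intro z hz
        have := hM (mem_image_of_mem _ hz)
        rw [mem_ball_zero_iff] at this
        rw [norm_div, div_lt_one (by linarith)]
        linarith
      refine ⟨fun z => Complex.log (- e y) + Complex.log (1 - e z / e y), ?_, ?_⟩
      · refine continuousOn_const.add (ContinuousOn.clog ?_ ?_)
        · exact continuousOn_const.sub (heA.div_const _)
        · intro z hz; exact one_sub_slit (hsm z hz)
      · intro z hz
        rw [Complex.exp_add, Complex.exp_log (neg_ne_zero.2 hy0),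
          Complex.exp_log (Complex.slitPlane_ne_zero (one_sub_slit (hsm z hz)))]
        field_simp; ring
    · have hxs : x ∈ e.source := by rw [hs]; exact hxq
      have hxA : e x ∉ e '' A := by
        rintro ⟨z, hz, hzx⟩
        exact hCA hx (e.injOn (hAs hz) hxs hzx ▸ hz)
      obtain ⟨d, hd0, hd⟩ := Metric.isOpen_iff.1 hcA.isClosed.isOpen_compl _ hxA
      have hN1 : ∀ᶠ y in 𝓝[C] x, e y ∈ Metric.ball (e x) d :=
        mem_nhdsWithin_of_mem_nhds ((e.continuousAt hxs) (Metric.ball_mem_nhds _ hd0))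
      have hN2 : ∀ᶠ y in 𝓝[C] x, y ≠ q :=
        mem_nhdsWithin_of_mem_nhds (isOpen_ne.mem_nhds hxq)
      filter_upwards [hN1, hN2] with y hy hyq
      have hne : ∀ z ∈ A, d ≤ ‖e z - e x‖ := by
        intro z hz
        by_contra hh
        exact hd (mem_ball_iff_norm.2 (not_le.1 hh)) (mem_image_of_mem _ hz)
      have hne0 : ∀ z ∈ A, e z - e x ≠ 0 := fun z hz h0 => by
        have := hne z hz; rw [h0] at this; simp at this; linarith
      have hsl : ∀ z ∈ A, 1 - (e y - e x) / (e z - e x) ∈ Complex.slitPlane := by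
        intro z hz
        apply one_sub_slit
        rw [norm_div, div_lt_one (by linarith [hne z hz])]
        exact (mem_ball_iff_norm.1 hy).trans_le (hne z hz)
      have hlc : ContinuousOn (fun z => Complex.log (1 - (e y - e x) / (e z - e x))) A := by
        refine ContinuousOn.clog ?_ hsl
        exact continuousOn_const.sub (continuousOn_const.div (heA.sub continuousOn_const) hne0)
      have hle : ∀ z ∈ A, Complex.exp (Complex.log (1 - (e y - e x) / (e z - e x))) =
          (e z - e y) / (e z - e x) := by
        intro z hz
        rw [Complex.exp_log (Complex.slitPlane_ne_zero (hsl z hz))]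
        field_simp [hne0 z hz]; ring
      have hney : ∀ z ∈ A, e z - e y ≠ 0 := by
        intro z hz h0
        have := hle z hz
        rw [h0, zero_div] at this
        exact Complex.exp_ne_zero _ this
      simp only [hxq, hyq, false_or]
      constructor
      · rintro ⟨g, hg, hge⟩
        refine ⟨_, hg.add hlc, fun z hz => ?_⟩
        rw [Pi.add_apply, Complex.exp_add, hge z hz, hle z hz]
        field_simp [hne0 z hz]
      · rintro ⟨g, hg, hge⟩
        refine ⟨_, hg.sub hlc, fun z hz => ?_⟩
        rw [Pi.sub_apply, Complex.exp_sub, hge z hz, hle z hz]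
        field_simp [hne0 z hz, hney z hz]
  have := hC.induction₂' (fun x y => (x = q ∨ HasLog e A x) → (y = q ∨ HasLog e A y)) key
    (fun x y z _ _ _ h1 h2 h => h2 (h1 h)) hq hp
  exact (this (Or.inl rfl)).resolve_left hpq

lemma Jn_of_hasLog [CompactSpace X] [T2Space X] [LocallyConnectedSpace X]
    (e : OpenPartialHomeomorph X ℂ) {q : X}
    (hs : e.source = {q}ᶜ) (ht : e.target = univ)
    {A : Set X} (hA : IsClosed A) {p : X} (hp : p ∉ A) (hq : q ∉ A)
    (h : HasLog e A p) : Jn A p q := by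
  by_contra hn
  obtain ⟨g, hg, hge⟩ := h
  set U := connectedComponentIn Aᶜ p with hU
  have hUo : IsOpen U := hA.isOpen_compl.connectedComponentIn
  have hqU : q ∉ closure U := by
    intro hqc
    have ho := hA.isOpen_compl.connectedComponentIn (x := q)
    obtain ⟨y, hy, hy'⟩ := mem_closure_iff.1 hqc _ ho (mem_connectedComponentIn hq)
    exact hn ((Jn_of_mem_comp hy').trans (Jn_of_mem_comp hy).symm)
  have hUs : closure U ⊆ e.source := by rw [hs]; rintro x hx rfl; exact hqU hx
  have hUs' : U ⊆ e.source := subset_closure.trans hUs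
  have hcU : IsCompact (e '' closure U) :=
    isClosed_closure.isCompact.image_of_continuousOn (e.continuousOn.mono hUs)
  have heo : IsOpen (e '' U) := e.isOpen_image_of_subset_source hUo hUs'
  have hfr : frontier (e '' U) ⊆ e '' frontier U := by
    rw [heo.frontier_eq]
    rintro z ⟨hz, hz'⟩
    have : z ∈ e '' closure U :=
      closure_minimal (image_mono subset_closure) hcU.isClosed hz
    obtain ⟨x, hx, rfl⟩ := this
    refine ⟨x, ?_, rfl⟩
    rw [hUo.frontier_eq]
    exact ⟨hx, fun h => hz' (mem_image_of_mem _ h)⟩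
  have hfA : frontier U ⊆ A := frontier_comp hA p
  refine no_log (U := e '' U) (p := e p) (hcU.isBounded.subset (image_mono subset_closure))
    (mem_image_of_mem _ (mem_connectedComponentIn hp)) heo (g := g ∘ e.symm) ?_ ?_
  · refine hg.comp (e.symm.continuousOn.mono (by simp [ht])) ?_
    intro z hz
    obtain ⟨x, hx, rfl⟩ := hfr hz
    rw [e.left_inv (hUs (frontier_subset_closure hx))]
    exact hfA hx
  · intro z hz
    obtain ⟨x, hx, rfl⟩ := hfr hz
    rw [Function.comp, e.left_inv (hUs (frontier_subset_closure hx))]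
    exact hge x (hfA hx)

def J1 (X : Type*) [TopologicalSpace X] : Prop :=
  ∀ (A B : Set X) (p q : X), IsClosed A → IsClosed B → IsPreconnected (A ∩ B) →
    Jn A p q → Jn B p q → Jn (A ∪ B) p q

lemma J1_of_charts [CompactSpace X] [T2Space X] [LocallyConnectedSpace X]
    (hch : ∀ q : X, ∃ e : OpenPartialHomeomorph X ℂ, e.source = {q}ᶜ ∧ e.target = univ) :
    J1 X := by
  classical
  intro A B p q hA hB hAB h1 h2
  have hp : p ∉ A ∪ B := by rintro (h | h); exacts [h1.left h, h2.left h]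
  have hq : q ∉ A ∪ B := by rintro (h | h); exacts [h1.right h, h2.right h]
  by_cases hpq : p = q
  · subst hpq; exact Jn.refl hp
  obtain ⟨e, hs, ht⟩ := hch q
  obtain ⟨g, hg, hge⟩ := hasLog_of_Jn e hs ht hA hpq h1
  obtain ⟨k, hk, hke⟩ := hasLog_of_Jn e hs ht hB hpq h2
  have hpne : ∀ z ∈ A ∪ B, e z - e p ≠ 0 := by
    intro z hz h0
    have hzs : z ∈ e.source := by rw [hs]; rintro rfl; exact hq hz
    have := e.injOn hzs (by rw [hs]; exact hpq) (sub_eq_zero.1 h0)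
    exact hp (this ▸ hz)
  have hc : ∃ c : ℂ, Complex.exp c = 1 ∧ ∀ z ∈ A ∩ B, g z = k z + c := by
    by_cases hne : (A ∩ B).Nonempty
    · obtain ⟨w, hw⟩ := hne
      have h1 : ∀ z ∈ A ∩ B, Complex.exp (g z - k z) = 1 := by
        intro z hz
        rw [Complex.exp_sub, hge z hz.1, hke z hz.2, div_self (hpne z (Or.inl hz.1))]
      refine ⟨g w - k w, h1 w hw, fun z hz => ?_⟩
      have := exp_const hAB (k := fun z => g z - k z)
        ((hg.mono inter_subset_left).sub (hk.mono inter_subset_right)) h1 z hz w hw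
      rw [← this]; ring
    · exact ⟨0, Complex.exp_zero, fun z hz => (hne ⟨z, hz⟩).elim⟩
  obtain ⟨c, hc1, hc⟩ := hc
  refine Jn_of_hasLog e hs ht (hA.union hB) hp hq
    ⟨fun z => if z ∈ A then g z else k z + c, ?_, ?_⟩
  · refine ContinuousOn.union_of_isClosed ?_ ?_ hA hB
    · exact hg.congr (fun z hz => if_pos hz)
    · refine (hk.add (continuousOn_const (c := c))).congr (fun z hz => ?_)
      by_cases hzA : z ∈ A
      · simp only [if_pos hzA, Pi.add_apply]; exact hc z ⟨hzA, hz⟩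
      · simp only [if_neg hzA, Pi.add_apply]
  · intro z hz
    by_cases hzA : z ∈ A
    · simp only [if_pos hzA]; exact hge z hzA
    · simp only [if_neg hzA]
      rw [Complex.exp_add, hc1, mul_one]; exact hke z (hz.resolve_left hzA)
end
end MQ


namespace MQ

class Moore (X : Type*) [TopologicalSpace X] : Prop extends CompactSpace X, T2Space X,
    SecondCountableTopology X, ConnectedSpace X, LocallyPathConnectedSpace X, Nontrivial X where
  j1 : J1 X
  j0 : ∀ x p q : X, p ≠ x → q ≠ x → Jn {x} p q

section
variable {X : Type*} [TopologicalSpace X]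

lemma meets_frontier {C O : Set X} (hC : IsPreconnected C) {p q : X} (hp : p ∈ C) (hpO : p ∈ O)
    (hq : q ∈ C) (hqO : q ∉ O) : (C ∩ frontier O).Nonempty := by
  by_contra hn
  have hsub : ∀ x ∈ C, x ∉ frontier O := fun x hx hf => hn ⟨x, hx, hf⟩
  have h1 : p ∈ interior O := by
    by_contra h; exact hsub p hp ⟨subset_closure hpO, h⟩
  have h2 : q ∉ closure O := fun h => hsub q hq ⟨h, fun h' => hqO (interior_subset h')⟩
  obtain ⟨x, hx, hx1, hx2⟩ := hC (interior O) (closure O)ᶜ isOpen_interior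
    isClosed_closure.isOpen_compl (fun x hx => by
      by_cases h : x ∈ closure O
      · left; by_contra h'; exact hsub x hx ⟨h, h'⟩
      · right; exact h) ⟨p, hp, h1⟩ ⟨q, hq, h2⟩
  exact hx2 (subset_closure (interior_subset hx1))

lemma preconn_of_Jn {K : Set X} (h : ∀ p q, p ∉ K → q ∉ K → Jn K p q) : IsPreconnected Kᶜ := by
  refine isPreconnected_of_forall_pair fun x hx y hy => ?_
  obtain ⟨C, hC, h1, h2, h3⟩ := h x y hx hy
  exact ⟨C, h3, h1, h2, hC⟩

lemma exists_compact_preconn [CompactSpace X] [T2Space X] [LocallyPathConnectedSpace X]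
    {W N : Set X} (hW : IsOpen W) (hWc : IsPreconnected W) (hN : IsCompact N) (hNW : N ⊆ W) :
    ∃ M, IsCompact M ∧ IsPreconnected M ∧ N ⊆ M ∧ M ⊆ W := by
  rcases N.eq_empty_or_nonempty with rfl | ⟨p0, hp0⟩
  · exact ⟨∅, isCompact_empty, isPreconnected_empty, subset_rfl, empty_subset _⟩
  have hpc : IsPathConnected W := (hW.isConnected_iff_isPathConnected).1 ⟨⟨p0, hNW hp0⟩, hWc⟩
  suffices h : ∃ M, IsCompact M ∧ IsPreconnected M ∧ p0 ∈ M ∧ N ⊆ M ∧ M ⊆ W by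
    obtain ⟨M, h1, h2, -, h3, h4⟩ := h; exact ⟨M, h1, h2, h3, h4⟩
  refine hN.induction_on (p := fun s => ∃ M, IsCompact M ∧ IsPreconnected M ∧ p0 ∈ M ∧ s ⊆ M ∧ M ⊆ W)
    ?_ ?_ ?_ ?_
  · exact ⟨{p0}, isCompact_singleton, isPreconnected_singleton, rfl, empty_subset _,
      by simpa using hNW hp0⟩
  · rintro s t hst ⟨M, h1, h2, h3, h4, h5⟩
    exact ⟨M, h1, h2, h3, hst.trans h4, h5⟩
  · rintro s t ⟨M, h1, h2, h3, h4, h5⟩ ⟨M', h1', h2', h3', h4', h5'⟩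
    exact ⟨M ∪ M', h1.union h1', h2.union p0 h3 h3' h2', Or.inl h3,
      union_subset_union h4 h4', union_subset h5 h5'⟩
  · intro x hx
    obtain ⟨V, hV, hVc, hVW⟩ := exists_mem_nhds_isClosed_subset (hW.mem_nhds (hNW hx))
    set D := connectedComponentIn (interior V) x with hD
    have hxV : x ∈ interior V := mem_interior_iff_mem_nhds.2 hV
    have hDo : IsOpen D := isOpen_interior.connectedComponentIn
    have hxD : x ∈ D := mem_connectedComponentIn hxV
    obtain ⟨γ, hγ⟩ := hpc.joinedIn p0 (hNW hp0) x (hNW hx)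
    refine ⟨D, mem_nhdsWithin_of_mem_nhds (hDo.mem_nhds hxD), closure D ∪ range γ, ?_, ?_, ?_, ?_, ?_⟩
    · exact isClosed_closure.isCompact.union (isCompact_range γ.continuous)
    · refine IsPreconnected.union x (subset_closure hxD) ⟨1, by simp⟩
        isPreconnected_connectedComponentIn.closure (isPreconnected_range γ.continuous)
    · right; exact ⟨0, by simp⟩
    · exact subset_closure.trans subset_union_left
    · refine union_subset ?_ ?_
      · exact (closure_minimal ((connectedComponentIn_subset _ _).trans interior_subset) hVc).trans hVW
      · rintro _ ⟨t, rfl⟩; exact hγ t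

lemma J2 [CompactSpace X] [T2Space X] [LocallyPathConnectedSpace X] (hJ : J1 X) {A B : Set X}
    (hA : IsClosed A) (hB : IsClosed B) (hAc : IsPreconnected A) (hBc : IsPreconnected B)
    (hAB : ¬ IsPreconnected (A ∩ B)) : ∃ p q, p ∉ A ∪ B ∧ q ∉ A ∪ B ∧ ¬ Jn (A ∪ B) p q := by
  by_contra! hcon
  have hW : IsPreconnected (A ∪ B)ᶜ := preconn_of_Jn fun p q hp hq => hcon p q hp hq
  rw [isPreconnected_closed_iff] at hAB
  push Not at hAB
  obtain ⟨t, t', ht, ht', hcov, ⟨p, hpAB, hpt⟩, ⟨q, hqAB, hqt⟩, hemp⟩ := hAB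
  have hPc : IsClosed (A ∩ B ∩ t) := (hA.inter hB).inter ht
  have hQc : IsClosed (A ∩ B ∩ t') := (hA.inter hB).inter ht'
  obtain ⟨O, hO, hPO, hOQ⟩ := normal_exists_closure_subset hPc hQc.isOpen_compl (by
    intro x hx hx'
    have : x ∈ A ∩ B ∩ (t ∩ t') := ⟨hx.1, hx.2, hx'.2⟩
    rw [hemp] at this; exact this)
  have hqO : q ∉ closure O := fun h => hOQ h ⟨hqAB, hqt⟩
  have hpO : p ∈ O := hPO ⟨hpAB, hpt⟩
  have hK : frontier O ⊆ Aᶜ ∪ Bᶜ := by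
    rw [hO.frontier_eq, ← compl_inter]
    rintro x ⟨hx1, hx2⟩ hx
    rcases hcov hx with h | h
    · exact hx2 (hPO ⟨hx, h⟩)
    · exact hOQ hx1 ⟨hx, h⟩
  obtain ⟨KA, KB, hKA, hKB, hKA', hKB', hKe⟩ :=
    (isClosed_frontier (s := O)).isCompact.binary_compact_cover hA.isOpen_compl hB.isOpen_compl hK
  obtain ⟨M, hM, hMc, hNM, hMW⟩ := exists_compact_preconn (hA.union hB).isOpen_compl hW
    (hKA.inter_right hKB.isClosed) (by
      rintro x ⟨h1, h2⟩ (h | h)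
      exacts [hKA' h1 h, hKB' h2 h])
  have h1 : Jn (KA ∪ M) p q := ⟨A, hAc, hpAB.1, hqAB.1, by
    rintro x hx (h | h)
    exacts [hKA' h hx, hMW h (Or.inl hx)]⟩
  have h2 : Jn (KB ∪ M) p q := ⟨B, hBc, hpAB.2, hqAB.2, by
    rintro x hx (h | h)
    exacts [hKB' h hx, hMW h (Or.inr hx)]⟩
  have hint : (KA ∪ M) ∩ (KB ∪ M) = M := by
    rw [← inter_union_distrib_right]; exact union_eq_right.2 hNM
  obtain ⟨C, hC, hpC, hqC, hCK⟩ := hJ _ _ p q (hKA.isClosed.union hM.isClosed)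
    (hKB.isClosed.union hM.isClosed) (by rwa [hint]) h1 h2
  obtain ⟨x, hxC, hxO⟩ := meets_frontier hC hpC hpO hqC (fun h => hqO (subset_closure h))
  rw [hKe] at hxO
  apply hCK hxC
  rcases hxO with h | h
  · exact Or.inl (Or.inl h)
  · exact Or.inr (Or.inl h)

lemma preimage_preconn {S : Type*} [TopologicalSpace S] {π : S → X}
    (hsurj : Function.Surjective π) (hcl : IsClosedMap π)
    (hfib : ∀ x, IsPreconnected (π ⁻¹' {x})) {T : Set X} (hT : IsPreconnected T) :
    IsPreconnected (π ⁻¹' T) := by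
  rw [isPreconnected_closed_iff] at hT ⊢
  rintro t t' ht ht' hcov ⟨a, haT, hat⟩ ⟨b, hbT, hbt⟩
  obtain ⟨y, hyT, ⟨u, hu, rfl⟩, ⟨v, hv, hvu⟩⟩ := hT (π '' t) (π '' t') (hcl t ht) (hcl t' ht') (by
    intro y hy
    obtain ⟨z, rfl⟩ := hsurj y
    rcases hcov hy with h | h
    exacts [Or.inl ⟨z, h, rfl⟩, Or.inr ⟨z, h, rfl⟩]) ⟨_, haT, a, hat, rfl⟩ ⟨_, hbT, b, hbt, rfl⟩
  obtain ⟨w, hw, hw'⟩ := (isPreconnected_closed_iff.1 (hfib (π u))) t t' ht ht' (by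
    intro z hz
    have hz' : π z = π u := hz
    exact hcov (by rw [mem_preimage, hz']; exact hyT)) ⟨u, rfl, hu⟩ ⟨v, hvu, hv⟩
  have hwu : π w = π u := hw
  exact ⟨w, by rw [mem_preimage, hwu]; exact hyT, hw'⟩

lemma sc_of_closed {S : Type*} [TopologicalSpace S] [CompactSpace S]
    [SecondCountableTopology S] [T1Space X] {π : S → X} (hc : Continuous π)
    (hsurj : Function.Surjective π) (hcl : IsClosedMap π) : SecondCountableTopology X := by
  set b := TopologicalSpace.countableBasis S with hb
  have hbb := TopologicalSpace.isBasis_countableBasis S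
  set B : Set (Set X) := (fun F : Set (Set S) => (π '' (⋃₀ F)ᶜ)ᶜ) '' {F | F ⊆ b ∧ F.Finite}
    with hB
  have hBc : B.Countable := by
    apply Countable.image
    have := Set.countable_ofPred_finite_subset (TopologicalSpace.countable_countableBasis S)
    refine this.mono ?_
    rintro F ⟨h1, h2⟩; exact ⟨h2, h1⟩
  refine TopologicalSpace.IsTopologicalBasis.secondCountableTopology (b := B) ?_ hBc
  refine TopologicalSpace.isTopologicalBasis_of_isOpen_of_nhds ?_ ?_
  · rintro _ ⟨F, ⟨hF, -⟩, rfl⟩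
    exact (hcl _ (isOpen_sUnion fun t ht => hbb.isOpen (hF ht)).isClosed_compl).isOpen_compl
  · intro x U hx hU
    have hK : IsCompact (π ⁻¹' {x}) := (isClosed_singleton.preimage hc).isCompact
    obtain ⟨F, hFs, hFfin, hFc⟩ := hK.elim_finite_subcover_image (b := {t ∈ b | t ⊆ π ⁻¹' U})
      (c := id) (fun t ht => hbb.isOpen ht.1) (by
        intro z hz
        have hzU : z ∈ π ⁻¹' U := by
          have : π z = x := hz
          rw [mem_preimage, this]; exact hx
        obtain ⟨t, ht, hzt, htU⟩ := hbb.exists_subset_of_mem_open hzU (hU.preimage hc)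
        exact mem_biUnion (show t ∈ {t ∈ b | t ⊆ π ⁻¹' U} from ⟨ht, htU⟩) hzt)
    have hFc' : π ⁻¹' {x} ⊆ ⋃₀ F := by
      rw [sUnion_eq_biUnion]; exact hFc
    refine ⟨_, ⟨F, ⟨fun t ht => (hFs ht).1, hFfin⟩, rfl⟩, ?_, ?_⟩
    · rintro ⟨z, hz, hzx⟩
      exact hz (hFc' hzx)
    · intro y hy
      obtain ⟨z, rfl⟩ := hsurj y
      by_contra hzU
      refine hy ⟨z, ?_, rfl⟩
      rintro ⟨t, ht, hzt⟩
      exact hzU ((hFs ht).2 hzt)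

lemma moore_of_map {S : Type*} [TopologicalSpace S] [CompactSpace S]
    [SecondCountableTopology S] [ConnectedSpace S] [LocallyPathConnectedSpace S] (hJ : J1 S)
    [T2Space X] [Nontrivial X] {π : S → X} (hc : Continuous π)
    (hsurj : Function.Surjective π) (hcl : IsClosedMap π)
    (hfib : ∀ x, IsPreconnected (π ⁻¹' {x})) (hfibc : ∀ x, IsPreconnected (π ⁻¹' {x})ᶜ) :
    Moore X := by
  have hlift : ∀ (A : Set X) p q, Jn A (π p) (π q) → Jn (π ⁻¹' A) p q := by
    rintro A p q ⟨C, hC, h1, h2, h3⟩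
    exact ⟨_, preimage_preconn hsurj hcl hfib hC, h1, h2, fun z hz => h3 hz⟩
  have hdesc : ∀ (A : Set X) p q, Jn (π ⁻¹' A) p q → Jn A (π p) (π q) := by
    rintro A p q ⟨C, hC, h1, h2, h3⟩
    refine ⟨_, hC.image π hc.continuousOn, mem_image_of_mem _ h1, mem_image_of_mem _ h2, ?_⟩
    rintro _ ⟨z, hz, rfl⟩; exact h3 hz
  have hq : IsQuotientMap π := hcl.isQuotientMap hc hsurj
  exact
  { toCompactSpace := ⟨by rw [← hsurj.range_eq]; exact isCompact_range hc⟩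
    toSecondCountableTopology := sc_of_closed hc hsurj hcl
    toConnectedSpace := hsurj.connectedSpace hc
    toLocallyPathConnectedSpace := hq.locallyPathConnectedSpace
    j1 := by
      intro A B p q hA hB hAB h1 h2
      obtain ⟨p, rfl⟩ := hsurj p
      obtain ⟨q, rfl⟩ := hsurj q
      apply hdesc
      rw [preimage_union]
      exact hJ _ _ _ _ (hA.preimage hc) (hB.preimage hc)
        (by rw [← preimage_inter]; exact preimage_preconn hsurj hcl hfib hAB)
        (hlift _ _ _ h1) (hlift _ _ _ h2)
    j0 := by
      intro x p q hp hq
      obtain ⟨p, rfl⟩ := hsurj p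
      obtain ⟨q, rfl⟩ := hsurj q
      apply hdesc
      exact ⟨_, hfibc x, hp, hq, subset_rfl⟩ }

end

abbrev Sph' : Type := Metric.sphere (0 : EuclideanSpace ℝ (Fin 3)) 1

lemma sph_charts (q : Sph') :
    ∃ e : OpenPartialHomeomorph Sph' ℂ, e.source = {q}ᶜ ∧ e.target = univ := by
  have : Fact (Module.finrank ℝ (EuclideanSpace ℝ (Fin 3)) = 2 + 1) := ⟨by simp⟩
  let h : EuclideanSpace ℝ (Fin 2) ≃ₜ ℂ := Complex.orthonormalBasisOneI.repr.symm.toHomeomorph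
  refine ⟨(stereographic' 2 q).transHomeomorph h, ?_, ?_⟩
  · simp
  · simp

instance sph_lpc : LocallyPathConnectedSpace Sph' := by
  have : Fact (Module.finrank ℝ (EuclideanSpace ℝ (Fin 3)) = 2 + 1) := ⟨by simp⟩
  exact ChartedSpace.locallyPathConnectedSpace (EuclideanSpace ℝ (Fin 2)) Sph'

instance sph_conn : ConnectedSpace Sph' := by
  have h : 1 < Module.rank ℝ (EuclideanSpace ℝ (Fin 3)) := by
    rw [← Module.finrank_eq_rank]; simp
  exact Subtype.connectedSpace (isConnected_sphere h 0 zero_le_one)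

lemma sph_J1 : J1 Sph' := J1_of_charts sph_charts

instance sph_nontriv : Nontrivial Sph' := by
  refine ⟨⟨EuclideanSpace.single 0 1, by simp⟩, ⟨EuclideanSpace.single 1 1, by simp⟩, ?_⟩
  intro hh
  have := congrArg (fun v : Sph' => v.1 0) hh
  simp at this

lemma sph_compl (x : Sph') : IsPreconnected ({x}ᶜ : Set Sph') := by
  obtain ⟨e, hs, ht⟩ := sph_charts x
  have : e.symm '' univ = {x}ᶜ := by rw [← ht, e.symm_image_target_eq_source, hs]
  rw [← this]
  exact isPreconnected_univ.image _ (by rw [← ht]; exact e.symm.continuousOn)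

lemma sph_moore : Moore Sph' :=
  moore_of_map sph_J1 continuous_id Function.surjective_id IsClosedMap.id
    (fun x => by simpa using isPreconnected_singleton) (fun x => by simpa using sph_compl x)

lemma quot_moore (s : Setoid Sph')
    (hcompact : ∀ C ∈ s.classes, IsCompact C)
    (hconn : ∀ C ∈ s.classes, IsConnected C)
    (hcompl : ∀ C ∈ s.classes, IsConnected Cᶜ)
    (husc : ∀ A ∈ s.classes, ∀ U : Set Sph', IsOpen U → A ⊆ U →
    ∃ V : Set Sph', IsOpen V ∧ A ⊆ V ∧ ∀ B ∈ s.classes, (B ∩ V).Nonempty → B ⊆ U)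
    (hnontriv : ¬ ∀ x y : Sph', s.r x y) : Moore (Quotient s) := by
  set π : Sph' → Quotient s := Quotient.mk s with hπ
  have hc : Continuous π := continuous_quotient_mk'
  have hsurj : Function.Surjective π := Quotient.mk_surjective
  have hcls : ∀ x, π ⁻¹' {π x} = {y | s y x} := by
    intro x; ext y; exact Quotient.eq
  have hmem : ∀ x, π ⁻¹' {x} ∈ s.classes := by
    intro x; obtain ⟨x, rfl⟩ := hsurj x
    rw [hcls]; exact s.mem_classes x
  have hcl : IsClosedMap π := by
    intro F hF
    rw [← (isQuotientMap_quotient_mk' (s := s)).isClosed_preimage, ← isOpen_compl_iff,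
      isOpen_iff_mem_nhds]
    intro x hx
    have hsub : π ⁻¹' {π x} ⊆ Fᶜ := fun y hy hyF => hx ⟨y, hyF, hy⟩
    obtain ⟨V, hV, hAV, hVB⟩ := husc _ (hmem (π x)) Fᶜ hF.isOpen_compl hsub
    refine mem_of_superset (hV.mem_nhds (hAV rfl)) ?_
    rintro y hy ⟨z, hz, hzy⟩
    exact hVB _ (hmem (π y)) ⟨y, rfl, hy⟩ hzy hz
  have : T2Space (Quotient s) := by
    constructor
    intro x y hxy
    have hd : Disjoint (π ⁻¹' {x}) (π ⁻¹' {y}) := by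
      rw [disjoint_left]; intro z hz hz'; exact hxy (hz.symm.trans hz')
    obtain ⟨U, V, hU, hV, hxU, hyV, hUV⟩ := SeparatedNhds.of_isCompact_isCompact
      (hcompact _ (hmem x)) (hcompact _ (hmem y)) hd
    refine ⟨(π '' Uᶜ)ᶜ, (π '' Vᶜ)ᶜ, (hcl _ hU.isClosed_compl).isOpen_compl,
      (hcl _ hV.isClosed_compl).isOpen_compl, ?_, ?_, ?_⟩
    · rintro ⟨z, hz, hzx⟩; exact hz (hxU hzx)
    · rintro ⟨z, hz, hzx⟩; exact hz (hyV hzx)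
    · rw [disjoint_left]
      intro w h1 h2
      obtain ⟨z, rfl⟩ := hsurj w
      have hzU : z ∈ U := by by_contra h; exact h1 ⟨z, h, rfl⟩
      have hzV : z ∈ V := by by_contra h; exact h2 ⟨z, h, rfl⟩
      exact disjoint_left.1 hUV hzU hzV
  have : Nontrivial (Quotient s) := by
    push Not at hnontriv
    obtain ⟨x, y, hxy⟩ := hnontriv
    exact ⟨π x, π y, fun h => hxy (Quotient.exact h)⟩
  exact moore_of_map sph_J1 hc hsurj hcl (fun x => (hconn _ (hmem x)).isPreconnected)
    (fun x => (hcompl _ (hmem x)).isPreconnected)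

end MQ


namespace MQ

section
variable {X : Type*} [TopologicalSpace X]

def IsArc (A : Set X) (a b : X) : Prop :=
  ∃ f : ℝ → X, ContinuousOn f (Icc 0 1) ∧ InjOn f (Icc 0 1) ∧ f '' Icc 0 1 = A ∧ f 0 = a ∧ f 1 = b

lemma IsArc.of_Icc {f : ℝ → X} {s t : ℝ} (hst : s < t) (hc : ContinuousOn f (Icc s t))
    (hi : InjOn f (Icc s t)) : IsArc (f '' Icc s t) (f s) (f t) := by
  have himg : (fun u : ℝ => (t - s) * u + s) '' Icc 0 1 = Icc s t := by
    rw [image_affine_Icc' (sub_pos.2 hst)]; simp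
  refine ⟨f ∘ (fun u => (t - s) * u + s), ?_, ?_, ?_, by simp, by simp⟩
  · exact hc.comp (by fun_prop) (by rw [mapsTo_iff_image_subset, himg])
  · refine hi.comp ?_ (by rw [mapsTo_iff_image_subset, himg])
    intro u _ v _ h
    simpa [sub_ne_zero.2 hst.ne'] using h
  · rw [image_comp, himg]

lemma IsArc.symm {A : Set X} {a b : X} : IsArc A a b → IsArc A b a := by
  rintro ⟨f, hc, hi, rfl, rfl, rfl⟩
  have himg : (fun u : ℝ => 1 - u) '' Icc 0 1 = Icc 0 1 := by simp
  refine ⟨f ∘ (fun u => 1 - u), ?_, ?_, ?_, by simp, by simp⟩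
  · exact hc.comp (by fun_prop) (by rw [mapsTo_iff_image_subset, himg])
  · refine hi.comp ?_ (by rw [mapsTo_iff_image_subset, himg])
    intro u _ v _ h
    simpa using h
  · rw [image_comp, himg]

lemma IsArc.image {Y : Type*} [TopologicalSpace Y] {A : Set X} {a b : X} (h : IsArc A a b)
    {g : X → Y} (hg : ContinuousOn g A) (hi : InjOn g A) : IsArc (g '' A) (g a) (g b) := by
  obtain ⟨f, hc, hi', rfl, rfl, rfl⟩ := h
  refine ⟨g ∘ f, hg.comp hc (mapsTo_image _ _), hi.comp hi' (mapsTo_image _ _), ?_, rfl, rfl⟩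
  rw [image_comp]

lemma IsArc.isCompact {A : Set X} {a b : X} : IsArc A a b → IsCompact A := by
  rintro ⟨f, hc, hi, rfl, rfl, rfl⟩
  exact isCompact_Icc.image_of_continuousOn hc

lemma IsArc.isClosed [T2Space X] {A : Set X} {a b : X} (h : IsArc A a b) : IsClosed A :=
  h.isCompact.isClosed

lemma IsArc.preconn {A : Set X} {a b : X} : IsArc A a b → IsPreconnected A := by
  rintro ⟨f, hc, hi, rfl, rfl, rfl⟩
  exact isPreconnected_Icc.image _ hc

lemma IsArc.left {A : Set X} {a b : X} : IsArc A a b → a ∈ A := by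
  rintro ⟨f, hc, hi, rfl, rfl, rfl⟩
  exact mem_image_of_mem _ (by simp)

lemma IsArc.right {A : Set X} {a b : X} (h : IsArc A a b) : b ∈ A := h.symm.left

lemma IsArc.ne {A : Set X} {a b : X} : IsArc A a b → a ≠ b := by
  rintro ⟨f, hc, hi, rfl, rfl, rfl⟩ h
  have := hi (by simp) (by simp) h
  norm_num at this

lemma arc_Ioo {f : ℝ → X} (hi : InjOn f (Icc 0 1)) :
    f '' Icc 0 1 \ {f 0, f 1} = f '' Ioo 0 1 := by
  ext x
  constructor
  · rintro ⟨⟨u, hu, rfl⟩, h⟩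
    refine ⟨u, ⟨lt_of_le_of_ne hu.1 ?_, lt_of_le_of_ne hu.2 ?_⟩, rfl⟩
    · rintro rfl; exact h (by simp)
    · rintro rfl; exact h (by simp)
  · rintro ⟨u, hu, rfl⟩
    refine ⟨⟨u, Ioo_subset_Icc_self hu, rfl⟩, ?_⟩
    rintro (h | h)
    · exact hu.1.ne' (hi (Ioo_subset_Icc_self hu) (by simp) h)
    · exact hu.2.ne (hi (Ioo_subset_Icc_self hu) (by simp) h)

lemma IsArc.ioo_preconn {A : Set X} {a b : X} : IsArc A a b → IsPreconnected (A \ {a, b}) := by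
  rintro ⟨f, hc, hi, rfl, rfl, rfl⟩
  rw [arc_Ioo hi]
  exact isPreconnected_Ioo.image _ (hc.mono Ioo_subset_Icc_self)

lemma IsArc.ioo_nonempty {A : Set X} {a b : X} : IsArc A a b → (A \ {a, b}).Nonempty := by
  rintro ⟨f, hc, hi, rfl, rfl, rfl⟩
  rw [arc_Ioo hi]
  exact (nonempty_Ioo.2 one_pos).image _

lemma IsArc.subset_closure_ioo {A : Set X} {a b : X} : IsArc A a b → A ⊆ closure (A \ {a, b}) := by
  rintro ⟨f, hc, hi, rfl, rfl, rfl⟩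
  rw [arc_Ioo hi]
  have : Icc (0 : ℝ) 1 = closure (Ioo 0 1) := (closure_Ioo (by norm_num)).symm
  rw [this] at hc ⊢
  exact hc.image_closure

lemma IsArc.split {A : Set X} {a b x : X} (h : IsArc A a b) (hx : x ∈ A) (hxa : x ≠ a)
    (hxb : x ≠ b) : ∃ A1 A2, IsArc A1 a x ∧ IsArc A2 x b ∧ A = A1 ∪ A2 ∧ A1 ∩ A2 = {x} := by
  obtain ⟨f, hc, hi, rfl, rfl, rfl⟩ := h
  obtain ⟨t, ht, rfl⟩ := hx
  have h0 : 0 < t := lt_of_le_of_ne ht.1 (by rintro rfl; exact hxa rfl)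
  have h1 : t < 1 := lt_of_le_of_ne ht.2 (by rintro rfl; exact hxb rfl)
  have s1 : Icc 0 t ⊆ Icc (0:ℝ) 1 := Icc_subset_Icc le_rfl ht.2
  have s2 : Icc t 1 ⊆ Icc (0:ℝ) 1 := Icc_subset_Icc ht.1 le_rfl
  refine ⟨f '' Icc 0 t, f '' Icc t 1, IsArc.of_Icc h0 (hc.mono s1) (hi.mono s1),
    IsArc.of_Icc h1 (hc.mono s2) (hi.mono s2), ?_, ?_⟩
  · rw [← image_union, Icc_union_Icc_eq_Icc ht.1 ht.2]
  · rw [← hi.image_inter s1 s2, Icc_inter_Icc_eq_singleton ht.1 ht.2, image_singleton]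

lemma glue {f g : ℝ → X} (hf : ContinuousOn f (Icc 0 1)) (hg : ContinuousOn g (Icc 0 1))
    (h : f 1 = g 0) : ∃ k : ℝ → X, ContinuousOn k (Icc 0 2) ∧ (∀ t ∈ Icc (0:ℝ) 1, k t = f t) ∧
      ∀ t ∈ Icc (1:ℝ) 2, k t = g (t - 1) := by
  set k : ℝ → X := fun t => if t ≤ 1 then f t else g (t - 1)
  have h1 : ∀ t ∈ Icc (0:ℝ) 1, k t = f t := fun t ht => if_pos ht.2
  have h2 : ∀ t ∈ Icc (1:ℝ) 2, k t = g (t - 1) := by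
    intro t ht
    rcases eq_or_lt_of_le ht.1 with rfl | h'
    · rw [h1 1 (by simp), h]; simp
    · exact if_neg (not_le.2 h')
  refine ⟨k, ?_, h1, h2⟩
  have hu : Icc (0:ℝ) 2 = Icc 0 1 ∪ Icc 1 2 :=
    (Icc_union_Icc_eq_Icc (by norm_num) (by norm_num)).symm
  rw [hu]
  refine ContinuousOn.union_of_isClosed ?_ ?_ isClosed_Icc isClosed_Icc
  · exact hf.congr h1
  · refine ContinuousOn.congr (hg.comp (f := fun t => t - 1) (by fun_prop) ?_) h2
    intro t ht; constructor <;> linarith [ht.1, ht.2]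

lemma shift_mem {t : ℝ} (ht : t ∈ Icc (1:ℝ) 2) : t - 1 ∈ Icc (0:ℝ) 1 := by
  constructor <;> linarith [ht.1, ht.2]

lemma image_glue1 {k f : ℝ → X} (h1 : ∀ t ∈ Icc (0:ℝ) 1, k t = f t) :
    k '' Icc 0 1 = f '' Icc 0 1 := image_congr h1

lemma image_glue2 {k g : ℝ → X} (h2 : ∀ t ∈ Icc (1:ℝ) 2, k t = g (t - 1)) :
    k '' Icc 1 2 = g '' Icc 0 1 := by
  ext x; constructor
  · rintro ⟨t, ht, rfl⟩; exact ⟨t - 1, shift_mem ht, (h2 t ht).symm⟩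
  · rintro ⟨t, ht, rfl⟩
    have : t + 1 ∈ Icc (1:ℝ) 2 := by constructor <;> linarith [ht.1, ht.2]
    exact ⟨t + 1, this, by rw [h2 _ this]; simp⟩

lemma Icc02 : Icc (0:ℝ) 2 = Icc 0 1 ∪ Icc 1 2 :=
  (Icc_union_Icc_eq_Icc (by norm_num) (by norm_num)).symm

lemma IsArc.concat {A B : Set X} {a b c : X} (hA : IsArc A a b) (hB : IsArc B b c)
    (hAB : A ∩ B ⊆ {b}) : IsArc (A ∪ B) a c := by
  obtain ⟨f, hf, hfi, rfl, rfl, rfl⟩ := hA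
  obtain ⟨g, hg, hgi, rfl, hg0, rfl⟩ := hB
  obtain ⟨k, hk, h1, h2⟩ := glue hf hg hg0.symm
  have hne : ∀ s ∈ Icc (0:ℝ) 1, ∀ t ∈ Icc (1:ℝ) 2, k s = k t → s = t := by
    intro s hs t ht he
    rw [h1 s hs, h2 t ht] at he
    have hb : f s ∈ ({f 1} : Set X) :=
      hAB ⟨mem_image_of_mem _ hs, by rw [he]; exact mem_image_of_mem _ (shift_mem ht)⟩
    have hs1 : s = 1 := hfi hs (by simp) hb
    rw [hb, ← hg0] at he
    have := hgi (by simp) (shift_mem ht) he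
    linarith
  have hi : InjOn k (Icc 0 2) := by
    rw [Icc02]
    rintro s (hs | hs) t (ht | ht) he
    · rw [h1 s hs, h1 t ht] at he; exact hfi hs ht he
    · exact hne s hs t ht he
    · exact (hne t ht s hs he.symm).symm
    · rw [h2 s hs, h2 t ht] at he
      have := hgi (shift_mem hs) (shift_mem ht) he
      linarith
  have := IsArc.of_Icc (by norm_num) hk hi
  rw [Icc02, image_union, image_glue1 h1, image_glue2 h2, h1 0 (by simp), h2 2 (by norm_num)] at this
  convert this using 2; norm_num

def IsLoop (J : Set X) : Prop :=
  ∃ a b A B, IsArc A a b ∧ IsArc B a b ∧ A ∩ B = {a, b} ∧ J = A ∪ B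

lemma IsLoop.resplit {J : Set X} (h : IsLoop J) {x y : X} (hx : x ∈ J) (hy : y ∈ J) (hxy : x ≠ y) :
    ∃ A B, IsArc A x y ∧ IsArc B x y ∧ A ∩ B = {x, y} ∧ J = A ∪ B := by
  obtain ⟨a, b, A, B, hA, hB, hAB, rfl⟩ := h
  replace hB := hB.symm
  obtain ⟨f, hf, hfi, rfl, rfl, rfl⟩ := hA
  obtain ⟨g, hg, hgi, rfl, hg0, hg1⟩ := hB
  obtain ⟨k, hk, h1, h2⟩ := glue hf hg hg0.symm
  have hk2 : k 2 = k 0 := by rw [h1 0 (by simp), h2 2 (by norm_num), ← hg1]; norm_num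
  have hne : ∀ s ∈ Icc (0:ℝ) 1, ∀ t ∈ Icc (1:ℝ) 2, k s = k t → s = t ∨ (s = 0 ∧ t = 2) := by
    intro s hs t ht he
    rw [h1 s hs, h2 t ht] at he
    have hb : f s ∈ ({f 0, f 1} : Set X) := by
      rw [← hAB]
      exact ⟨mem_image_of_mem _ hs, by rw [he]; exact mem_image_of_mem _ (shift_mem ht)⟩
    rcases hb with hb | hb
    · have hs1 : s = 0 := hfi hs (by simp) hb
      rw [hb, ← hg1] at he
      have := hgi (by simp) (shift_mem ht) he
      right; exact ⟨hs1, by linarith⟩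
    · have hs1 : s = 1 := hfi hs (by simp) hb
      rw [hb, ← hg0] at he
      have := hgi (by simp) (shift_mem ht) he
      left; linarith
  have hi : ∀ s ∈ Icc (0:ℝ) 2, ∀ t ∈ Icc (0:ℝ) 2, k s = k t →
      s = t ∨ (s = 0 ∧ t = 2) ∨ (s = 2 ∧ t = 0) := by
    rw [Icc02]
    rintro s (hs | hs) t (ht | ht) he
    · rw [h1 s hs, h1 t ht] at he; exact Or.inl (hfi hs ht he)
    · rcases hne s hs t ht he with h | h <;> tauto
    · rcases hne t ht s hs he.symm with h | h
      · exact Or.inl h.symm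
      · tauto
    · rw [h2 s hs, h2 t ht] at he
      have := hgi (shift_mem hs) (shift_mem ht) he
      left; linarith
  have hJ : f '' Icc 0 1 ∪ g '' Icc 0 1 = k '' Icc 0 2 := by
    rw [Icc02, image_union, image_glue1 h1, image_glue2 h2]
  rw [hJ] at hx hy ⊢
  clear hne hJ h1 h2 hf hg hfi hgi hg0 hg1 hAB f g
  have hrep : ∀ x ∈ k '' Icc 0 2, ∃ s ∈ Ico (0:ℝ) 2, k s = x := by
    rintro _ ⟨s, hs, rfl⟩
    rcases eq_or_lt_of_le hs.2 with rfl | h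
    · exact ⟨0, by simp, hk2.symm⟩
    · exact ⟨s, ⟨hs.1, h⟩, rfl⟩
  have main : ∀ s ∈ Ico (0:ℝ) 2, ∀ t ∈ Ico (0:ℝ) 2, s < t → ∃ A B, IsArc A (k s) (k t) ∧
      IsArc B (k s) (k t) ∧ A ∩ B = {k s, k t} ∧ k '' Icc 0 2 = A ∪ B := by
    rintro s ⟨hs0, hs2⟩ t ⟨ht0, ht2⟩ hst
    have hinj : ∀ u v, 0 ≤ u → v ≤ 2 → (0 < u ∨ v < 2) → InjOn k (Icc u v) := by
      intro u v hu hv huv x hx y hy he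
      rcases hi x ⟨hu.trans hx.1, hx.2.trans hv⟩ y ⟨hu.trans hy.1, hy.2.trans hv⟩ he with
        h | ⟨h, h'⟩ | ⟨h, h'⟩
      · exact h
      · exfalso; rcases huv with h'' | h'' <;> linarith [hx.1, hy.2]
      · exfalso; rcases huv with h'' | h'' <;> linarith [hy.1, hx.2]
    have hA := IsArc.of_Icc hst (hk.mono (Icc_subset_Icc hs0 ht2.le)) (hinj s t hs0 ht2.le (Or.inr ht2))
    have hB := IsArc.of_Icc ht2 (hk.mono (Icc_subset_Icc ht0 le_rfl))
      (hinj t 2 ht0 le_rfl (Or.inl (by linarith)))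
    rw [hk2] at hB
    have hBarc : IsArc (k '' Icc t 2 ∪ k '' Icc 0 s) (k t) (k s) := by
      rcases eq_or_lt_of_le hs0 with rfl | hs0'
      · have : k '' Icc t 2 ∪ k '' Icc 0 0 = k '' Icc t 2 := by
          refine union_eq_left.2 ?_
          rintro _ ⟨u, hu, rfl⟩
          have : u = 0 := le_antisymm hu.2 hu.1
          exact ⟨2, ⟨ht2.le, le_rfl⟩, by rw [hk2, this]⟩
        rw [this]; exact hB
      · have hC := IsArc.of_Icc hs0' (hk.mono (Icc_subset_Icc le_rfl hs2.le))
          (hinj 0 s le_rfl hs2.le (Or.inr hs2))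
        refine hB.concat hC ?_
        rintro _ ⟨⟨u, hu, rfl⟩, v, hv, he⟩
        rcases hi v ⟨hv.1, hv.2.trans hs2.le⟩ u ⟨ht0.trans hu.1, hu.2⟩ he with
          h | ⟨h, h'⟩ | ⟨h, h'⟩
        · linarith [hv.2, hu.1]
        · rw [h', hk2]; rfl
        · linarith [hv.2, hu.1]
    refine ⟨_, _, hA, hBarc.symm, ?_, ?_⟩
    · apply subset_antisymm
      · rintro _ ⟨⟨u, hu, rfl⟩, ⟨v, hv, he⟩ | ⟨v, hv, he⟩⟩
        · rcases hi v ⟨ht0.trans hv.1, hv.2⟩ u ⟨hs0.trans hu.1, hu.2.trans ht2.le⟩ he with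
            h | ⟨h, h'⟩ | ⟨h, h'⟩
          · right; rw [show u = t by linarith [hv.1, hu.2]]; rfl
          · linarith [hu.2, hv.1]
          · left; rw [show u = s by linarith [hu.1]]
        · rcases hi v ⟨hv.1, hv.2.trans hs2.le⟩ u ⟨hs0.trans hu.1, hu.2.trans ht2.le⟩ he with
            h | ⟨h, h'⟩ | ⟨h, h'⟩
          · left; rw [show u = s by linarith [hv.2, hu.1]]
          · linarith [hu.2]
          · linarith [hv.2]
      · rintro _ (rfl | rfl)
        · exact ⟨hA.left, hBarc.right⟩
        · exact ⟨hA.right, hBarc.left⟩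
    · rw [← image_union, ← image_union]
      congr 1
      ext u; constructor
      · rintro ⟨h1, h2⟩
        rcases le_total u s with h | h
        · right; right; exact ⟨h1, h⟩
        · rcases le_total u t with h' | h'
          · left; exact ⟨h, h'⟩
          · right; left; exact ⟨h', h2⟩
      · rintro (h | h | h) <;> constructor <;> linarith [h.1, h.2]
  obtain ⟨s, hs, rfl⟩ := hrep x hx
  obtain ⟨t, ht, rfl⟩ := hrep y hy
  rcases lt_trichotomy s t with h | h | h
  · exact main s hs t ht h
  · exact (hxy (by rw [h])).elim
  · obtain ⟨A, B, h1, h2, h3, h4⟩ := main t ht s hs h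
    exact ⟨A, B, h1.symm, h2.symm, by rw [h3, pair_comm], h4⟩

end
end MQ


namespace MQ

section
variable {X : Type*} [TopologicalSpace X]

def Good (f : ℝ → X) (O : Set ℝ) : Prop :=
  ∀ s ∈ O, ∃ c d, 0 ≤ c ∧ d ≤ 1 ∧ c < s ∧ s < d ∧ Ioo c d ⊆ O ∧ c ∉ O ∧ d ∉ O ∧ f c = f d

lemma Good.isOpen {f : ℝ → X} {O : Set ℝ} (h : Good f O) : IsOpen O := by
  rw [isOpen_iff_mem_nhds]
  intro s hs
  obtain ⟨c, d, -, -, h1, h2, h3, -⟩ := h s hs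
  exact mem_of_superset (Ioo_mem_nhds h1 h2) h3

lemma Good.zero {f : ℝ → X} {O : Set ℝ} (h : Good f O) {s : ℝ} (hs : s ∈ O) : 0 < s ∧ s < 1 := by
  obtain ⟨c, d, h0, h0', h1, h2, h3, -⟩ := h s hs
  constructor <;> linarith

lemma exists_cc {O : Set ℝ} (hO : IsOpen O) {u : ℝ} (h : ∃ v ≤ u, v ∉ O) :
    ∃ c, c ≤ u ∧ c ∉ O ∧ ∀ v ≤ u, v ∉ O → v ≤ c := by
  set S := {v | v ≤ u ∧ v ∉ O}
  have hS : IsClosed S := isClosed_Iic.inter hO.isClosed_compl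
  have hb : BddAbove S := ⟨u, fun v hv => hv.1⟩
  have hne : S.Nonempty := by obtain ⟨v, h1, h2⟩ := h; exact ⟨v, h1, h2⟩
  have := hS.csSup_mem hne hb
  exact ⟨sSup S, this.1, this.2, fun v h1 h2 => le_csSup hb ⟨h1, h2⟩⟩

lemma exists_dd {O : Set ℝ} (hO : IsOpen O) {u : ℝ} (h : ∃ v, u ≤ v ∧ v ∉ O) :
    ∃ c, u ≤ c ∧ c ∉ O ∧ ∀ v, u ≤ v → v ∉ O → c ≤ v := by
  set S := {v | u ≤ v ∧ v ∉ O}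
  have hS : IsClosed S := isClosed_Ici.inter hO.isClosed_compl
  have hb : BddBelow S := ⟨u, fun v hv => hv.1⟩
  have hne : S.Nonempty := by obtain ⟨v, h1, h2⟩ := h; exact ⟨v, h1, h2⟩
  have := hS.csInf_mem hne hb
  exact ⟨sInf S, this.1, this.2, fun v h1 h2 => csInf_le hb ⟨h1, h2⟩⟩

lemma exists_max_good [T2Space X] {f : ℝ → X} (hf : Continuous f) :
    ∃ O, Maximal (· ∈ {O | Good f O}) O := by
  refine zorn_subset _ ?_
  intro 𝒞 h𝒞 hch
  refine ⟨⋃₀ 𝒞, ?_, fun s hs => subset_sUnion_of_mem hs⟩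
  have hO : IsOpen (⋃₀ 𝒞) := isOpen_sUnion fun t ht => (h𝒞 ht).isOpen
  have h01 : ∀ s ∈ ⋃₀ 𝒞, 0 < s ∧ s < 1 := by
    rintro s ⟨t, ht, hs⟩; exact (h𝒞 ht).zero hs
  have h0 : (0:ℝ) ∉ ⋃₀ 𝒞 := fun h => lt_irrefl _ (h01 _ h).1
  have h1 : (1:ℝ) ∉ ⋃₀ 𝒞 := fun h => lt_irrefl _ (h01 _ h).2
  intro s hs
  obtain ⟨c, hcs, hcO, hc⟩ := exists_cc hO (u := s) ⟨0, (h01 s hs).1.le, h0⟩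
  obtain ⟨d, hds, hdO, hd⟩ := exists_dd hO (u := s) ⟨1, (h01 s hs).2.le, h1⟩
  have hcs' : c < s := lt_of_le_of_ne hcs (by rintro rfl; exact hcO hs)
  have hds' : s < d := lt_of_le_of_ne hds (by rintro rfl; exact hdO hs)
  have hsub : Ioo c d ⊆ ⋃₀ 𝒞 := by
    intro v hv
    by_contra hvO
    rcases le_total v s with h | h
    · exact absurd (hc v h hvO) (not_le.2 hv.1)
    · exact absurd (hd v h hvO) (not_le.2 hv.2)
  refine ⟨c, d, hc 0 (h01 s hs).1.le h0, hd 1 (h01 s hs).2.le h1, hcs', hds', hsub, hcO, hdO, ?_⟩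
  by_contra hne
  obtain ⟨U, V, hU, hV, hcU, hdV, hUV⟩ := t2_separation hne
  obtain ⟨ε1, he1, hε1⟩ := Metric.isOpen_iff.1 (hU.preimage hf) c hcU
  obtain ⟨ε2, he2, hε2⟩ := Metric.isOpen_iff.1 (hV.preimage hf) d hdV
  set ε := min (min ε1 ε2) (min (s - c) (d - s)) / 2 with hε
  have hpos : 0 < min (min ε1 ε2) (min (s - c) (d - s)) := by
    simp only [lt_min_iff]; refine ⟨⟨he1, he2⟩, ?_, ?_⟩ <;> linarith
  have hεpos : 0 < ε := by positivity
  have l1 : ε < ε1 := by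
    have : min (min ε1 ε2) (min (s - c) (d - s)) ≤ ε1 := (min_le_left _ _).trans (min_le_left _ _)
    linarith
  have l2 : ε < ε2 := by
    have : min (min ε1 ε2) (min (s - c) (d - s)) ≤ ε2 := (min_le_left _ _).trans (min_le_right _ _)
    linarith
  have l3 : ε < s - c := by
    have : min (min ε1 ε2) (min (s - c) (d - s)) ≤ s - c :=
      (min_le_right _ _).trans (min_le_left _ _)
    linarith
  have l4 : ε < d - s := by
    have : min (min ε1 ε2) (min (s - c) (d - s)) ≤ d - s :=
      (min_le_right _ _).trans (min_le_right _ _)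
    linarith
  obtain ⟨t0, ht0, hst0⟩ := hs
  have : Nonempty 𝒞 := ⟨⟨t0, ht0⟩⟩
  obtain ⟨⟨Oi, hOi⟩, hsubi⟩ := (isCompact_Icc (a := c + ε) (b := d - ε)).elim_directed_cover
    (fun t : 𝒞 => (t : Set ℝ)) (fun t => (h𝒞 t.2).isOpen)
    (by rw [← sUnion_eq_iUnion]
        exact fun v hv => hsub ⟨by linarith [hv.1], by linarith [hv.2]⟩)
    hch.directedOn.directed_val
  simp only at hsubi
  obtain ⟨ci, di, -, -, hci, hdi, hgi, hciO, hdiO, hfi⟩ :=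
    h𝒞 hOi s (hsubi ⟨by linarith, by linarith⟩)
  have hOsub : Oi ⊆ ⋃₀ 𝒞 := subset_sUnion_of_mem hOi
  have a1 : c ≤ ci := by
    by_contra h
    exact hcO (hOsub (hgi ⟨not_le.1 h, by linarith⟩))
  have a2 : di ≤ d := by
    by_contra h
    exact hdO (hOsub (hgi ⟨by linarith, not_le.1 h⟩))
  have a3 : ci < c + ε := by
    by_contra h
    exact hciO (hsubi ⟨not_lt.1 h, by linarith⟩)
  have a4 : d - ε < di := by
    by_contra h
    exact hdiO (hsubi ⟨by linarith, not_lt.1 h⟩)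
  have b1 : f ci ∈ U := hε1 (by rw [Metric.mem_ball, Real.dist_eq, abs_lt]; constructor <;> linarith)
  have b2 : f di ∈ V := hε2 (by rw [Metric.mem_ball, Real.dist_eq, abs_lt]; constructor <;> linarith)
  exact disjoint_left.1 hUV b1 (hfi ▸ b2)

lemma mono_path [T2Space X] {f : ℝ → X} (hf : Continuous f) :
    ∃ g : ℝ → X, ContinuousOn g (Icc 0 1) ∧ g 0 = f 0 ∧ g 1 = f 1 ∧
      g '' Icc 0 1 ⊆ f '' Icc 0 1 ∧
      ∀ s v t, 0 ≤ s → s ≤ v → v ≤ t → t ≤ 1 → g s = g t → g v = g s := by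
  obtain ⟨O, hmax⟩ := exists_max_good hf
  have hG : Good f O := hmax.prop
  have hO := hG.isOpen
  have h0 : (0:ℝ) ∉ O := fun h => lt_irrefl _ (hG.zero h).1
  have h1 : (1:ℝ) ∉ O := fun h => lt_irrefl _ (hG.zero h).2
  have hinj : ∀ s t, 0 ≤ s → s < t → t ≤ 1 → s ∉ O → t ∉ O → f s = f t → Ioo s t ⊆ O := by
    intro s t hs hst ht hsO htO hfe
    have : Good f (O ∪ Ioo s t) := by
      rintro x (hx | hx)
      · by_cases hxi : x ∈ Ioo s t
        · exact ⟨s, t, hs, ht, hxi.1, hxi.2, subset_union_right, by simp [hsO], by simp [htO], hfe⟩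
        · obtain ⟨c, d, hc0, hd1, hcx, hxd, hsub, hcO, hdO, he⟩ := hG x hx
          refine ⟨c, d, hc0, hd1, hcx, hxd, hsub.trans subset_union_left, ?_, ?_, he⟩
          · rintro (h | h)
            · exact hcO h
            · exact htO (hsub ⟨h.2, by
                by_contra h'
                exact hxi ⟨by linarith [h.1], by linarith⟩⟩)
          · rintro (h | h)
            · exact hdO h
            · exact hsO (hsub ⟨by
                by_contra h'
                exact hxi ⟨by linarith, by linarith [h.2]⟩, h.1⟩)
      · exact ⟨s, t, hs, ht, hx.1, hx.2, subset_union_right, by simp [hsO], by simp [htO], hfe⟩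
    exact subset_union_right.trans (hmax.2 this subset_union_left)
  have hcc : ∀ u : ℝ, ∃ c, 0 ≤ u → (c ≤ u ∧ c ∉ O ∧ ∀ v ≤ u, v ∉ O → v ≤ c) := by
    intro u
    by_cases hu : 0 ≤ u
    · obtain ⟨c, hc⟩ := exists_cc hO (u := u) ⟨0, hu, h0⟩
      exact ⟨c, fun _ => hc⟩
    · exact ⟨0, fun h => (hu h).elim⟩
  choose cc hcc using hcc
  have cc_self : ∀ u, 0 ≤ u → u ∉ O → cc u = u := fun u hu huO =>
    le_antisymm (hcc u hu).1 ((hcc u hu).2.2 u le_rfl huO)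
  have cc_nn : ∀ u, 0 ≤ u → 0 ≤ cc u := fun u hu => (hcc u hu).2.2 0 hu h0
  have cc_gap : ∀ c d v, 0 ≤ c → Ioo c d ⊆ O → c ∉ O → c < v → v < d → cc v = c := by
    intro c d v hc hsub hcO hcv hvd
    have := hcc v (by linarith)
    refine le_antisymm ?_ (this.2.2 c hcv.le hcO)
    by_contra h
    exact this.2.1 (hsub ⟨not_le.1 h, by linarith [this.1]⟩)
  have cc_mono : ∀ u v, 0 ≤ u → u ≤ v → cc u ≤ cc v := fun u v hu huv =>
    (hcc v (hu.trans huv)).2.2 _ ((hcc u hu).1.trans huv) (hcc u hu).2.1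
  have hbet : ∀ u v, 0 ≤ u → 0 ≤ v → u ∉ O → ∃ w ∈ uIcc u v, f w = f (cc v) := by
    intro u v hu hv huO
    rcases le_total u v with h | h
    · exact ⟨cc v, by rw [uIcc_of_le h]; exact ⟨(hcc v hv).2.2 u h huO, (hcc v hv).1⟩, rfl⟩
    · by_cases hvO : v ∈ O
      · obtain ⟨c, d, hc0, hd1, hcx, hxd, hsub, hcO, hdO, he⟩ := hG v hvO
        refine ⟨d, ?_, ?_⟩
        · rw [uIcc_of_ge h]
          refine ⟨hxd.le, ?_⟩
          by_contra h'
          exact huO (hsub ⟨by linarith, not_le.1 h'⟩)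
        · rw [cc_gap c d v hc0 hsub hcO hcx hxd, he]
      · exact ⟨v, right_mem_uIcc, by rw [cc_self v hv hvO]⟩
  refine ⟨f ∘ cc, ?_, ?_, ?_, ?_, ?_⟩
  · intro u hu
    by_cases huO : u ∈ O
    · obtain ⟨c, d, hc0, hd1, hcx, hxd, hsub, hcO, hdO, he⟩ := hG u huO
      have : (f ∘ cc) =ᶠ[𝓝 u] fun _ => f c := by
        filter_upwards [Ioo_mem_nhds hcx hxd] with v hv
        simp only [Function.comp, cc_gap c d v hc0 hsub hcO hv.1 hv.2]
      exact (continuousAt_const.congr this.symm).continuousWithinAt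
    · have hcu := cc_self u hu.1 huO
      intro N hN
      simp only [Function.comp, hcu] at hN
      obtain ⟨ε, hε, hb⟩ := Metric.mem_nhds_iff.1 (hf.continuousAt hN)
      rw [mem_map, mem_nhdsWithin_iff_exists_mem_nhds_inter]
      refine ⟨_, Metric.ball_mem_nhds u hε, ?_⟩
      rintro v ⟨hv, hv0⟩
      obtain ⟨w, hw, hwe⟩ := hbet u v hu.1 hv0.1 huO
      have : w ∈ Metric.ball u ε := by
        rw [Real.ball_eq_Ioo] at hv ⊢
        exact (ordConnected_Ioo.uIcc_subset ⟨by linarith, by linarith⟩ hv) hw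
      have := hb this
      simp only [mem_preimage, Function.comp] at this ⊢
      rwa [← hwe]
  · simp only [Function.comp, cc_self 0 le_rfl h0]
  · simp only [Function.comp, cc_self 1 zero_le_one h1]
  · rintro _ ⟨u, hu, rfl⟩
    exact ⟨cc u, ⟨cc_nn u hu.1, (hcc u hu.1).1.trans hu.2⟩, rfl⟩
  · intro s v t hs hsv hvt ht he
    simp only [Function.comp] at he ⊢
    have m1 := cc_mono s v hs hsv
    have m2 := cc_mono v t (hs.trans hsv) hvt
    rcases eq_or_lt_of_le (m1.trans m2) with h | h
    · rw [le_antisymm (m2.trans h.symm.le) m1]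
    · have := hinj (cc s) (cc t) (cc_nn s hs) h
        ((hcc t (by linarith)).1.trans ht) (hcc s hs).2.1 (hcc t (by linarith)).2.1 he
      rcases eq_or_lt_of_le m1 with h1 | h1
      · rw [h1]
      rcases eq_or_lt_of_le m2 with h2 | h2
      · rw [h2, he]
      exact ((hcc v (by linarith)).2.1 (this ⟨h1, h2⟩)).elim

lemma arc_of_mono [CompactSpace X] [T2Space X] [SecondCountableTopology X] {g : ℝ → X}
    (hg : Continuous g) (hne : g 0 ≠ g 1)
    (hm : ∀ s v t, 0 ≤ s → s ≤ v → v ≤ t → t ≤ 1 → g s = g t → g v = g s) :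
    IsArc (g '' Icc 0 1) (g 0) (g 1) := by
  letI := TopologicalSpace.metrizableSpaceMetric X
  obtain ⟨b, hbc, -, hb⟩ := TopologicalSpace.exists_countable_basis X
  have hbne : b.Nonempty := by
    obtain ⟨v, hv, -⟩ := hb.exists_subset_of_mem_open (mem_univ (g 0)) isOpen_univ
    exact ⟨v, hv⟩
  obtain ⟨B, rfl⟩ := hbc.exists_eq_range hbne
  set h : ℕ → X → ℝ := fun k x => min 1 (Metric.infDist x (B k)ᶜ) with hh
  have hhc : ∀ k, Continuous (h k) := fun k =>
    continuous_const.min (Metric.continuous_infDist_pt _)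
  have hh0 : ∀ k x, 0 ≤ h k x := fun k x => le_min zero_le_one Metric.infDist_nonneg
  have hh1 : ∀ k x, h k x ≤ 1 := fun k x => min_le_left _ _
  set ψ : ℕ → ℝ → ℝ := fun k t => sSup ((fun u => h k (g (u * t))) '' Icc 0 1) with hψ
  have hψc : ∀ k, Continuous (ψ k) := by
    intro k
    refine isCompact_Icc.continuous_sSup (f := fun t u => h k (g (u * t))) ?_
    have := hhc k
    change Continuous (fun p : ℝ × ℝ => h k (g (p.2 * p.1)))
    fun_prop
  have hψle : ∀ k t c, 0 ≤ t → (∀ v ∈ Icc 0 t, h k (g v) ≤ c) → ψ k t ≤ c := by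
    intro k t c ht hc
    refine csSup_le ((nonempty_Icc.2 zero_le_one).image _) ?_
    rintro _ ⟨u, hu, rfl⟩
    exact hc _ ⟨mul_nonneg hu.1 ht, mul_le_of_le_one_left ht hu.2⟩
  have hleψ : ∀ k t, ∀ v ∈ Icc 0 t, h k (g v) ≤ ψ k t := by
    intro k t v hv
    refine le_csSup ⟨1, ?_⟩ ?_
    · rintro _ ⟨u, hu, rfl⟩; exact hh1 _ _
    · rcases eq_or_lt_of_le (hv.1.trans hv.2) with h0 | h0
      · have : v = 0 := le_antisymm (hv.2.trans h0.symm.le) hv.1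
        exact ⟨0, by simp, by simp [this]⟩
      · exact ⟨v / t, ⟨div_nonneg hv.1 h0.le, div_le_one_of_le₀ hv.2 h0.le⟩, by
          simp only; rw [div_mul_cancel₀ _ h0.ne']⟩
  have hψ0 : ∀ k t, 0 ≤ t → 0 ≤ ψ k t := fun k t ht =>
    (hh0 k (g 0)).trans (hleψ k t 0 ⟨le_rfl, ht⟩)
  have hψ1 : ∀ k t, 0 ≤ t → ψ k t ≤ 1 := fun k t ht => hψle k t 1 ht fun v _ => hh1 _ _
  have hψm : ∀ k s t, 0 ≤ s → s ≤ t → ψ k s ≤ ψ k t := fun k s t hs hst =>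
    hψle k s _ hs fun v hv => hleψ k t v ⟨hv.1, hv.2.trans hst⟩
  set φ : ℝ → ℝ := fun t => ∑' k, (1 / 2) ^ k * ψ k t with hφ
  have hsum : ∀ t, 0 ≤ t → Summable fun k => (1 / 2 : ℝ) ^ k * ψ k t := by
    intro t ht
    refine Summable.of_nonneg_of_le (fun k => mul_nonneg (by positivity) (hψ0 k t ht)) (fun k => ?_)
      summable_geometric_two
    exact mul_le_of_le_one_right (by positivity) (hψ1 k t ht)
  have hφc : ContinuousOn φ (Icc 0 1) := by
    refine continuousOn_tsum (u := fun k => (1 / 2 : ℝ) ^ k)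
      (fun k => (continuous_const.mul (hψc k)).continuousOn) summable_geometric_two ?_
    intro k t ht
    rw [Real.norm_of_nonneg (mul_nonneg (by positivity) (hψ0 k t ht.1))]
    exact mul_le_of_le_one_right (by positivity) (hψ1 k t ht.1)
  have hφm : ∀ s t, 0 ≤ s → s ≤ t → φ s ≤ φ t := fun s t hs hst =>
    (hsum s hs).tsum_le_tsum
      (fun k => mul_le_mul_of_nonneg_left (hψm k s t hs hst) (by positivity)) (hsum t (hs.trans hst))
  have hlt : ∀ s t, 0 ≤ s → s ≤ t → t ≤ 1 → g s ≠ g t → φ s < φ t := by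
    intro s t hs hst ht hgne
    have hK : IsClosed (g '' Icc 0 s) := (isCompact_Icc.image hg).isClosed
    have hnot : g t ∉ g '' Icc 0 s := by
      rintro ⟨u, hu, he⟩
      exact hgne ((hm u s t hu.1 hu.2 hst ht he).trans he)
    obtain ⟨_, ⟨k, rfl⟩, htk, hksub⟩ := hb.exists_subset_of_mem_open
      (show g t ∈ (g '' Icc 0 s)ᶜ from hnot) hK.isOpen_compl
    have hsubK : g '' Icc 0 s ⊆ (B k)ᶜ := fun x hx hxB => hksub hxB hx
    have hz : ψ k s ≤ 0 := by
      refine hψle k s 0 hs fun v hv => ?_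
      refine (min_le_right _ _).trans (le_of_eq ?_)
      exact Metric.infDist_zero_of_mem (hsubK (mem_image_of_mem _ hv))
    have hp : 0 < ψ k t := by
      refine lt_of_lt_of_le ?_ (hleψ k t t ⟨hs.trans hst, le_rfl⟩)
      refine lt_min one_pos ?_
      have hcl : IsClosed (B k)ᶜ := (hb.isOpen (mem_range_self k)).isClosed_compl
      have hn : (B k)ᶜ.Nonempty := ⟨g 0, hsubK ⟨0, ⟨le_rfl, hs⟩, rfl⟩⟩
      exact (hcl.notMem_iff_infDist_pos hn).1 (fun h => h htk)
    refine (hsum s hs).tsum_lt_tsum (i := k)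
      (fun k => mul_le_mul_of_nonneg_left (hψm k s t hs hst) (by positivity)) ?_
      (hsum t (hs.trans hst))
    exact mul_lt_mul_of_pos_left (hz.trans_lt hp) (by positivity)
  have heq : ∀ s t, 0 ≤ s → s ≤ t → t ≤ 1 → g s = g t → φ s = φ t := by
    intro s t hs hst ht he
    refine le_antisymm (hφm s t hs hst) ?_
    refine (hsum t (hs.trans hst)).tsum_le_tsum (fun k => mul_le_mul_of_nonneg_left ?_ (by positivity))
      (hsum s hs)
    refine hψle k t _ (hs.trans hst) fun v hv => ?_
    rcases le_total v s with h | h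
    · exact hleψ k s v ⟨hv.1, h⟩
    · rw [hm s v t hs h hv.2 ht he]; exact hleψ k s s ⟨hs, le_rfl⟩
  have hiff : ∀ s ∈ Icc (0:ℝ) 1, ∀ t ∈ Icc (0:ℝ) 1, φ s = φ t ↔ g s = g t := by
    have : ∀ s ∈ Icc (0:ℝ) 1, ∀ t ∈ Icc (0:ℝ) 1, s ≤ t → (φ s = φ t ↔ g s = g t) := by
      intro s hs t ht hst
      refine ⟨fun h => ?_, heq s t hs.1 hst ht.2⟩
      by_contra hne
      exact (hlt s t hs.1 hst ht.2 hne).ne h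
    intro s hs t ht
    rcases le_total s t with h | h
    · exact this s hs t ht h
    · rw [eq_comm, this t ht s hs h, eq_comm]
  have hφimg : φ '' Icc 0 1 = Icc (φ 0) (φ 1) := by
    apply subset_antisymm
    · rintro _ ⟨t, ht, rfl⟩
      exact ⟨hφm 0 t le_rfl ht.1, hφm t 1 ht.1 ht.2⟩
    · exact intermediate_value_Icc zero_le_one hφc
  have hex : ∀ y, ∃ t, y ∈ Icc (φ 0) (φ 1) → t ∈ Icc (0:ℝ) 1 ∧ φ t = y := by
    intro y
    by_cases hy : y ∈ Icc (φ 0) (φ 1)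
    · rw [← hφimg] at hy
      obtain ⟨t, ht, h⟩ := hy
      exact ⟨t, fun _ => ⟨ht, h⟩⟩
    · exact ⟨0, fun h => (hy h).elim⟩
  choose τ hτ using hex
  have hmem : ∀ t ∈ Icc (0:ℝ) 1, φ t ∈ Icc (φ 0) (φ 1) := fun t ht => by
    rw [← hφimg]; exact mem_image_of_mem _ ht
  have hF : ∀ t ∈ Icc (0:ℝ) 1, g (τ (φ t)) = g t := by
    intro t ht
    have := hτ _ (hmem t ht)
    exact (hiff _ this.1 t ht).1 this.2
  have hFc : ContinuousOn (g ∘ τ) (Icc (φ 0) (φ 1)) := by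
    rw [continuousOn_iff_isClosed]
    intro Z hZ
    refine ⟨φ '' (Icc 0 1 ∩ g ⁻¹' Z), ?_, ?_⟩
    · exact ((isCompact_Icc.inter_right (hZ.preimage hg)).image_of_continuousOn
        (hφc.mono inter_subset_left)).isClosed
    · ext y; constructor
      · rintro ⟨hy, hyI⟩
        exact ⟨⟨τ y, ⟨(hτ y hyI).1, hy⟩, (hτ y hyI).2⟩, hyI⟩
      · rintro ⟨⟨t, ⟨ht, htZ⟩, rfl⟩, hyI⟩
        refine ⟨?_, hyI⟩
        simp only [mem_preimage, Function.comp, hF t ht]; exact htZ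
  have hFi : InjOn (g ∘ τ) (Icc (φ 0) (φ 1)) := by
    intro y hy z hz he
    have := (hiff _ (hτ y hy).1 _ (hτ z hz).1).2 he
    rwa [(hτ y hy).2, (hτ z hz).2] at this
  have hfin := IsArc.of_Icc (hlt 0 1 le_rfl zero_le_one le_rfl hne) hFc hFi
  have e1 : (g ∘ τ) '' Icc (φ 0) (φ 1) = g '' Icc 0 1 := by
    rw [← hφimg, ← image_comp]
    exact image_congr fun t ht => hF t ht
  rw [e1] at hfin
  simpa only [Function.comp, hF 0 (by simp), hF 1 (by simp)] using hfin

lemma path_arc [CompactSpace X] [T2Space X] [SecondCountableTopology X] {f : ℝ → X}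
    (hf : ContinuousOn f (Icc 0 1)) (hne : f 0 ≠ f 1) :
    ∃ C, IsArc C (f 0) (f 1) ∧ C ⊆ f '' Icc 0 1 := by
  have ext : ∀ f : ℝ → X, ContinuousOn f (Icc 0 1) →
      ∃ F : ℝ → X, Continuous F ∧ ∀ t ∈ Icc (0:ℝ) 1, F t = f t := by
    intro f hf
    refine ⟨fun t => f (projIcc 0 1 zero_le_one t), ?_, ?_⟩
    · exact hf.comp_continuous (continuous_subtype_val.comp continuous_projIcc) (fun t => Subtype.prop _)
    · intro t ht; simp only [projIcc_of_mem zero_le_one ht]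
  obtain ⟨F, hF, hFe⟩ := ext f hf
  obtain ⟨g, hg, hg0, hg1, hgs, hgm⟩ := mono_path hF
  obtain ⟨G, hG, hGe⟩ := ext g hg
  have i0 : (0:ℝ) ∈ Icc (0:ℝ) 1 := by simp
  have i1 : (1:ℝ) ∈ Icc (0:ℝ) 1 := by simp
  have := arc_of_mono hG (by rwa [hGe 0 i0, hGe 1 i1, hg0, hg1, hFe 0 i0, hFe 1 i1]) (by
    intro s v t hs hsv hvt ht he
    rw [hGe s ⟨hs, by linarith⟩, hGe t ⟨by linarith, ht⟩] at he
    rw [hGe s ⟨hs, by linarith⟩, hGe v ⟨by linarith, by linarith⟩]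
    exact hgm s v t hs hsv hvt ht he)
  rw [hGe 0 i0, hGe 1 i1, hg0, hg1, hFe 0 i0, hFe 1 i1, image_congr hGe] at this
  exact ⟨_, this, by rwa [image_congr hFe] at hgs⟩

end
end MQ


namespace MQ

section
variable {X : Type*} [TopologicalSpace X]

lemma stays {G T C : Set X} (hC : IsPreconnected C) {p : X} (hp : p ∈ C) (hpG : p ∈ G)
    (hCT : C ⊆ Tᶜ) (hfr : frontier G ⊆ T) : C ⊆ G := by
  intro q hq
  by_contra hqG
  obtain ⟨x, hx, hx'⟩ := meets_frontier hC hp hpG hq hqG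
  exact hCT hx (hfr hx')

variable [Moore X]

lemma Jn.joinedIn {K : Set X} (hK : IsClosed K) {p q : X} (h : Jn K p q) : JoinedIn Kᶜ p q := by
  have ho := hK.isOpen_compl.connectedComponentIn (x := p)
  have hp : p ∈ Kᶜ := h.left
  have hc : IsConnected (connectedComponentIn Kᶜ p) := isConnected_connectedComponentIn_iff.2 hp
  exact ((ho.isConnected_iff_isPathConnected.1 hc).joinedIn p (mem_connectedComponentIn hp) q
    (Jn_iff.1 h)).mono (connectedComponentIn_subset _ _)

lemma arc_nonsep {A : Set X} {a b p q : X} (hA : IsArc A a b) (hp : p ∉ A) (hq : q ∉ A) :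
    Jn A p q := by
  obtain ⟨f, hc, hi, rfl, rfl, rfl⟩ := hA
  set ι := {C : Set X // IsClosed C ∧ IsPreconnected C ∧ p ∈ C ∧ q ∈ C}
  have hres : Continuous (fun t : Icc (0:ℝ) 1 => f t) := hc.comp_continuous continuous_subtype_val
    (fun t => t.2)
  obtain ⟨t, ht0, htm, ⟨m, htm'⟩, htc⟩ := exists_monotone_Icc_subset_open_cover_Icc
    (a := (0:ℝ)) (b := 1) zero_le_one (c := fun C : ι => {t : Icc (0:ℝ) 1 | f t ∈ C.1ᶜ})
    (fun C => C.2.1.isOpen_compl.preimage hres) (by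
      intro t _
      have hj := Moore.j0 (f t) p q (fun h => hp ⟨t, t.2, h.symm⟩) (fun h => hq ⟨t, t.2, h.symm⟩)
      obtain ⟨γ, hγ⟩ := hj.joinedIn isClosed_singleton
      refine mem_iUnion.2 ⟨⟨range γ, (isCompact_range γ.continuous).isClosed,
        isPreconnected_range γ.continuous, ⟨0, by simp⟩, ⟨1, by simp⟩⟩, ?_⟩
      rintro ⟨s, hs⟩
      exact hγ s hs)
  have key : ∀ n, Jn (f '' Icc 0 (t n)) p q := by
    intro n
    induction n with
    | zero =>
      rw [ht0, Icc_self, image_singleton]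
      exact Moore.j0 _ p q (fun h => hp ⟨0, by simp, h.symm⟩) (fun h => hq ⟨0, by simp, h.symm⟩)
    | succ n ih =>
      have hle : (t n : ℝ) ≤ t (n + 1) := htm (Nat.le_succ n)
      have s1 : Icc (0:ℝ) (t n) ⊆ Icc 0 1 := Icc_subset_Icc le_rfl (t n).2.2
      have s2 : Icc (t n : ℝ) (t (n + 1)) ⊆ Icc 0 1 := Icc_subset_Icc (t n).2.1 (t (n+1)).2.2
      have hu : f '' Icc 0 (t (n + 1)) = f '' Icc 0 (t n) ∪ f '' Icc (t n) (t (n + 1)) := by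
        rw [← image_union, Icc_union_Icc_eq_Icc (t n).2.1 hle]
      rw [hu]
      refine Moore.j1 _ _ p q (isCompact_Icc.image_of_continuousOn (hc.mono s1)).isClosed
        (isCompact_Icc.image_of_continuousOn (hc.mono s2)).isClosed ?_ ih ?_
      · rw [← hi.image_inter s1 s2, Icc_inter_Icc_eq_singleton (t n).2.1 hle, image_singleton]
        exact isPreconnected_singleton
      · obtain ⟨C, hC⟩ := htc n
        refine ⟨C.1, C.2.2.1, C.2.2.2.1, C.2.2.2.2, ?_⟩
        rintro _ hx ⟨u, hu, rfl⟩
        exact hC (show (⟨u, s2 hu⟩ : Icc (0:ℝ) 1) ∈ Icc (t n) (t (n+1)) from ⟨hu.1, hu.2⟩) hx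
  have := key m
  rwa [htm' m le_rfl] at this

lemma arc_tail {A : Set X} {a b : X} (hA : IsArc A a b) {W : Set X} (hW : IsOpen W) (haW : a ∈ W) :
    ∃ γ c, IsArc γ c b ∧ γ ⊆ A ∧ a ∉ γ ∧ A \ γ ⊆ W := by
  obtain ⟨f, hc, hi, rfl, rfl, rfl⟩ := hA
  have h0 : (0:ℝ) ∈ Icc (0:ℝ) 1 := by simp
  have : ∀ᶠ t in 𝓝[Icc 0 1] (0:ℝ), f t ∈ W := hc 0 h0 (hW.mem_nhds haW)
  rw [eventually_nhdsWithin_iff] at this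
  obtain ⟨ε, hε, hb⟩ := Metric.eventually_nhds_iff.1 this
  set δ := min ε (1/2) with hδ
  have hδ0 : 0 < δ := by positivity
  have hδ1 : δ < 1 := (min_le_right _ _).trans_lt (by norm_num)
  have hδε : δ ≤ ε := min_le_left _ _
  have hs : Icc δ 1 ⊆ Icc (0:ℝ) 1 := Icc_subset_Icc hδ0.le le_rfl
  refine ⟨f '' Icc δ 1, f δ, IsArc.of_Icc hδ1 (hc.mono hs) (hi.mono hs), image_mono hs, ?_, ?_⟩
  · rintro ⟨t, ht, h⟩
    have := hi (hs ht) h0 h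
    linarith [ht.1]
  · rintro _ ⟨⟨t, ht, rfl⟩, hn⟩
    have : t < δ := by
      by_contra h; exact hn ⟨t, ⟨not_lt.1 h, ht.2⟩, rfl⟩
    refine hb ?_ ht
    rw [Real.dist_eq, sub_zero, abs_of_nonneg ht.1]; linarith

lemma loop_tail {J : Set X} (hJ : IsLoop J) {a : X} (ha : a ∈ J) {W : Set X} (hW : IsOpen W)
    (haW : a ∈ W) : ∃ γ c d, IsArc γ c d ∧ γ ⊆ J ∧ a ∉ γ ∧ J \ γ ⊆ W := by
  obtain ⟨b, hb, hab⟩ : ∃ b ∈ J, a ≠ b := by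
    obtain ⟨u, v, A, B, hA, hB, -, rfl⟩ := hJ
    by_cases h : a = u
    · exact ⟨v, Or.inl hA.right, h ▸ hA.ne⟩
    · exact ⟨u, Or.inl hA.left, h⟩
  obtain ⟨A, B, hA, hB, hAB, rfl⟩ := hJ.resplit ha hb hab
  obtain ⟨γ1, c, h1, h2, h3, h4⟩ := arc_tail hA hW haW
  obtain ⟨γ2, d, k1, k2, k3, k4⟩ := arc_tail hB hW haW
  refine ⟨γ1 ∪ γ2, c, d, h1.concat k1.symm ?_, union_subset_union h2 k2, ?_, ?_⟩
  · rintro x ⟨hx, hx'⟩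
    have : x ∈ A ∩ B := ⟨h2 hx, k2 hx'⟩
    rw [hAB] at this
    rcases this with rfl | h
    · exact (h3 hx).elim
    · exact h
  · rintro (h | h); exacts [h3 h, k3 h]
  · rintro x ⟨hx | hx, hn⟩
    · exact h4 ⟨hx, fun h => hn (Or.inl h)⟩
    · exact k4 ⟨hx, fun h => hn (Or.inr h)⟩

def Nice (T : Set X) (a : X) : Prop :=
  ∀ W, IsOpen W → a ∈ W → ∃ γ, IsClosed γ ∧ IsPreconnected γ ∧ γ ⊆ T ∧ a ∉ γ ∧ T \ γ ⊆ W

lemma LC {T : Set X} (hT : IsClosed T) {a : X} (hN : Nice T a) {W : Set X} (hW : IsOpen W)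
    (haW : a ∈ W) : ∃ V, IsOpen V ∧ a ∈ V ∧ V ⊆ W ∧
      ∀ p ∈ V \ T, ∀ q ∈ V \ T, Jn T p q → Jn (T ∪ Wᶜ) p q := by
  obtain ⟨γ, hγc, hγp, hγT, haγ, hTγ⟩ := hN W hW haW
  have ho : IsOpen (W ∩ γᶜ) := hW.inter hγc.isOpen_compl
  have hsub := connectedComponentIn_subset (W ∩ γᶜ) a
  refine ⟨connectedComponentIn (W ∩ γᶜ) a, ho.connectedComponentIn,
    mem_connectedComponentIn ⟨haW, haγ⟩, hsub.trans inter_subset_left, ?_⟩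
  intro p hp q hq h
  have h2 : Jn (Wᶜ ∪ γ) p q := ⟨_, isPreconnected_connectedComponentIn, hp.1, hq.1, by
    intro x hx
    rintro (h | h)
    exacts [h (hsub hx).1, (hsub hx).2 h]⟩
  have hint : T ∩ (Wᶜ ∪ γ) = γ := by
    ext x; constructor
    · rintro ⟨hx, h | h⟩
      · by_contra hn; exact h (hTγ ⟨hx, hn⟩)
      · exact h
    · intro hx; exact ⟨hγT hx, Or.inr hx⟩
  refine (Moore.j1 _ _ p q hT (hW.isClosed_compl.union hγc) (by rwa [hint]) h h2).mono ?_
  exact union_subset_union_right _ subset_union_left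

lemma nice_arc {A : Set X} {a b : X} (hA : IsArc A a b) : Nice A a := by
  intro W hW ha
  obtain ⟨γ, c, h1, h2, h3, h4⟩ := arc_tail hA hW ha
  exact ⟨γ, h1.isClosed, h1.preconn, h2, h3, h4⟩

lemma nice_loop {J : Set X} (hJ : IsLoop J) {a : X} (ha : a ∈ J) : Nice J a := by
  intro W hW haW
  obtain ⟨γ, c, d, h1, h2, h3, h4⟩ := loop_tail hJ ha hW haW
  exact ⟨γ, h1.isClosed, h1.preconn, h2, h3, h4⟩

lemma IsLoop.isClosed {J : Set X} : IsLoop J → IsClosed J := by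
  rintro ⟨a, b, A, B, hA, hB, -, rfl⟩; exact hA.isClosed.union hB.isClosed

lemma IsLoop.preconn {J : Set X} : IsLoop J → IsPreconnected J := by
  rintro ⟨a, b, A, B, hA, hB, -, rfl⟩
  exact hA.preconn.union a hA.left hB.left hB.preconn

lemma nice_lollipop_end {J α : Set X} {x p : X} (hJ : IsLoop J) (hα : IsArc α x p)
    (hint : α ∩ J = {x}) : Nice (J ∪ α) p := by
  intro W hW hpW
  obtain ⟨γ, c, h1, h2, h3, h4⟩ := arc_tail hα.symm hW hpW
  have hx : x ∈ J := by
    have : x ∈ α ∩ J := by rw [hint]; rfl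
    exact this.2
  refine ⟨J ∪ γ, hJ.isClosed.union h1.isClosed, hJ.preconn.union x hx h1.right h1.preconn,
    union_subset_union_right _ h2, ?_, ?_⟩
  · rintro (h | h)
    · have : p ∈ α ∩ J := ⟨hα.right, h⟩
      rw [hint] at this
      exact hα.ne this.symm
    · exact h3 h
  · rintro y ⟨h | h, hn⟩
    · exact (hn (Or.inl h)).elim
    · exact h4 ⟨h, fun h' => hn (Or.inr h')⟩

lemma nice_lollipop_base {J α : Set X} {x p y : X} (hJ : IsLoop J) (hα : IsArc α x p)
    (hint : α ∩ J = {x}) (hy : y ∈ J) (hyx : y ≠ x) : Nice (J ∪ α) y := by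
  intro W hW hyW
  have hyα : y ∉ α := fun h => by
    have : y ∈ α ∩ J := ⟨h, hy⟩
    rw [hint] at this; exact hyx this
  obtain ⟨γ, c, d, h1, h2, h3, h4⟩ := loop_tail hJ hy (hW.inter hα.isClosed.isOpen_compl) ⟨hyW, hyα⟩
  have hxJ : x ∈ J := by
    have : x ∈ α ∩ J := by rw [hint]; rfl
    exact this.2
  have hxγ : x ∈ γ := by
    by_contra h
    exact (h4 ⟨hxJ, h⟩).2 hα.left
  refine ⟨γ ∪ α, h1.isClosed.union hα.isClosed, h1.preconn.union x hxγ hα.left hα.preconn,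
    union_subset_union_left _ h2, ?_, ?_⟩
  · rintro (h | h); exacts [h3 h, hyα h]
  · rintro z ⟨h | h, hn⟩
    · exact (h4 ⟨h, fun h' => hn (Or.inl h')⟩).1
    · exact (hn (Or.inr h)).elim

lemma access1 {T G : Set X} (hT : IsClosed T) (hGc : IsPreconnected G)
    (hGT : Disjoint G T) (hfr : frontier G ⊆ T) {a : X} (ha : a ∈ closure G) (hN : Nice T a) :
    ∃ g : ℝ → X, ContinuousOn g (Icc 0 1) ∧ g 0 = a ∧ ∀ t ∈ Ioc (0:ℝ) 1, g t ∈ G := by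
  let := TopologicalSpace.metrizableSpaceMetric X
  have hV : ∀ n : ℕ, ∃ V, IsOpen V ∧ a ∈ V ∧
      ∀ p ∈ V \ T, ∀ q ∈ V \ T, Jn T p q → Jn (T ∪ (Metric.ball a (1 / (n + 1)))ᶜ) p q := by
    intro n
    obtain ⟨V, h1, h2, -, h3⟩ := LC hT hN (Metric.isOpen_ball (x := a) (ε := 1 / ((n:ℝ) + 1)))
      (Metric.mem_ball_self (by positivity))
    exact ⟨V, h1, h2, h3⟩
  choose V hVo haV hVJ using hV
  have hx : ∀ n : ℕ, ∃ x ∈ G, ∀ m ≤ n, x ∈ V m := by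
    intro n
    have ho : IsOpen (⋂ m ∈ Finset.range (n + 1), V m) :=
      isOpen_biInter_finset fun m _ => hVo m
    obtain ⟨x, hx, hxG⟩ := mem_closure_iff.1 ha _ ho (by simp [haV])
    refine ⟨x, hxG, fun m hm => ?_⟩
    simp only [Finset.mem_range, mem_iInter] at hx
    exact hx m (by omega)
  choose x hxG hxV using hx
  have hpath : ∀ n : ℕ, ∃ γ : ℝ → X, Continuous γ ∧ γ 0 = x n ∧ γ 1 = x (n + 1) ∧
      ∀ t, γ t ∈ G ∩ Metric.ball a (1 / (n + 1)) := by
    intro n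
    have hj := hVJ n (x n) ⟨hxV n n le_rfl, disjoint_left.1 hGT (hxG n)⟩ (x (n+1))
      ⟨hxV (n+1) n (Nat.le_succ n), disjoint_left.1 hGT (hxG (n+1))⟩
      ⟨G, hGc, hxG n, hxG (n+1), fun z hz => disjoint_left.1 hGT hz⟩
    obtain ⟨γ, hγ⟩ := hj.joinedIn (hT.union Metric.isOpen_ball.isClosed_compl)
    refine ⟨γ.extend, γ.continuous_extend, γ.extend_zero, γ.extend_one, fun t => ?_⟩
    have hr : γ.extend t ∈ range γ := by rw [← γ.extend_range]; exact mem_range_self t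
    have hsubG : range γ ⊆ G := stays (isPreconnected_range γ.continuous) (p := x n) ⟨0, by simp⟩
      (hxG n) (by rintro _ ⟨s, rfl⟩ h; exact hγ s (Or.inl h)) hfr
    refine ⟨hsubG hr, ?_⟩
    obtain ⟨s, hs⟩ := hr
    rw [← hs]
    by_contra h
    exact hγ s (Or.inr h)
  choose γ hγc hγ0 hγ1 hγm using hpath
  set F : ℝ → X := fun t => γ ⌊t⌋₊ (t - ⌊t⌋₊) with hF
  have hFn : ∀ n : ℕ, ∀ t ∈ Icc (n:ℝ) (n + 1), F t = γ n (t - n) := by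
    intro n t ht
    rcases eq_or_lt_of_le ht.2 with h | h
    · have : ⌊t⌋₊ = n + 1 := by rw [h]; exact_mod_cast Nat.floor_natCast (n + 1)
      simp only [hF, this]
      rw [h]; push_cast; simp [hγ0, hγ1]
    · have : ⌊t⌋₊ = n := (Nat.floor_eq_iff (n.cast_nonneg.trans ht.1)).2 ⟨ht.1, h⟩
      simp only [hF, this]
  have hlf : LocallyFinite (fun n : ℕ => Icc (n:ℝ) (n + 1)) := by
    intro t
    refine ⟨Metric.ball t 1, Metric.ball_mem_nhds _ one_pos, (finite_Iic ⌈t + 1⌉₊).subset ?_⟩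
    rintro n ⟨u, hu, hu'⟩
    rw [Real.ball_eq_Ioo] at hu'
    have : (n:ℝ) ≤ ⌈t + 1⌉₊ := (hu.1.trans hu'.2.le).trans (Nat.le_ceil _)
    exact_mod_cast this
  have hFc : ContinuousOn F (Ici 0) := by
    have := hlf.continuousOn_iUnion (g := F) (fun n => isClosed_Icc) (fun n =>
      (((hγc n).comp (continuous_id.sub continuous_const)).continuousOn).congr (hFn n))
    refine this.mono ?_
    intro t ht
    exact mem_iUnion.2 ⟨⌊t⌋₊, Nat.floor_le ht, (Nat.lt_floor_add_one t).le⟩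
  have hinv : ∀ t ∈ Ioc (0:ℝ) 1, 0 ≤ t⁻¹ - 1 := fun t ht => by
    have := (one_le_inv₀ ht.1).2 ht.2; linarith
  refine ⟨fun t => if t = 0 then a else F (t⁻¹ - 1), ?_, by simp, ?_⟩
  · intro t ht
    rcases eq_or_lt_of_le ht.1 with h | h
    · subst h
      rw [Metric.continuousWithinAt_iff]
      intro ε hε
      obtain ⟨N, hN⟩ := exists_nat_one_div_lt hε
      refine ⟨1 / (N + 2), by positivity, fun {u} hu hud => ?_⟩
      by_cases hu0 : u = 0
      · simp [hu0, hε]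
      · have hup : 0 < u := lt_of_le_of_ne hu.1 (Ne.symm hu0)
        rw [Real.dist_eq, sub_zero, abs_of_pos hup, lt_one_div hup (by positivity)] at hud
        simp only [hu0, if_false, if_true]
        have h1 := (hγm ⌊u⁻¹ - 1⌋₊ (u⁻¹ - 1 - ⌊u⁻¹ - 1⌋₊)).2
        rw [Metric.mem_ball] at h1
        refine h1.trans (lt_of_le_of_lt ?_ hN)
        have h2 : N ≤ ⌊u⁻¹ - 1⌋₊ := by
          apply Nat.le_floor
          rw [one_div] at hud; linarith
        have h3 : (N:ℝ) ≤ ⌊u⁻¹ - 1⌋₊ := by exact_mod_cast h2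
        exact one_div_le_one_div_of_le (by positivity) (by linarith)
    · have hcont : ContinuousOn (fun t : ℝ => F (t⁻¹ - 1)) (Ioc 0 1) := by
        refine hFc.comp ?_ (fun t ht => hinv t ht)
        exact (continuousOn_id.inv₀ (fun t ht => ht.1.ne')).sub continuousOn_const
      have h1 : ContinuousWithinAt (fun t : ℝ => F (t⁻¹ - 1)) (Ioc 0 1) t := hcont t ⟨h, ht.2⟩
      have h2 : ContinuousWithinAt (fun t : ℝ => F (t⁻¹ - 1)) (Icc 0 1) t := by
        refine h1.mono_of_mem_nhdsWithin ?_
        rw [mem_nhdsWithin]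
        exact ⟨Ioi 0, isOpen_Ioi, h, fun u hu => ⟨hu.1, hu.2.2⟩⟩
      refine h2.congr_of_eventuallyEq ?_ ?_
      · filter_upwards [mem_nhdsWithin_of_mem_nhds (Ioi_mem_nhds h)] with u hu
        have hu2 : u ≠ 0 := ne_of_gt (mem_Ioi.1 hu)
        simp only [if_neg hu2]
      · simp only [if_neg h.ne']
  · intro t ht
    simp only [if_neg ht.1.ne']
    exact (hγm _ _).1

lemma access {T G : Set X} (hT : IsClosed T) (hG : IsOpen G) (hGc : IsPreconnected G)
    (hGT : Disjoint G T) (hfr : frontier G ⊆ T) {a b : X} (ha : a ∈ closure G) (hb : b ∈ closure G)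
    (hab : a ≠ b) (hNa : Nice T a) (hNb : Nice T b) :
    ∃ C, IsArc C a b ∧ C \ {a, b} ⊆ G := by
  obtain ⟨g, hg, hg0, hgG⟩ := access1 hT hGc hGT hfr ha hNa
  obtain ⟨k, hk, hk0, hkG⟩ := access1 hT hGc hGT hfr hb hNb
  have i1 : (1:ℝ) ∈ Ioc (0:ℝ) 1 := by simp
  have hpc : IsPathConnected G := hG.isConnected_iff_isPathConnected.1 ⟨⟨_, hgG 1 i1⟩, hGc⟩
  obtain ⟨γ, hγ⟩ := hpc.joinedIn _ (hgG 1 i1) _ (hkG 1 i1)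
  obtain ⟨u, hu, hu1, hu2⟩ := glue hg γ.continuous_extend.continuousOn (by simp)
  have himg2 : (fun t : ℝ => 2 * t) '' Icc 0 1 = Icc 0 2 := by
    have := image_affine_Icc' (a := (2:ℝ)) two_pos 0 0 1
    simpa using this
  have hu' : ContinuousOn (fun t : ℝ => u (2 * t)) (Icc 0 1) :=
    hu.comp (by fun_prop) (by rw [mapsTo_iff_image_subset, himg2])
  have himg1 : (fun t : ℝ => 1 - t) '' Icc 0 1 = Icc 0 1 := by simp
  have hk' : ContinuousOn (fun t : ℝ => k (1 - t)) (Icc 0 1) :=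
    hk.comp (by fun_prop) (by rw [mapsTo_iff_image_subset, himg1])
  obtain ⟨v, hv, hv1, hv2⟩ := glue hu' hk' (by
    simp only [mul_one, sub_zero]
    rw [hu2 2 (by norm_num)]; norm_num)
  have huG : ∀ t ∈ Ioc (0:ℝ) 2, u t ∈ G := by
    intro t ht
    rcases le_total t 1 with h | h
    · rw [hu1 t ⟨ht.1.le, h⟩]; exact hgG t ⟨ht.1, h⟩
    · rw [hu2 t ⟨h, ht.2⟩]
      have hr : γ.extend (t - 1) ∈ range γ := by rw [← γ.extend_range]; exact mem_range_self _
      obtain ⟨s, hs⟩ := hr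
      rw [← hs]; exact hγ s
  have hvG : ∀ t ∈ Ioo (0:ℝ) 2, v t ∈ G := by
    intro t ht
    rcases le_total t 1 with h | h
    · rw [hv1 t ⟨ht.1.le, h⟩]
      exact huG _ ⟨by linarith [ht.1], by linarith⟩
    · rw [hv2 t ⟨h, ht.2.le⟩]; exact hkG _ ⟨by linarith [ht.2], by linarith⟩
  have hv' : ContinuousOn (fun t : ℝ => v (2 * t)) (Icc 0 1) :=
    hv.comp (by fun_prop) (by rw [mapsTo_iff_image_subset, himg2])
  have e0 : v (2 * 0) = a := by
    rw [mul_zero, hv1 0 (by simp), mul_zero, hu1 0 (by simp), hg0]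
  have e1 : v (2 * 1) = b := by
    rw [mul_one, hv2 2 (by norm_num)]; norm_num [hk0]
  obtain ⟨C, hC, hCs⟩ := path_arc hv' (by rw [e0, e1]; exact hab)
  rw [e0, e1] at hC
  refine ⟨C, hC, ?_⟩
  rintro x ⟨hx, hxn⟩
  obtain ⟨t, ht, rfl⟩ := hCs hx
  refine hvG _ ⟨?_, ?_⟩
  · rcases eq_or_lt_of_le ht.1 with h | h
    · subst h; exact (hxn (Or.inl e0)).elim
    · linarith
  · rcases eq_or_lt_of_le ht.2 with h | h
    · subst h; exact (hxn (Or.inr e1)).elim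
    · linarith

lemma arc_end_closure {A : Set X} {a b : X} (hA : IsArc A a b) : a ∈ closure Aᶜ := by
  have hAc := hA.isClosed
  obtain ⟨f, hc, hi, rfl, rfl, rfl⟩ := hA
  rw [closure_compl]
  intro hint
  have h0 : (0:ℝ) ∈ Icc (0:ℝ) 1 := by simp
  have : ∀ᶠ t in 𝓝[Icc 0 1] (0:ℝ), f t ∈ interior (f '' Icc 0 1) :=
    hc 0 h0 (isOpen_interior.mem_nhds hint)
  rw [eventually_nhdsWithin_iff] at this
  obtain ⟨ε, hε, hb⟩ := Metric.eventually_nhds_iff.1 this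
  set δ := min (ε/2) (1/2) with hδ
  have hδ0 : 0 < δ := by positivity
  have hδ1 : δ < 1 := (min_le_right _ _).trans_lt (by norm_num)
  have hδε : δ < ε := (min_le_left _ _).trans_lt (by linarith)
  have s1 : Icc 0 δ ⊆ Icc (0:ℝ) 1 := Icc_subset_Icc le_rfl hδ1.le
  have s2 : Icc δ 1 ⊆ Icc (0:ℝ) 1 := Icc_subset_Icc hδ0.le le_rfl
  have hδm : δ ∈ Icc (0:ℝ) 1 := ⟨hδ0.le, hδ1.le⟩
  have c1 : IsClosed (f '' Icc 0 δ) := (isCompact_Icc.image_of_continuousOn (hc.mono s1)).isClosed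
  have c2 : IsClosed (f '' Icc δ 1) := (isCompact_Icc.image_of_continuousOn (hc.mono s2)).isClosed
  obtain ⟨C, hC, haC, hbC, hCx⟩ := Moore.j0 (f δ) (f 0) (f 1)
    (fun h => hδ0.ne (hi h0 hδm h)) (fun h => hδ1.ne' (hi (by simp) hδm h))
  obtain ⟨x, hx, hxf⟩ := meets_frontier hC haC (O := f '' Icc 0 δ) ⟨0, ⟨le_rfl, hδ0.le⟩, rfl⟩ hbC (by
    rintro ⟨t, ht, he⟩
    have := hi (s1 ht) (by simp) he
    linarith [ht.2])
  have hx1 := c1.frontier_subset hxf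
  obtain ⟨t, ht, rfl⟩ := hx1
  have htδ : t ≠ δ := by rintro rfl; exact hCx hx rfl
  have htδ' : t < δ := lt_of_le_of_ne ht.2 htδ
  refine hxf.2 (mem_interior.2 ⟨interior (f '' Icc 0 1) ∩ (f '' Icc δ 1)ᶜ, ?_,
    isOpen_interior.inter c2.isOpen_compl, ?_, ?_⟩)
  · rintro y ⟨hy, hy'⟩
    obtain ⟨u, hu, rfl⟩ := interior_subset hy
    refine ⟨u, ⟨hu.1, ?_⟩, rfl⟩
    by_contra h
    exact hy' ⟨u, ⟨(not_le.1 h).le, hu.2⟩, rfl⟩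
  · refine hb ?_ (s1 ht)
    rw [Real.dist_eq, sub_zero, abs_of_nonneg ht.1]; linarith [ht.2]
  · rintro ⟨u, hu, he⟩
    have := hi (s2 hu) (s1 ht) he
    linarith [hu.1]

lemma exists_loop : ∃ J : Set X, IsLoop J := by
  obtain ⟨p, q, hpq⟩ := exists_pair_ne X
  have : PathConnectedSpace X := pathConnectedSpace_iff_connectedSpace.2 inferInstance
  obtain ⟨γ⟩ := PathConnectedSpace.joined p q
  obtain ⟨A, hA, -⟩ := path_arc (f := γ.extend) γ.continuous_extend.continuousOn (by simpa using hpq)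
  rw [γ.extend_zero, γ.extend_one] at hA
  obtain ⟨C, hC, hCs⟩ := access (T := A) (G := Aᶜ) hA.isClosed hA.isClosed.isOpen_compl
    (preconn_of_Jn fun p q hp hq => arc_nonsep hA hp hq) disjoint_compl_left
    (by rw [frontier_compl]; exact hA.isClosed.frontier_subset)
    (arc_end_closure hA) (arc_end_closure hA.symm) hpq (nice_arc hA) (nice_arc hA.symm)
  refine ⟨A ∪ C, p, q, A, C, hA, hC, ?_, rfl⟩
  apply subset_antisymm
  · rintro x ⟨h1, h2⟩
    by_contra hn
    exact hCs ⟨h2, hn⟩ h1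
  · rintro x (rfl | rfl)
    exacts [⟨hA.left, hC.left⟩, ⟨hA.right, hC.right⟩]

end
end MQ


set_option linter.unusedSectionVars false
set_option linter.unusedVariables false
namespace MQ

section
variable {X : Type*} [TopologicalSpace X] [Moore X]

def Face (J U : Set X) : Prop := IsLoop J ∧ ∃ p, p ∉ J ∧ U = connectedComponentIn Jᶜ p

lemma IsArc.nontriv {A : Set X} {a b : X} (hA : IsArc A a b) : (∃ z, z ∈ A ∧ z ≠ a ∧ z ≠ b) := by
  obtain ⟨z, hz, hz'⟩ := hA.ioo_nonempty
  exact ⟨z, hz, fun h => hz' (by simp [h]), fun h => hz' (by simp [h])⟩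

lemma loop_sep {J : Set X} (hJ : IsLoop J) : ∃ p q, p ∉ J ∧ q ∉ J ∧ ¬ Jn J p q := by
  obtain ⟨a, b, A, B, hA, hB, hAB, rfl⟩ := hJ
  refine J2 Moore.j1 hA.isClosed hB.isClosed hA.preconn hB.preconn ?_
  rw [hAB]
  intro h
  obtain ⟨z, -, hz1, hz2⟩ := isPreconnected_closed_iff.1 h {a} {b} isClosed_singleton
    isClosed_singleton (by rintro z (rfl | rfl) <;> simp) ⟨a, by simp⟩ ⟨b, by simp⟩
  exact hA.ne (hz1.symm.trans hz2)

lemma Face.isOpen {J U : Set X} (h : Face J U) : IsOpen U := by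
  obtain ⟨hJ, p, hp, rfl⟩ := h
  exact hJ.isClosed.isOpen_compl.connectedComponentIn

lemma Face.preconn {J U : Set X} (h : Face J U) : IsPreconnected U := by
  obtain ⟨hJ, p, hp, rfl⟩ := h
  exact isPreconnected_connectedComponentIn

lemma Face.nonempty {J U : Set X} (h : Face J U) : U.Nonempty := by
  obtain ⟨hJ, p, hp, rfl⟩ := h
  exact ⟨p, mem_connectedComponentIn hp⟩

lemma Face.notMem {J U : Set X} (h : Face J U) {x : X} (hx : x ∈ U) : x ∉ J := by
  obtain ⟨hJ, p, hp, rfl⟩ := h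
  exact connectedComponentIn_subset _ _ hx

lemma Face.jn {J U : Set X} (h : Face J U) {x y : X} (hx : x ∈ U) (hy : y ∈ U) : Jn J x y :=
  ⟨U, h.preconn, hx, hy, fun _ hz => h.notMem hz⟩

lemma Face.frontier_sub {J U : Set X} (h : Face J U) : frontier U ⊆ J := by
  obtain ⟨hJ, p, hp, rfl⟩ := h
  exact frontier_comp hJ.isClosed p

lemma Face.of_jn {J U : Set X} (h : Face J U) {x y : X} (hx : x ∈ U) (hxy : Jn J x y) : y ∈ U := by
  obtain ⟨C, hC, hxC, hyC, hCJ⟩ := hxy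
  exact stays hC hxC hx hCJ h.frontier_sub hyC

lemma face_comp {J : Set X} (hJ : IsLoop J) {p : X} (hp : p ∉ J) :
    ∃ U, Face J U ∧ p ∈ U :=
  ⟨_, ⟨hJ, p, hp, rfl⟩, mem_connectedComponentIn hp⟩

lemma Face.frontier_eq {J U : Set X} (h : Face J U) : frontier U = J := by
  refine h.frontier_sub.antisymm fun x hx => ?_
  by_contra hxU
  obtain ⟨γ, c, d, hγ, hγJ, hxγ, hJγ⟩ := loop_tail h.1 hx isClosed_frontier.isOpen_compl hxU
  have hfr : frontier U ⊆ γ := by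
    intro z hz
    by_contra hzγ
    exact hJγ ⟨h.frontier_sub hz, hzγ⟩ hz
  obtain ⟨p, q, hp, hq, hpq⟩ := loop_sep h.1
  have key : ∀ z, z ∉ J → z ∈ U := by
    intro z hz
    obtain ⟨u, hu⟩ := h.nonempty
    obtain ⟨C, hC, huC, hzC, hCγ⟩ := arc_nonsep hγ (fun h' => h.notMem hu (hγJ h')) (fun h' => hz (hγJ h'))
    exact stays hC huC hu hCγ hfr hzC
  exact hpq (h.jn (key p hp) (key q hq))

lemma Face.mem_closure {J U : Set X} (h : Face J U) {x : X} (hx : x ∈ J) : x ∈ closure U := by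
  rw [← h.frontier_eq] at hx
  exact hx.1

lemma Face.closure_eq {J U : Set X} (h : Face J U) : closure U = U ∪ J := by
  rw [closure_eq_self_union_frontier, h.frontier_eq]

lemma Face.insert_preconn {J U : Set X} (h : Face J U) {x : X} (hx : x ∈ J) :
    IsPreconnected (insert x U) :=
  h.preconn.subset_closure (subset_insert _ _)
    (insert_subset (h.mem_closure hx) subset_closure)

lemma Jn.of_face {J U K : Set X} (h : Face J U) {x y : X} (hx : x ∈ J) (hy : y ∈ U)
    (hK : ∀ z ∈ U, z ∉ K) (hxK : x ∉ K) : Jn K x y :=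
  ⟨_, h.insert_preconn hx, mem_insert _ _, mem_insert_of_mem _ hy, by
    rintro z (rfl | hz)
    · exact hxK
    · exact hK z hz⟩

lemma Face.crosscut {J U : Set X} (h : Face J U) {x y : X} (hx : x ∈ J) (hy : y ∈ J) (hxy : x ≠ y) :
    ∃ C, IsArc C x y ∧ C \ {x, y} ⊆ U :=
  access h.1.isClosed h.isOpen h.preconn
    (Set.disjoint_left.2 fun _ hz => h.notMem hz) h.frontier_sub (h.mem_closure hx)
    (h.mem_closure hy) hxy (nice_loop h.1 hx) (nice_loop h.1 hy)

lemma cross_cases {C U : Set X} {x y z : X} (hCU : C \ {x, y} ⊆ U) (hz : z ∈ C) : z = x ∨ z = y ∨ z ∈ U := by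
  by_cases h1 : z = x
  · exact Or.inl h1
  by_cases h2 : z = y
  · exact Or.inr (Or.inl h2)
  exact Or.inr (Or.inr (hCU ⟨hz, by simp [h1, h2]⟩))

lemma two_faces {J U : Set X} (h : Face J U) {p q : X} (hp : p ∉ J) (hq : q ∉ J) (hpU : p ∉ U)
    (hqU : q ∉ U) : Jn J p q := by
  by_contra hpq
  obtain ⟨V, hV, hpV⟩ := face_comp h.1 hp
  obtain ⟨W, hW, hqW⟩ := face_comp h.1 hq
  obtain ⟨x, y, A, B, hA, hB, hAB, hJ⟩ := h.1
  have hxA := hA.left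
  have hyA := hA.right
  have hAJ : A ⊆ J := hJ ▸ subset_union_left
  have hBJ : B ⊆ J := hJ ▸ subset_union_right
  obtain ⟨C, hC, hCU⟩ := h.crosscut (hAJ hxA) (hAJ hyA) hA.ne
  have hout : ∀ V, Face J V → ∀ p ∈ V, p ∉ U → ∀ z ∈ V, z ∉ C := by
    intro V hV p hp hpU z hz hzC
    rcases cross_cases hCU hzC with rfl | rfl | h'
    · exact hV.notMem hz (hAJ hxA)
    · exact hV.notMem hz (hAJ hyA)
    · exact hpU (h.of_jn h' (hV.jn hz hp))
  have key : ∀ A' B', IsArc A' x y → IsArc B' x y → A' ∩ B' = {x, y} → A' ⊆ J → B' ⊆ J → Jn (A' ∪ C) p q := by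
    intro A' B' hA' hB' hAB' hAJ' hBJ'
    obtain ⟨b, hb, hbx, hby⟩ := hB'.nontriv
    have hbn : b ∉ A' ∪ C := by
      rintro (hb' | hb')
      · have : b ∈ A' ∩ B' := ⟨hb', hb⟩
        rw [hAB'] at this
        simp [hbx, hby] at this
      · rcases cross_cases hCU hb' with h' | h' | h'
        · exact hbx h'
        · exact hby h'
        · exact h.notMem h' (hBJ' hb)
    refine (Jn.of_face hV (hBJ' hb) hpV ?_ hbn).symm.trans (Jn.of_face hW (hBJ' hb) hqW ?_ hbn)
    · rintro z hz (h' | h')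
      · exact hV.notMem hz (hAJ' h')
      · exact hout V hV p hpV hpU z hz h'
    · rintro z hz (h' | h')
      · exact hW.notMem hz (hAJ' h')
      · exact hout W hW q hqW hqU z hz h'
  have h1 := key A B hA hB hAB hAJ hBJ
  have h2 := key B A hB hA (by rw [inter_comm, hAB]) hBJ hAJ
  refine hpq ((Moore.j1 _ _ _ _ (hA.isClosed.union hC.isClosed) (hB.isClosed.union hC.isClosed) ?_ h1 h2).mono ?_)
  · have : (A ∪ C) ∩ (B ∪ C) = C := by
      rw [← inter_union_distrib_right, hAB, union_eq_right]
      rintro z (rfl | rfl)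
      exacts [hC.left, hC.right]
    rw [this]
    exact hC.preconn
  · rw [hJ]
    exact union_subset_union subset_union_left subset_union_left

lemma Face.other {J U : Set X} (h : Face J U) : ∃ V, Face J V ∧ Disjoint U V ∧ U ∪ V = Jᶜ := by
  obtain ⟨p, q, hp, hq, hpq⟩ := loop_sep h.1
  have : ∃ z, z ∉ J ∧ z ∉ U := by
    by_contra! hc
    exact hpq (h.jn (hc p hp) (hc q hq))
  obtain ⟨z, hz, hzU⟩ := this
  obtain ⟨V, hV, hzV⟩ := face_comp h.1 hz
  refine ⟨V, hV, Set.disjoint_left.2 fun w hw hw' => hzU (h.of_jn hw (hV.jn hw' hzV)), ?_⟩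
  ext w
  constructor
  · rintro (hw | hw)
    exacts [h.notMem hw, hV.notMem hw]
  · intro hw
    by_cases hwU : w ∈ U
    · exact Or.inl hwU
    · exact Or.inr (hV.of_jn hzV (two_faces h hz hw hzU hwU))

lemma Face.compl_preconn {J U : Set X} (h : Face J U) : IsPreconnected Uᶜ := by
  obtain ⟨V, hV, hd, hu⟩ := h.other
  have : Uᶜ = closure V := by
    rw [hV.closure_eq]
    ext z
    constructor
    · intro hz
      by_cases hzJ : z ∈ J
      · exact Or.inr hzJ
      · rw [← mem_compl_iff, ← hu] at hzJ
        exact Or.inl (hzJ.resolve_left hz)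
    · rintro (hz | hz) hzU
      · exact Set.disjoint_left.1 hd hzU hz
      · exact h.notMem hzU hz
  rw [this]
  exact hV.preconn.closure

lemma cross_inter {J U A C : Set X} {x y : X} (h : Face J U) (hA : IsArc A x y) (hC : IsArc C x y)
    (hCU : C \ {x, y} ⊆ U) (hAJ : A ⊆ J) : A ∩ C = {x, y} := by
  ext z
  constructor
  · rintro ⟨h1, h2⟩
    rcases cross_cases hCU h2 with h' | h' | h'
    · simp [h']
    · simp [h']
    · exact absurd (hAJ h1) (h.notMem h')
  · rintro (rfl | rfl)
    exacts [⟨hA.left, hC.left⟩, ⟨hA.right, hC.right⟩]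

lemma theta_half {J U V A B C : Set X} {x y : X} (h : Face J U) (hV : Face J V) (hd : Disjoint U V)
    (hu : U ∪ V = Jᶜ) (hA : IsArc A x y) (hB : IsArc B x y) (hAB : A ∩ B = {x, y}) (hJ : J = A ∪ B)
    (hC : IsArc C x y) (hCU : C \ {x, y} ⊆ U) :
    ∃ U1, Face (A ∪ C) U1 ∧ U1 ⊆ U \ C ∧ ∀ z ∈ U \ C, z ∉ U1 → ∀ v ∈ V, Jn (A ∪ C) z v := by
  have hAJ : A ⊆ J := hJ ▸ subset_union_left
  have hBJ : B ⊆ J := hJ ▸ subset_union_right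
  have hloop : IsLoop (A ∪ C) := ⟨x, y, A, C, hA, hC, cross_inter h hA hC hCU hAJ, rfl⟩
  have hVn : ∀ z ∈ V, z ∉ A ∪ C := by
    rintro z hz (h' | h')
    · exact hV.notMem hz (hAJ h')
    · rcases cross_cases hCU h' with rfl | rfl | h'
      · exact hV.notMem hz (hAJ hA.left)
      · exact hV.notMem hz (hAJ hA.right)
      · exact Set.disjoint_left.1 hd h' hz
  have hBn : ∀ b ∈ B, b ∉ A → b ∉ A ∪ C := by
    rintro b hb hbA (h' | h')
    · exact hbA h'
    · rcases cross_cases hCU h' with rfl | rfl | h'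
      · exact hbA hA.left
      · exact hbA hA.right
      · exact h.notMem h' (hBJ hb)
  obtain ⟨v, hv⟩ := hV.nonempty
  obtain ⟨V1, hV1, hvV1⟩ := face_comp hloop (hVn v hv)
  obtain ⟨U1, hU1, hd1, hu1⟩ := hV1.other
  have hVV1 : ∀ z ∈ V, z ∈ V1 := fun z hz => hV1.of_jn hvV1 ⟨V, hV.preconn, hv, hz, hVn⟩
  refine ⟨U1, hU1, ?_, ?_⟩
  · intro z hz
    have hzn := hU1.notMem hz
    refine ⟨?_, fun h' => hzn (Or.inr h')⟩
    by_contra hzU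
    have hz1 : z ∈ V1 := by
      by_cases hzJ : z ∈ J
      · rw [hJ] at hzJ
        have hzB : z ∈ B := hzJ.resolve_left fun h' => hzn (Or.inl h')
        exact hV1.of_jn hvV1 (Jn.of_face hV (hBJ hzB) hv hVn hzn).symm
      · rw [← mem_compl_iff, ← hu] at hzJ
        exact hVV1 z (hzJ.resolve_left hzU)
    exact Set.disjoint_left.1 hd1 hz1 hz
  · intro z hz hz1 w hw
    have : z ∈ (A ∪ C)ᶜ := by
      rintro (h' | h')
      exacts [h.notMem hz.1 (hAJ h'), hz.2 h']
    rw [← hu1] at this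
    exact hV1.jn (this.resolve_right hz1) (hVV1 w hw)

lemma theta {J U A B C : Set X} {x y : X} (h : Face J U)
    (hA : IsArc A x y) (hB : IsArc B x y) (hAB : A ∩ B = {x, y}) (hJ : J = A ∪ B)
    (hC : IsArc C x y) (hCU : C \ {x, y} ⊆ U) :
    ∃ U1 U2, Face (A ∪ C) U1 ∧ Face (B ∪ C) U2 ∧ Disjoint U1 U2 ∧ U1 ∪ U2 = U \ C := by
  obtain ⟨V, hV, hd, hu⟩ := h.other
  have hAJ : A ⊆ J := hJ ▸ subset_union_left
  have hBJ : B ⊆ J := hJ ▸ subset_union_right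
  obtain ⟨U1, hU1, hs1, hc1⟩ := theta_half h hV hd hu hA hB hAB hJ hC hCU
  obtain ⟨U2, hU2, hs2, hc2⟩ := theta_half h hV hd hu hB hA (by rw [inter_comm, hAB])
    (by rw [hJ, union_comm]) hC hCU
  refine ⟨U1, U2, hU1, hU2, ?_, ?_⟩
  · rw [Set.disjoint_left]
    intro z hz1 hz2
    have hn : ∀ w ∈ U \ C, w ∉ A ∪ C ∧ w ∉ B ∪ C := by
      intro w hw
      constructor <;> rintro (h' | h')
      exacts [h.notMem hw.1 (hAJ h'), hw.2 h', h.notMem hw.1 (hBJ h'), hw.2 h']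
    have h12 : U1 = U2 := by
      apply Subset.antisymm
      · exact fun w hw => hU2.of_jn hz2 ⟨U1, hU1.preconn, hz1, hw, fun a ha => (hn a (hs1 ha)).2⟩
      · exact fun w hw => hU1.of_jn hz1 ⟨U2, hU2.preconn, hz2, hw, fun a ha => (hn a (hs2 ha)).1⟩
    obtain ⟨a, ha, hax, hay⟩ := hA.nontriv
    have : a ∈ B ∪ C := by
      rw [← hU2.frontier_eq, ← h12, hU1.frontier_eq]; exact Or.inl ha
    rcases this with h' | h'
    · have : a ∈ A ∩ B := ⟨ha, h'⟩
      rw [hAB] at this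
      simp [hax, hay] at this
    · have : a ∈ A ∩ C := ⟨ha, h'⟩
      rw [cross_inter h hA hC hCU hAJ] at this
      simp [hax, hay] at this
  · refine (union_subset hs1 hs2).antisymm fun z hz => ?_
    by_contra hn
    obtain ⟨v, hv⟩ := hV.nonempty
    have h1 := hc1 z hz (fun h' => hn (Or.inl h')) v hv
    have h2 := hc2 z hz (fun h' => hn (Or.inr h')) v hv
    have : Jn J z v := by
      refine (Moore.j1 _ _ _ _ (hA.isClosed.union hC.isClosed) (hB.isClosed.union hC.isClosed)
        ?_ h1 h2).mono ?_
      · have : (A ∪ C) ∩ (B ∪ C) = C := by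
          rw [← inter_union_distrib_right, hAB, union_eq_right]
          rintro z (rfl | rfl)
          exacts [hC.left, hC.right]
        rw [this]
        exact hC.preconn
      · rw [hJ]
        exact union_subset_union subset_union_left subset_union_left
    exact Set.disjoint_left.1 hd (h.of_jn hz.1 this) hv

lemma Face.cross_through {J U : Set X} (h : Face J U) {p : X} (hp : p ∈ U) :
    ∃ x y C, x ∈ J ∧ y ∈ J ∧ x ≠ y ∧ IsArc C x y ∧ C \ {x, y} ⊆ U ∧ p ∈ C := by
  obtain ⟨x, y, A, B, hA, hB, hAB, hJ⟩ := h.1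
  have hxJ : x ∈ J := hJ ▸ Or.inl hA.left
  have hyJ : y ∈ J := hJ ▸ Or.inl hA.right
  have hpJ := h.notMem hp
  have hxp : x ≠ p := fun e => hpJ (e ▸ hxJ)
  obtain ⟨α, hα, hαU⟩ := access h.1.isClosed h.isOpen h.preconn
    (Set.disjoint_left.2 fun _ hz => h.notMem hz) h.frontier_sub (h.mem_closure hxJ)
    (subset_closure hp) hxp (nice_loop h.1 hxJ)
    (fun W _ _ => ⟨J, h.1.isClosed, h.1.preconn, le_rfl, hpJ, by simp⟩)
  have hαJ : α ∩ J = {x} := by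
    ext z
    constructor
    · rintro ⟨hz, hzJ⟩
      rcases cross_cases hαU hz with h' | rfl | h'
      · exact h'
      · exact absurd hzJ hpJ
      · exact absurd hzJ (h.notMem h')
    · rintro rfl
      exact ⟨hα.left, hxJ⟩
  have hα' : α ⊆ insert x U := by
    intro z hz
    rcases cross_cases hαU hz with h' | rfl | h'
    · exact Or.inl h'
    · exact Or.inr hp
    · exact Or.inr h'
  have hyα : y ∉ α := fun h' => hA.ne (show y ∈ ({x} : Set X) from hαJ ▸ ⟨h', hyJ⟩).symm
  have hG : IsOpen (U \ α) := h.isOpen.sdiff hα.isClosed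
  have hGc : IsPreconnected (U \ α) := by
    have e : U \ α = (Uᶜ ∪ α)ᶜ := by rw [compl_union, compl_compl]; rfl
    rw [e]
    refine preconn_of_Jn fun a b ha hb => ?_
    have ha' : a ∈ U \ α := by rw [e]; exact ha
    have hb' : b ∈ U \ α := by rw [e]; exact hb
    refine Moore.j1 _ _ _ _ h.isOpen.isClosed_compl hα.isClosed ?_
      ⟨U, h.preconn, ha'.1, hb'.1, by simp⟩ (arc_nonsep hα ha'.2 hb'.2)
    refine Set.Subsingleton.isPreconnected fun z hz w hw => ?_
    exact ((hα' hz.2).resolve_right hz.1).trans ((hα' hw.2).resolve_right hw.1).symm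
  have hfr : frontier (U \ α) ⊆ J ∪ α := by
    intro z hz
    rw [sdiff_eq] at hz
    rcases frontier_inter_subset _ _ hz with h' | h'
    · exact Or.inl (h.frontier_sub h'.1)
    · refine Or.inr ?_
      have := h'.2
      rw [frontier_compl] at this
      exact hα.isClosed.frontier_subset this
  have hpcl : p ∈ closure (U \ α) := by
    have := arc_end_closure hα.symm
    exact h.isOpen.inter_closure ⟨hp, this⟩
  have hycl : y ∈ closure (U \ α) := by
    have := hα.isClosed.isOpen_compl.inter_closure ⟨hyα, h.mem_closure hyJ⟩
    rwa [inter_comm] at this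
  have hpy : p ≠ y := fun e => hpJ (e ▸ hyJ)
  obtain ⟨β, hβ, hβU⟩ := access (h.1.isClosed.union hα.isClosed) hG hGc
    (Set.disjoint_left.2 fun z hz hz' => hz'.elim (h.notMem hz.1) hz.2) hfr hpcl hycl hpy
    (nice_lollipop_end h.1 hα hαJ) (nice_lollipop_base h.1 hα hαJ hyJ hA.ne.symm)
  refine ⟨x, y, α ∪ β, hxJ, hyJ, hA.ne, hα.concat hβ ?_, ?_, Or.inl hα.right⟩
  · rintro z ⟨h1, h2⟩
    rcases cross_cases hβU h2 with h' | rfl | h'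
    · exact h'
    · exact absurd h1 hyα
    · exact absurd h1 h'.2
  · rintro z ⟨h1 | h1, h2⟩
    · exact (hα' h1).resolve_left fun e => h2 (by simp [e])
    · rcases cross_cases hβU h1 with rfl | rfl | h'
      · exact hp
      · exact absurd (by simp) h2
      · exact h'.1

lemma loop_through (p w : X) (hpw : p ≠ w) : ∃ J : Set X, IsLoop J ∧ p ∈ J ∧ w ∈ J := by
  have one : ∀ (J : Set X) (P : X), IsLoop J → ∀ w ∈ J, ∃ J', IsLoop J' ∧ w ∈ J' ∧ P ∈ J' := by
    intro J P hJ w hw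
    by_cases hP : P ∈ J
    · exact ⟨J, hJ, hw, hP⟩
    obtain ⟨U, hU, hPU⟩ := face_comp hJ hP
    obtain ⟨x, y, C, hx, hy, hxy, hC, hCU, hPC⟩ := hU.cross_through hPU
    obtain ⟨A, B, hA, hB, hAB, e⟩ := hJ.resplit hx hy hxy
    have hAJ : A ⊆ J := e ▸ subset_union_left
    have hBJ : B ⊆ J := e ▸ subset_union_right
    rcases (e ▸ hw : w ∈ A ∪ B) with h | h
    · exact ⟨A ∪ C, ⟨x, y, A, C, hA, hC, cross_inter hU hA hC hCU hAJ, rfl⟩, Or.inl h, Or.inr hPC⟩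
    · exact ⟨B ∪ C, ⟨x, y, B, C, hB, hC, cross_inter hU hB hC hCU hBJ, rfl⟩, Or.inl h, Or.inr hPC⟩
  obtain ⟨J, hJ⟩ := exists_loop (X := X)
  obtain ⟨u, hu⟩ : J.Nonempty := by
    obtain ⟨a, b, A, B, hA, hB, hAB, e⟩ := hJ
    exact ⟨a, e ▸ Or.inl hA.left⟩
  obtain ⟨J', hJ', -, hp⟩ := one J p hJ u hu
  obtain ⟨J'', hJ'', h1, h2⟩ := one J' w hJ' p hp
  exact ⟨J'', hJ'', h1, h2⟩

lemma sep_loop (p w : X) (hpw : p ≠ w) : ∃ Q : Set X, IsLoop Q ∧ p ∉ Q ∧ w ∉ Q ∧ ¬ Jn Q p w := by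
  obtain ⟨J, hJ, hp, hw⟩ := loop_through p w hpw
  obtain ⟨A, B, hA, hB, hAB, e⟩ := hJ.resplit hp hw hpw
  obtain ⟨x, hx, hxp, hxw⟩ := hA.nontriv
  obtain ⟨y, hy, hyp, hyw⟩ := hB.nontriv
  obtain ⟨A1, A2, hA1, hA2, eA, iA⟩ := hA.split hx hxp hxw
  obtain ⟨B1, B2, hB1, hB2, eB, iB⟩ := hB.split hy hyp hyw
  have hAB' : ∀ z, z ∈ A → z ∈ B → z = p ∨ z = w := fun z h1 h2 => by
    have : z ∈ A ∩ B := ⟨h1, h2⟩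
    rw [hAB] at this
    simpa using this
  have sA1 : A1 ⊆ A := eA ▸ subset_union_left
  have sA2 : A2 ⊆ A := eA ▸ subset_union_right
  have sB1 : B1 ⊆ B := eB ▸ subset_union_left
  have sB2 : B2 ⊆ B := eB ▸ subset_union_right
  have iA' : ∀ z, z ∈ A1 → z ∈ A2 → z = x := fun z h1 h2 => by
    have : z ∈ A1 ∩ A2 := ⟨h1, h2⟩
    rw [iA] at this
    simpa using this
  have iB' : ∀ z, z ∈ B1 → z ∈ B2 → z = y := fun z h1 h2 => by
    have : z ∈ B1 ∩ B2 := ⟨h1, h2⟩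
    rw [iB] at this
    simpa using this
  have hwA1 : w ∉ A1 := fun h => hxw (iA' w h hA2.right).symm
  have hwB1 : w ∉ B1 := fun h => hyw (iB' w h hB2.right).symm
  have hpA2 : p ∉ A2 := fun h => hxp (iA' p hA1.left h).symm
  have hpB2 : p ∉ B2 := fun h => hyp (iB' p hB1.left h).symm
  have hxy : x ≠ y := by
    rintro rfl
    rcases hAB' x hx hy with h | h
    exacts [hxp h, hxw h]
  have hE : IsArc (A1 ∪ B1) x y := hA1.symm.concat hB1 (by
    rintro z ⟨h1, h2⟩
    rcases hAB' z (sA1 h1) (sB1 h2) with rfl | rfl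
    · rfl
    · exact absurd h1 hwA1)
  have hF : IsArc (A2 ∪ B2) x y := hA2.concat hB2.symm (by
    rintro z ⟨h1, h2⟩
    rcases hAB' z (sA2 h1) (sB2 h2) with rfl | rfl
    · exact absurd h1 hpA2
    · rfl)
  have hEF : (A1 ∪ B1) ∩ (A2 ∪ B2) = {x, y} := by
    ext z
    constructor
    · rintro ⟨h1 | h1, h2 | h2⟩
      · simp [iA' z h1 h2]
      · rcases hAB' z (sA1 h1) (sB2 h2) with rfl | rfl
        exacts [absurd h2 hpB2, absurd h1 hwA1]
      · rcases hAB' z (sA2 h2) (sB1 h1) with rfl | rfl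
        exacts [absurd h2 hpA2, absurd h1 hwB1]
      · simp [iB' z h1 h2]
    · rintro (rfl | rfl)
      exacts [⟨hE.left, hF.left⟩, ⟨hE.right, hF.right⟩]
  have hJE : J = (A1 ∪ B1) ∪ (A2 ∪ B2) := by
    rw [e, eA, eB, union_union_union_comm]
  have hpE : p ∈ A1 ∪ B1 := Or.inl hA1.left
  have hwF : w ∈ A2 ∪ B2 := Or.inl hA2.right
  have hpx := hxp.symm
  have hpy := hyp.symm
  have hwx := hxw.symm
  have hwy := hyw.symm
  generalize A1 ∪ B1 = E at *
  generalize A2 ∪ B2 = F at *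
  have hEJ : E ⊆ J := hJE ▸ subset_union_left
  have hFJ : F ⊆ J := hJE ▸ subset_union_right
  obtain ⟨q, -, hq, -⟩ := loop_sep hJ
  obtain ⟨U, hU, -⟩ := face_comp hJ hq
  obtain ⟨V, hV, hd, hu⟩ := hU.other
  obtain ⟨c, hc, hcU⟩ := hU.crosscut (hEJ hE.left) (hEJ hE.right) hxy
  obtain ⟨c', hc', hcV⟩ := hV.crosscut (hEJ hE.left) (hEJ hE.right) hxy
  have hQ : IsLoop (c ∪ c') := by
    refine ⟨x, y, c, c', hc, hc', ?_, rfl⟩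
    ext z
    constructor
    · rintro ⟨h1, h2⟩
      rcases cross_cases hcU h1 with h' | h' | h'
      · simp [h']
      · simp [h']
      rcases cross_cases hcV h2 with h'' | h'' | h''
      · simp [h'']
      · simp [h'']
      exact absurd h'' (Set.disjoint_left.1 hd h')
    · rintro (rfl | rfl)
      exacts [⟨hc.left, hc'.left⟩, ⟨hc.right, hc'.right⟩]
  have hJQ : ∀ z ∈ J, z ≠ x → z ≠ y → z ∉ c ∪ c' := by
    rintro z hz hzx hzy (h' | h')
    · rcases cross_cases hcU h' with h' | h' | h'
      exacts [hzx h', hzy h', hU.notMem h' hz]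
    · rcases cross_cases hcV h' with h' | h' | h'
      exacts [hzx h', hzy h', hV.notMem h' hz]
  refine ⟨c ∪ c', hQ, hJQ p hp hpx hpy, hJQ w hw hwx hwy, fun hj => ?_⟩
  have side : ∀ U c K, Face J U → IsArc c x y → c \ {x, y} ⊆ U → c ⊆ K → (∀ z ∈ U, z ∈ K → z ∈ c) →
      p ∉ K → w ∉ K → Jn K p w → ∀ z ∈ U ∪ J, z ∉ K → Jn K p z := by
    intro U c K hU hc hcU hcK hK hpK hwK hj z hz hzK
    obtain ⟨U1, U2, hU1, hU2, -, h12⟩ := theta hU hE hF hEF hJE hc hcU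
    have hn1 : ∀ z ∈ U1, z ∉ K := fun z hz hzK => by
      have : z ∈ U \ c := h12 ▸ Or.inl hz
      exact this.2 (hK z this.1 hzK)
    have hn2 : ∀ z ∈ U2, z ∉ K := fun z hz hzK => by
      have : z ∈ U \ c := h12 ▸ Or.inr hz
      exact this.2 (hK z this.1 hzK)
    have k1 : ∀ z ∈ U1, Jn K p z := fun z hz => Jn.of_face hU1 (Or.inl hpE) hz hn1 hpK
    have k2 : ∀ z ∈ U2, Jn K p z := fun z hz => hj.trans (Jn.of_face hU2 (Or.inl hwF) hz hn2 hwK)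
    rcases hz with hz | hz
    · have : z ∈ U \ c := ⟨hz, fun h' => hzK (hcK h')⟩
      rw [← h12] at this
      exact this.elim (k1 z) (k2 z)
    · rcases (hJE ▸ hz : z ∈ E ∪ F) with h | h
      · obtain ⟨u, hu⟩ := hU1.nonempty
        exact (k1 u hu).trans (Jn.of_face hU1 (Or.inl h) hu hn1 hzK).symm
      · obtain ⟨u, hu⟩ := hU2.nonempty
        exact (k2 u hu).trans (Jn.of_face hU2 (Or.inl h) hu hn2 hzK).symm
  have hall : ∀ z, z ∉ c ∪ c' → Jn (c ∪ c') p z := by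
    intro z hz
    have hcV' : ∀ z ∈ c', z ∉ U := fun z h' hzU => by
      rcases cross_cases hcV h' with rfl | rfl | h'
      · exact hU.notMem hzU (hEJ hE.left)
      · exact hU.notMem hzU (hEJ hE.right)
      · exact Set.disjoint_left.1 hd hzU h'
    have hcU' : ∀ z ∈ c, z ∉ V := fun z h' hzU => by
      rcases cross_cases hcU h' with rfl | rfl | h'
      · exact hV.notMem hzU (hEJ hE.left)
      · exact hV.notMem hzU (hEJ hE.right)
      · exact Set.disjoint_left.1 hd h' hzU
    by_cases hzV : z ∈ V
    · exact side V c' _ hV hc' hcV subset_union_right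
        (fun z hz h => h.resolve_left fun h' => hcU' z h' hz) hj.left hj.right hj z (Or.inl hzV) hz
    · refine side U c _ hU hc hcU subset_union_left
        (fun z hz h => h.resolve_right fun h' => hcV' z h' hz) hj.left hj.right hj z ?_ hz
      by_cases hzJ : z ∈ J
      · exact Or.inr hzJ
      · rw [← mem_compl_iff, ← hu] at hzJ
        exact Or.inl (hzJ.resolve_right hzV)
  obtain ⟨q, r, hq, hr, hqr⟩ := loop_sep hQ
  exact hqr ((hall q hq).symm.trans (hall r hr))

end
end MQ


set_option linter.unusedSectionVars false
set_option linter.unusedVariables false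
namespace MQ

section
variable {X : Type*} [TopologicalSpace X] [Moore X]

def Gates (f : ℝ → X) (U : Set X) : Set (Set X) :=
  {C | ∃ s e : ℝ, 0 ≤ s ∧ s < e ∧ e ≤ 1 ∧ f s ∉ U ∧ f e ∉ U ∧ f '' Ioo s e ⊆ U ∧ C = f '' Icc s e}

lemma gate_arc {U : Set X} (hU : IsOpen U) (hUc : IsPreconnected U) (hUc' : IsPreconnected Uᶜ)
    {f : ℝ → X} (hf : ContinuousOn f (Icc 0 1)) (hi : InjOn f (Icc 0 1)) (h0 : f 0 ∉ U) (h1 : f 1 ∉ U)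
    {v w : X} (hv : v ∈ U) (hw : w ∈ U) (hg : ∀ C ∈ Gates f U, Jn (Uᶜ ∪ C) v w) :
    Jn (Uᶜ ∪ f '' Icc 0 1) v w := by
  have hcl : ∀ s e : ℝ, 0 ≤ s → e ≤ 1 → IsClosed (Uᶜ ∪ f '' Icc s e) := fun s e hs he =>
    hU.isClosed_compl.union
      (isCompact_Icc.image_of_continuousOn (hf.mono (Icc_subset_Icc hs he))).isClosed
  have comb : ∀ s e : ℝ, 0 ≤ s → s ≤ e → e ≤ 1 → f s ∉ U → Jn (Uᶜ ∪ f '' Icc 0 s) v w →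
      Jn (Uᶜ ∪ f '' Icc s e) v w → Jn (Uᶜ ∪ f '' Icc 0 e) v w := by
    intro s e hs hse he hsU h1 h2
    have := Moore.j1 _ _ _ _ (hcl 0 s le_rfl (hse.trans he)) (hcl s e hs he) ?_ h1 h2
    · refine this.mono ?_
      rw [← Icc_union_Icc_eq_Icc hs hse, image_union]
      rintro z (h | h | h)
      exacts [Or.inl (Or.inl h), Or.inl (Or.inr h), Or.inr (Or.inr h)]
    · have e' : (Uᶜ ∪ f '' Icc 0 s) ∩ (Uᶜ ∪ f '' Icc s e) = Uᶜ := by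
        refine Subset.antisymm ?_ (subset_inter subset_union_left subset_union_left)
        rintro z ⟨h | ⟨a, ha, rfl⟩, h' | ⟨b, hb, hab⟩⟩
        · exact h
        · exact h
        · exact h'
        · have : b = a := hi ⟨hs.trans hb.1, hb.2.trans he⟩ ⟨ha.1, ha.2.trans (hse.trans he)⟩ hab
          subst this
          rwa [le_antisymm ha.2 hb.1]
      rw [e']
      exact hUc'
  obtain ⟨σ, hσ, hσc, hσN, hσU⟩ := exists_compact_preconn hU hUc (N := {v, w})
    (by simp) (by rintro z (rfl | rfl) <;> assumption)
  have near : ∀ τ ∈ Icc (0:ℝ) 1, f τ ∉ U → ∃ ε > 0, ∀ s e : ℝ, 0 ≤ s → e ≤ 1 → τ - ε < s → e < τ + ε →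
      Jn (Uᶜ ∪ f '' Icc s e) v w := by
    intro τ hτ hτU
    have : f ⁻¹' σᶜ ∈ 𝓝[Icc 0 1] τ := (hf τ hτ) (hσ.isClosed.isOpen_compl.mem_nhds fun h => hτU (hσU h))
    rw [Metric.mem_nhdsWithin_iff] at this
    obtain ⟨ε, hε, hb⟩ := this
    refine ⟨ε, hε, fun s e hs he hs' he' => ⟨σ, hσc, hσN (by simp), hσN (by simp), ?_⟩⟩
    rintro z hz (hzU | ⟨a, ha, rfl⟩)
    · exact hzU (hσU hz)
    · refine hb ⟨?_, hs.trans ha.1, ha.2.trans he⟩ hz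
      rw [Metric.mem_ball, Real.dist_eq, abs_lt]
      constructor <;> linarith [ha.1, ha.2]
  have hBd : IsClosed (Icc (0:ℝ) 1 ∩ f ⁻¹' Uᶜ) :=
    hf.preimage_isClosed_of_isClosed isClosed_Icc hU.isClosed_compl
  set M : Set ℝ := {t | t ∈ Icc (0:ℝ) 1 ∩ f ⁻¹' Uᶜ ∧ Jn (Uᶜ ∪ f '' Icc 0 t) v w} with hM
  have hM0 : (0:ℝ) ∈ M := by
    refine ⟨⟨⟨le_rfl, zero_le_one⟩, h0⟩, U, hUc, hv, hw, ?_⟩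
    rintro z hz (h | h)
    · exact h hz
    · simp only [Icc_self, image_singleton, mem_singleton_iff] at h
      exact h0 (h ▸ hz)
  have hbdd : BddAbove M := ⟨1, fun t ht => ht.1.1.2⟩
  have hτ : sSup M ∈ Icc (0:ℝ) 1 ∩ f ⁻¹' Uᶜ := by
    have := csSup_mem_closure ⟨0, hM0⟩ hbdd
    exact hBd.closure_subset_iff.2 (fun t ht => ht.1) this
  have hup : ∀ t ∈ M, t ≤ sSup M := fun t ht => le_csSup hbdd ht
  obtain ⟨ε, hε, hnear⟩ := near _ hτ.1 hτ.2
  have hτM : sSup M ∈ M := by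
    obtain ⟨s, hs, hs'⟩ := exists_lt_of_lt_csSup ⟨0, hM0⟩ (sub_lt_self (sSup M) hε)
    exact ⟨hτ, comb s _ hs.1.1.1 (hup s hs) hτ.1.2 hs.1.2 hs.2
      (hnear s _ hs.1.1.1 hτ.1.2 hs' (by linarith))⟩
  generalize sSup M = τ at *
  rcases hτ.1.2.eq_or_lt with rfl | hτ1
  · exact hτM.2
  exfalso
  set N : Set ℝ := {t | τ < t ∧ t ≤ 1 ∧ f t ∉ U} with hN
  have hN1 : (1:ℝ) ∈ N := ⟨hτ1, le_rfl, h1⟩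
  have hbb : BddBelow N := ⟨τ, fun t ht => ht.1.le⟩
  have hlow : ∀ t ∈ N, sInf N ≤ t := fun t ht => csInf_le hbb ht
  have hτe : τ ≤ sInf N := le_csInf ⟨1, hN1⟩ fun t ht => ht.1.le
  rcases hτe.eq_or_lt with heq | hlt
  · obtain ⟨s, hs, hs'⟩ := exists_lt_of_csInf_lt ⟨1, hN1⟩ (show sInf N < τ + ε by linarith)
    have : s ∈ M := ⟨⟨⟨hτ.1.1.trans hs.1.le, hs.2.1⟩, hs.2.2⟩, comb τ s hτ.1.1 hs.1.le hs.2.1 hτ.2 hτM.2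
      (hnear τ s hτ.1.1 hs.2.1 (by linarith) hs')⟩
    exact absurd (hup s this) (not_le.2 hs.1)
  · have he : sInf N ∈ Icc (0:ℝ) 1 ∩ f ⁻¹' Uᶜ := by
      have := csInf_mem_closure ⟨1, hN1⟩ hbb
      exact hBd.closure_subset_iff.2 (fun t ht => ⟨⟨hτ.1.1.trans ht.1.le, ht.2.1⟩, ht.2.2⟩) this
    have : sInf N ∈ M := by
      refine ⟨he, comb τ _ hτ.1.1 hlt.le he.1.2 hτ.2 hτM.2 (hg _ ⟨τ, _, hτ.1.1, hlt, he.1.2, hτ.2, he.2, ?_, rfl⟩)⟩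
      rintro _ ⟨a, ha, rfl⟩
      by_contra haU
      exact absurd (hlow a ⟨ha.1, ha.2.le.trans he.1.2, haU⟩) (not_le.2 ha.2)
    exact absurd (hup _ this) (not_le.2 hlt)

lemma gate_isArc {U : Set X} {f : ℝ → X} (hf : ContinuousOn f (Icc 0 1)) (hi : InjOn f (Icc 0 1)) {C : Set X}
    (hC : C ∈ Gates f U) : ∃ x y, IsArc C x y ∧ C \ {x, y} ⊆ U ∧ x ∉ U ∧ y ∉ U := by
  obtain ⟨s, e, hs, hse, he, hsU, heU, hsub, rfl⟩ := hC
  have hss := Icc_subset_Icc hs he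
  refine ⟨f s, f e, IsArc.of_Icc hse (hf.mono hss) (hi.mono hss), ?_, hsU, heU⟩
  rintro _ ⟨⟨a, ha, rfl⟩, hn⟩
  refine hsub ⟨a, ⟨ha.1.lt_of_ne ?_, ha.2.lt_of_ne ?_⟩, rfl⟩
  · rintro rfl; simp at hn
  · rintro rfl; simp at hn

lemma gate_sub {U : Set X} {f : ℝ → X} {C : Set X} (hC : C ∈ Gates f U) : C ⊆ f '' Icc 0 1 := by
  obtain ⟨s, e, hs, hse, he, hsU, heU, hsub, rfl⟩ := hC
  exact image_mono (Icc_subset_Icc hs he)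

lemma gate_disj {U : Set X} {f : ℝ → X} (hi : InjOn f (Icc 0 1)) {C C' : Set X}
    (hC : C ∈ Gates f U) (hC' : C' ∈ Gates f U) (hne : C ≠ C') {z : X} (hz : z ∈ C) (hz' : z ∈ C') : z ∉ U := by
  obtain ⟨s, e, hs, hse, he, hsU, heU, hsub, rfl⟩ := hC
  obtain ⟨s', e', hs', hse', he', hsU', heU', hsub', rfl⟩ := hC'
  intro hzU
  obtain ⟨a, ha, rfl⟩ := hz
  obtain ⟨b, hb, hab⟩ := hz'
  have : b = a := hi (Icc_subset_Icc hs' he' hb) (Icc_subset_Icc hs he ha) hab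
  subst this
  have ha1 : s < b := ha.1.lt_of_ne (by rintro rfl; exact hsU hzU)
  have ha2 : b < e := ha.2.lt_of_ne (by rintro rfl; exact heU hzU)
  have hb1 : s' < b := hb.1.lt_of_ne (by rintro rfl; exact hsU' hzU)
  have hb2 : b < e' := hb.2.lt_of_ne (by rintro rfl; exact heU' hzU)
  have e1 : s = s' := by
    rcases lt_trichotomy s s' with h | h | h
    · exact absurd (hsub ⟨s', ⟨h, hb1.trans ha2⟩, rfl⟩) hsU'
    · exact h
    · exact absurd (hsub' ⟨s, ⟨h, ha1.trans hb2⟩, rfl⟩) hsU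
  have e2 : e = e' := by
    rcases lt_trichotomy e e' with h | h | h
    · exact absurd (hsub' ⟨e, ⟨hb1.trans ha2, h⟩, rfl⟩) heU
    · exact h
    · exact absurd (hsub ⟨e', ⟨ha1.trans hb2, h⟩, rfl⟩) heU'
  exact hne (by rw [e1, e2])

lemma exists_cuts {J U Q K1 K2 : Set X} (h : Face J U) (hQ : IsLoop Q) (hK1 : IsClosed K1) (hK2 : IsClosed K2)
    (hsep : ∀ v ∈ K1, ∀ w ∈ K2, v ∉ Q ∧ w ∉ Q ∧ ¬ Jn Q v w) {p1 p2 : X} (hp : p1 ≠ p2)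
    (hp1 : p1 ∈ Q) (hp2 : p2 ∈ Q) (hp1U : p1 ∉ U) (hp2U : p2 ∉ U) :
    ∃ 𝒢 : Set (Set X), 𝒢.Finite ∧ (∀ C ∈ 𝒢, ∃ x y, IsArc C x y ∧ C \ {x, y} ⊆ U ∧ x ∉ U ∧ y ∉ U ∧ C ⊆ Q) ∧
      (∀ C ∈ 𝒢, ∀ C' ∈ 𝒢, C ≠ C' → ∀ z ∈ C, z ∈ C' → z ∉ U) ∧
      ∀ v ∈ K1, ∀ w ∈ K2, v ∈ U → w ∈ U → ∃ C ∈ 𝒢, ¬ Jn (Uᶜ ∪ C) v w := by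
  obtain ⟨Q1, Q2, hQ1, hQ2, hQi, hQu⟩ := hQ.resplit hp1 hp2 hp
  have hQ1c := hQ1.isClosed
  have hQ2c := hQ2.isClosed
  obtain ⟨f, hf, hfi, hfQ, hf0, hf1⟩ := hQ1
  obtain ⟨g, hg, hgi, hgQ, hg0, hg1⟩ := hQ2
  set 𝒞 : Set (Set X) := Gates f U ∪ Gates g U
  have hsub1 : ∀ C ∈ Gates f U, C ⊆ Q1 := fun C hC => hfQ ▸ gate_sub hC
  have hsub2 : ∀ C ∈ Gates g U, C ⊆ Q2 := fun C hC => hgQ ▸ gate_sub hC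
  have c1 : ∀ C ∈ 𝒞, ∃ x y, IsArc C x y ∧ C \ {x, y} ⊆ U ∧ x ∉ U ∧ y ∉ U ∧ C ⊆ Q := by
    rintro C (hC | hC)
    · obtain ⟨x, y, h1, h2, h3, h4⟩ := gate_isArc hf hfi hC
      exact ⟨x, y, h1, h2, h3, h4, hQu ▸ (hsub1 C hC).trans subset_union_left⟩
    · obtain ⟨x, y, h1, h2, h3, h4⟩ := gate_isArc hg hgi hC
      exact ⟨x, y, h1, h2, h3, h4, hQu ▸ (hsub2 C hC).trans subset_union_right⟩
  have hends : ∀ z, z ∈ Q1 → z ∈ Q2 → z ∉ U := by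
    intro z h1 h2
    have : z ∈ Q1 ∩ Q2 := ⟨h1, h2⟩
    rw [hQi] at this
    rcases this with rfl | rfl <;> assumption
  have c2 : ∀ C ∈ 𝒞, ∀ C' ∈ 𝒞, C ≠ C' → ∀ z ∈ C, z ∈ C' → z ∉ U := by
    rintro C (hC | hC) C' (hC' | hC') hne z hz hz'
    · exact gate_disj hfi hC hC' hne hz hz'
    · exact hends z (hsub1 C hC hz) (hsub2 C' hC' hz')
    · exact hends z (hsub1 C' hC' hz') (hsub2 C hC hz)
    · exact gate_disj hgi hC hC' hne hz hz'
  have c3 : ∀ v w, v ∈ U → w ∈ U → ¬ Jn Q v w → ∃ C ∈ 𝒞, ¬ Jn (Uᶜ ∪ C) v w := by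
    intro v w hv hw hj
    by_contra! hc
    have j1 := gate_arc h.isOpen h.preconn h.compl_preconn hf hfi (hf0 ▸ hp1U) (hf1 ▸ hp2U) hv hw
      (fun C hC => hc C (Or.inl hC))
    have j2 := gate_arc h.isOpen h.preconn h.compl_preconn hg hgi (hg0 ▸ hp1U) (hg1 ▸ hp2U) hv hw
      (fun C hC => hc C (Or.inr hC))
    rw [hfQ] at j1
    rw [hgQ] at j2
    have hUc := h.isOpen.isClosed_compl
    have := Moore.j1 _ _ _ _ (hUc.union hQ1c) (hUc.union hQ2c) ?_ j1 j2
    · refine hj (this.mono ?_)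
      rw [hQu]
      exact union_subset_union subset_union_right subset_union_right
    · have : (Uᶜ ∪ Q1) ∩ (Uᶜ ∪ Q2) = Uᶜ := by
        rw [← union_inter_distrib_left, hQi, union_eq_left]
        rintro z (rfl | rfl) <;> assumption
      rw [this]
      exact h.compl_preconn
  have loc : ∀ v, v ∉ Q → ∃ V, IsOpen V ∧ v ∈ V ∧ ∀ p ∈ V, ∀ q ∈ V, p ∈ U → q ∈ U → Jn (Uᶜ ∪ Q) p q := by
    intro v hv
    have hN : Nice J v := by
      by_cases hvJ : v ∈ J
      · exact nice_loop h.1 hvJ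
      · exact fun W _ _ => ⟨J, h.1.isClosed, h.1.preconn, le_rfl, hvJ, by simp⟩
    obtain ⟨V, hV, hvV, -, hVJ⟩ := LC h.1.isClosed hN hQ.isClosed.isOpen_compl hv
    refine ⟨V, hV, hvV, fun p hp q hq hpU hqU => ?_⟩
    obtain ⟨D, hD, hpD, hqD, hDn⟩ := hVJ p ⟨hp, h.notMem hpU⟩ q ⟨hq, h.notMem hqU⟩ (h.jn hpU hqU)
    rw [compl_compl] at hDn
    refine ⟨D, hD, hpD, hqD, ?_⟩
    have hDU : D ⊆ U := stays hD hpD hpU (fun z hz hzJ => hDn hz (Or.inl hzJ)) h.frontier_sub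
    rintro z hz (hz' | hz')
    exacts [hz' (hDU hz), hDn hz (Or.inr hz')]
  have hcomp : IsCompact ((K1 ∩ closure U) ×ˢ (K2 ∩ closure U)) :=
    (hK1.inter isClosed_closure).isCompact.prod (hK2.inter isClosed_closure).isCompact
  have key : ∃ 𝒢 : Set (Set X), 𝒢.Finite ∧ 𝒢 ⊆ 𝒞 ∧ ∀ z ∈ (K1 ∩ closure U) ×ˢ (K2 ∩ closure U), z.1 ∈ U → z.2 ∈ U →
      ∃ C ∈ 𝒢, ¬ Jn (Uᶜ ∪ C) z.1 z.2 := by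
    refine hcomp.induction_on (p := fun S => ∃ 𝒢 : Set (Set X), 𝒢.Finite ∧ 𝒢 ⊆ 𝒞 ∧ ∀ z ∈ S, z.1 ∈ U → z.2 ∈ U →
      ∃ C ∈ 𝒢, ¬ Jn (Uᶜ ∪ C) z.1 z.2) ?_ ?_ ?_ ?_
    · exact ⟨∅, finite_empty, empty_subset _, by simp⟩
    · rintro S T hST ⟨𝒢, h1, h2, h3⟩
      exact ⟨𝒢, h1, h2, fun z hz => h3 z (hST hz)⟩
    · rintro S T ⟨𝒢, h1, h2, h3⟩ ⟨𝒢', h1', h2', h3'⟩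
      refine ⟨𝒢 ∪ 𝒢', h1.union h1', union_subset h2 h2', ?_⟩
      rintro z (hz | hz) hz1 hz2
      · obtain ⟨C, hC, hC'⟩ := h3 z hz hz1 hz2
        exact ⟨C, Or.inl hC, hC'⟩
      · obtain ⟨C, hC, hC'⟩ := h3' z hz hz1 hz2
        exact ⟨C, Or.inr hC, hC'⟩
    · rintro ⟨v, w⟩ ⟨⟨hv, hvU⟩, hw, hwU⟩
      obtain ⟨hvQ, hwQ, hvw⟩ := hsep v hv w hw
      obtain ⟨V, hV, hvV, hVj⟩ := loc v hvQ
      obtain ⟨W, hW, hwW, hWj⟩ := loc w hwQ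
      obtain ⟨v', hv'V, hv'U⟩ := mem_closure_iff.1 hvU (V ∩ Qᶜ ∩ (connectedComponentIn Qᶜ v))
        ((hV.inter hQ.isClosed.isOpen_compl).inter hQ.isClosed.isOpen_compl.connectedComponentIn)
        ⟨⟨hvV, hvQ⟩, mem_connectedComponentIn hvQ⟩
      obtain ⟨w', hw'V, hw'U⟩ := mem_closure_iff.1 hwU (W ∩ Qᶜ ∩ (connectedComponentIn Qᶜ w))
        ((hW.inter hQ.isClosed.isOpen_compl).inter hQ.isClosed.isOpen_compl.connectedComponentIn)
        ⟨⟨hwW, hwQ⟩, mem_connectedComponentIn hwQ⟩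
      obtain ⟨C, hC, hCj⟩ := c3 v' w' hv'U hw'U (fun hj => hvw
        (((Jn_iff.2 hv'V.2).trans hj).trans (Jn_iff.2 hw'V.2).symm))
      refine ⟨V ×ˢ W, mem_nhdsWithin_of_mem_nhds ((hV.prod hW).mem_nhds ⟨hvV, hwW⟩), {C}, finite_singleton _,
        by simpa using hC, ?_⟩
      rintro ⟨a, b⟩ ⟨ha, hb⟩ haU hbU
      refine ⟨C, rfl, fun hj => hCj ?_⟩
      have hCQ : Uᶜ ∪ C ⊆ Uᶜ ∪ Q := union_subset_union le_rfl (by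
        obtain ⟨x, y, -, -, -, -, h5⟩ := c1 C hC
        exact h5)
      exact (((hVj v' hv'V.1.1 a ha hv'U haU).mono hCQ).trans hj).trans
        ((hWj b hb w' hw'V.1.1 hbU hw'U).mono hCQ)
  obtain ⟨𝒢, g1, g2, g3⟩ := key
  refine ⟨𝒢, g1, fun C hC => c1 C (g2 hC), fun C hC C' hC' => c2 C (g2 hC) C' (g2 hC'), ?_⟩
  exact fun v hv w hw hvU hwU => g3 (v, w) ⟨⟨hv, subset_closure hvU⟩, hw, subset_closure hwU⟩ hvU hwU

end
end MQ


set_option linter.unusedSectionVars false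
set_option linter.unusedVariables false
namespace MQ

section
variable {X : Type*} [TopologicalSpace X] {Y : Type*} [TopologicalSpace Y]

lemma matched_arc {A : Set X} {A' : Set Y} {a b : X} {a' b' : Y} (hA : IsArc A a b) (hA' : IsArc A' a' b') :
    ∃ Γ : Set (X × Y), IsArc Γ (a, a') (b, b') ∧ Prod.fst '' Γ = A ∧ Prod.snd '' Γ = A' ∧
      InjOn Prod.fst Γ ∧ InjOn Prod.snd Γ := by
  obtain ⟨f, hf, hfi, rfl, rfl, rfl⟩ := hA
  obtain ⟨g, hg, hgi, rfl, rfl, rfl⟩ := hA'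
  refine ⟨(fun t => (f t, g t)) '' Icc 0 1, ⟨fun t => (f t, g t), hf.prodMk hg, ?_, rfl, rfl, rfl⟩, ?_, ?_, ?_, ?_⟩
  · intro s hs t ht h
    exact hfi hs ht (congrArg Prod.fst h)
  · rw [image_image]
  · rw [image_image]
  · rintro _ ⟨s, hs, rfl⟩ _ ⟨t, ht, rfl⟩ h
    rw [hfi hs ht h]
  · rintro _ ⟨s, hs, rfl⟩ _ ⟨t, ht, rfl⟩ h
    rw [hgi hs ht h]

lemma injOn_union {α β : Type*} {f : α → β} {E Γ : Set α} (hE : InjOn f E) (hΓ : InjOn f Γ) {P Q : α}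
    (hPE : P ∈ E) (hQE : Q ∈ E) (hPΓ : P ∈ Γ) (hQΓ : Q ∈ Γ)
    (h : ∀ z ∈ E, ∀ z' ∈ Γ, f z = f z' → f z' = f P ∨ f z' = f Q) : InjOn f (E ∪ Γ) := by
  have key : ∀ z ∈ E, ∀ z' ∈ Γ, f z = f z' → z = z' := by
    intro z hz z' hz' e
    rcases h z hz z' hz' e with h | h
    · rw [hE hz hPE (e.trans h), hΓ hz' hPΓ h]
    · rw [hE hz hQE (e.trans h), hΓ hz' hQΓ h]
  rintro z (hz | hz) z' (hz' | hz') e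
  · exact hE hz hz' e
  · exact key z hz z' hz' e
  · exact (key z' hz' z hz e.symm).symm
  · exact hΓ hz hz' e

structure Tr (X Y : Type*) where
  G : Set (X × Y)
  U : Set X
  V : Set Y

def gr (S : Set (Tr X Y)) : Set (X × Y) := ⋃ t ∈ S, t.G

structure State (S : Set (Tr X Y)) : Prop where
  fin : S.Finite
  loop : ∀ t ∈ S, IsLoop t.G
  fU : ∀ t ∈ S, Face (Prod.fst '' t.G) t.U
  fV : ∀ t ∈ S, Face (Prod.snd '' t.G) t.V
  dU : ∀ t ∈ S, ∀ t' ∈ S, ∀ x, x ∈ t.U → x ∈ t'.U → t = t'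
  dV : ∀ t ∈ S, ∀ t' ∈ S, ∀ x, x ∈ t.V → x ∈ t'.V → t = t'
  cU : ∀ x, ∃ t ∈ S, x ∈ closure t.U
  cV : ∀ x, ∃ t ∈ S, x ∈ closure t.V
  iU : InjOn Prod.fst (gr S)
  iV : InjOn Prod.snd (gr S)

def Ref (S' S : Set (Tr X Y)) : Prop := ∀ t' ∈ S', ∃ t ∈ S, t'.U ⊆ t.U ∧ t'.V ⊆ t.V

lemma Ref.refl (S : Set (Tr X Y)) : Ref S S := fun t ht => ⟨t, ht, le_rfl, le_rfl⟩

lemma Ref.trans {S S' S'' : Set (Tr X Y)} (h : Ref S S') (h' : Ref S' S'') : Ref S S'' := by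
  intro t ht
  obtain ⟨t', ht', h1, h2⟩ := h t ht
  obtain ⟨t'', ht'', h3, h4⟩ := h' t' ht'
  exact ⟨t'', ht'', h1.trans h3, h2.trans h4⟩

def Tr.swap (t : Tr X Y) : Tr Y X := ⟨Prod.swap '' t.G, t.V, t.U⟩

lemma Tr.swap_swap (t : Tr X Y) : t.swap.swap = t := by
  cases t
  simp [Tr.swap, image_image]

lemma Ref.swap {S S' : Set (Tr X Y)} (h : Ref S' S) : Ref (Tr.swap '' S') (Tr.swap '' S) := by
  rintro _ ⟨t', ht', rfl⟩
  obtain ⟨t, ht, h1, h2⟩ := h t' ht'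
  exact ⟨t.swap, ⟨t, ht, rfl⟩, h2, h1⟩

lemma swap_image (S : Set (Tr X Y)) : Tr.swap '' (Tr.swap '' S) = S := by
  rw [image_image]
  simp [Tr.swap_swap]

lemma loop_swap {G : Set (X × Y)} (h : IsLoop G) : IsLoop (Prod.swap '' G) := by
  obtain ⟨a, b, A, B, hA, hB, hAB, rfl⟩ := h
  refine ⟨_, _, _, _, hA.image continuous_swap.continuousOn Prod.swap_injective.injOn,
    hB.image continuous_swap.continuousOn Prod.swap_injective.injOn, ?_, image_union _ _ _⟩
  rw [← image_inter Prod.swap_injective, hAB, image_pair]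

lemma gr_swap (S : Set (Tr X Y)) : gr (Tr.swap '' S) = Prod.swap '' gr S := by
  simp only [gr, image_iUnion, biUnion_image, Tr.swap]

lemma State.swap {S : Set (Tr X Y)} (h : State S) : State (Tr.swap '' S) where
  fin := h.fin.image _
  loop := by
    rintro _ ⟨t, ht, rfl⟩
    exact loop_swap (h.loop t ht)
  fU := by
    rintro _ ⟨t, ht, rfl⟩
    have := h.fV t ht
    simpa [Tr.swap, image_image] using this
  fV := by
    rintro _ ⟨t, ht, rfl⟩
    have := h.fU t ht
    simpa [Tr.swap, image_image] using this
  dU := by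
    rintro _ ⟨t, ht, rfl⟩ _ ⟨t', ht', rfl⟩ x hx hx'
    rw [h.dV t ht t' ht' x hx hx']
  dV := by
    rintro _ ⟨t, ht, rfl⟩ _ ⟨t', ht', rfl⟩ x hx hx'
    rw [h.dU t ht t' ht' x hx hx']
  cU := fun x => by
    obtain ⟨t, ht, hx⟩ := h.cV x
    exact ⟨t.swap, ⟨t, ht, rfl⟩, hx⟩
  cV := fun x => by
    obtain ⟨t, ht, hx⟩ := h.cU x
    exact ⟨t.swap, ⟨t, ht, rfl⟩, hx⟩
  iU := by
    rw [gr_swap]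
    rintro _ ⟨z, hz, rfl⟩ _ ⟨z', hz', rfl⟩ e
    rw [h.iV hz hz' e]
  iV := by
    rw [gr_swap]
    rintro _ ⟨z, hz, rfl⟩ _ ⟨z', hz', rfl⟩ e
    rw [h.iU hz hz' e]

variable [Moore X] [Moore Y]

lemma State.gr_notMem {S : Set (Tr X Y)} (h : State S) {z : X × Y} (hz : z ∈ gr S) {t : Tr X Y} (ht : t ∈ S) :
    z.1 ∉ t.U := by
  intro hzt
  simp only [gr, mem_iUnion] at hz
  obtain ⟨t', ht', hz'⟩ := hz
  have hJ : z.1 ∈ Prod.fst '' t'.G := ⟨z, hz', rfl⟩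
  obtain ⟨u, hu, hu'⟩ := mem_closure_iff.1 ((h.fU t' ht').mem_closure hJ) _ (h.fU t ht).isOpen hzt
  have := h.dU t ht t' ht' u hu hu'
  subst this
  exact (h.fU t ht).notMem hzt hJ

lemma State.gr_notMem' {S : Set (Tr X Y)} (h : State S) {z : X × Y} (hz : z ∈ gr S) {t : Tr X Y} (ht : t ∈ S) :
    z.2 ∉ t.V := by
  have : z.swap ∈ gr (Tr.swap '' S) := by
    rw [gr_swap]; exact ⟨z, hz, rfl⟩
  exact h.swap.gr_notMem this ⟨t, ht, rfl⟩

lemma mem_gr {S : Set (Tr X Y)} {t : Tr X Y} (ht : t ∈ S) : t.G ⊆ gr S := fun z hz => by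
  simp only [gr, mem_iUnion]
  exact ⟨t, ht, hz⟩

lemma State.coh {S : Set (Tr X Y)} (h : State S) {z : X × Y} (hz : z ∈ gr S) {t : Tr X Y} (ht : t ∈ S)
    (hc : z.1 ∈ closure t.U) : z.2 ∈ closure t.V := by
  rw [(h.fU t ht).closure_eq] at hc
  obtain ⟨z', hz', e⟩ := hc.resolve_left (h.gr_notMem hz ht)
  rw [← h.iU (mem_gr ht hz') hz e]
  exact (h.fV t ht).mem_closure ⟨z', hz', rfl⟩

lemma State.cut {S : Set (Tr X Y)} (h : State S) {C : Set X} {x y : X} (hC : IsArc C x y) {t : Tr X Y} (ht : t ∈ S)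
    (hCU : C \ {x, y} ⊆ t.U) (hx : ∀ t ∈ S, x ∉ t.U) (hy : ∀ t ∈ S, y ∉ t.U) :
    ∃ S' : Set (Tr X Y), State S' ∧ Ref S' S ∧ (∀ t ∈ S', Disjoint t.U C) ∧
      ∀ D, IsPreconnected D → ∀ t ∈ S, D ⊆ t.U → Disjoint D C → ∃ t' ∈ S', D ⊆ t'.U := by
  have hF := h.fU t ht
  have hF' := h.fV t ht
  have hCc : C ⊆ closure t.U := hC.subset_closure_ioo.trans (closure_mono hCU)
  have hxG : x ∈ Prod.fst '' t.G := by
    have := hCc hC.left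
    rw [hF.closure_eq] at this
    exact this.resolve_left (hx t ht)
  have hyG : y ∈ Prod.fst '' t.G := by
    have := hCc hC.right
    rw [hF.closure_eq] at this
    exact this.resolve_left (hy t ht)
  obtain ⟨⟨_, x'⟩, hxG', rfl⟩ := hxG
  obtain ⟨⟨_, y'⟩, hyG', rfl⟩ := hyG
  simp only at hC hCU hx hy
  rename_i x y
  have hGg := mem_gr ht
  have hxy : (x, x') ≠ (y, y') := fun e => hC.ne (congrArg Prod.fst e)
  have hxy' : x' ≠ y' := fun e => hxy (h.iV (hGg hxG') (hGg hyG') e)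
  obtain ⟨C', hC', hCV⟩ := hF'.crosscut ⟨_, hxG', rfl⟩ ⟨_, hyG', rfl⟩ hxy'
  simp only at hC' hCV
  obtain ⟨Γ, hΓ, hΓ1, hΓ2, iΓ1, iΓ2⟩ := matched_arc hC hC'
  obtain ⟨A, B, hA, hB, hAB, hG⟩ := (h.loop t ht).resplit hxG' hyG' hxy
  have hAG : A ⊆ t.G := hG ▸ subset_union_left
  have hBG : B ⊆ t.G := hG ▸ subset_union_right
  have i1 := h.iU.mono hGg
  have i2 := h.iV.mono hGg
  obtain ⟨U1, U2, hU1, hU2, hUd, hUu⟩ := theta hF (hA.image continuous_fst.continuousOn (i1.mono hAG))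
    (hB.image continuous_fst.continuousOn (i1.mono hBG))
    (by rw [← i1.image_inter hAG hBG, hAB, image_pair]) (by rw [hG, image_union]) hC hCU
  obtain ⟨V1, V2, hV1, hV2, hVd, hVu⟩ := theta hF' (hA.image continuous_snd.continuousOn (i2.mono hAG))
    (hB.image continuous_snd.continuousOn (i2.mono hBG))
    (by rw [← i2.image_inter hAG hBG, hAB, image_pair]) (by rw [hG, image_union]) hC' hCV
  have hm1 : ∀ z ∈ gr S, ∀ z' ∈ Γ, z.1 = z'.1 → z'.1 = (x, x').1 ∨ z'.1 = (y, y').1 := by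
    intro z hz z' hz' e
    have : z'.1 ∈ C := hΓ1 ▸ ⟨z', hz', rfl⟩
    rcases cross_cases hCU this with h' | h' | h'
    · exact Or.inl h'
    · exact Or.inr h'
    · rw [← e] at h'
      exact absurd h' (h.gr_notMem hz ht)
  have hm2 : ∀ z ∈ gr S, ∀ z' ∈ Γ, z.2 = z'.2 → z'.2 = (x, x').2 ∨ z'.2 = (y, y').2 := by
    intro z hz z' hz' e
    have : z'.2 ∈ C' := hΓ2 ▸ ⟨z', hz', rfl⟩
    rcases cross_cases hCV this with h' | h' | h'
    · exact Or.inl h'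
    · exact Or.inr h'
    · rw [← e] at h'
      exact absurd h' (h.gr_notMem' hz ht)
  have iE1 : InjOn Prod.fst (gr S ∪ Γ) :=
    injOn_union h.iU iΓ1 (hGg hxG') (hGg hyG') hΓ.left hΓ.right hm1
  have iE2 : InjOn Prod.snd (gr S ∪ Γ) :=
    injOn_union h.iV iΓ2 (hGg hxG') (hGg hyG') hΓ.left hΓ.right hm2
  have hint : ∀ A : Set (X × Y), A ⊆ t.G → IsArc A (x, x') (y, y') → IsLoop (A ∪ Γ) := by
    intro A hAG hA
    refine ⟨_, _, A, Γ, hA, hΓ, ?_, rfl⟩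
    apply Subset.antisymm
    · rintro z ⟨hz, hz'⟩
      rcases hm1 z (hGg (hAG hz)) z hz' rfl with e | e
      · exact Or.inl (iΓ1 hz' hΓ.left e)
      · exact Or.inr (iΓ1 hz' hΓ.right e)
    · rintro z (rfl | rfl)
      exacts [⟨hA.left, hΓ.left⟩, ⟨hA.right, hΓ.right⟩]
  have sU1 : U1 ⊆ t.U := fun z hz => (hUu ▸ Or.inl hz : z ∈ t.U \ C).1
  have sU2 : U2 ⊆ t.U := fun z hz => (hUu ▸ Or.inr hz : z ∈ t.U \ C).1
  have sV1 : V1 ⊆ t.V := fun z hz => (hVu ▸ Or.inl hz : z ∈ t.V \ C').1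
  have sV2 : V2 ⊆ t.V := fun z hz => (hVu ▸ Or.inr hz : z ∈ t.V \ C').1
  have clU : closure t.U ⊆ closure U1 ∪ closure U2 := by
    refine closure_minimal ?_ (isClosed_closure.union isClosed_closure)
    intro z hz
    by_cases hzC : z ∈ C
    · exact Or.inl (hU1.mem_closure (Or.inr hzC))
    · have : z ∈ U1 ∪ U2 := hUu ▸ ⟨hz, hzC⟩
      exact this.imp (fun h => subset_closure h) (fun h => subset_closure h)
  have clV : closure t.V ⊆ closure V1 ∪ closure V2 := by
    refine closure_minimal ?_ (isClosed_closure.union isClosed_closure)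
    intro z hz
    by_cases hzC : z ∈ C'
    · exact Or.inl (hV1.mem_closure (Or.inr hzC))
    · have : z ∈ V1 ∪ V2 := hVu ▸ ⟨hz, hzC⟩
      exact this.imp (fun h => subset_closure h) (fun h => subset_closure h)
  set t1 : Tr X Y := ⟨A ∪ Γ, U1, V1⟩ with ht1
  set t2 : Tr X Y := ⟨B ∪ Γ, U2, V2⟩ with ht2
  set S' : Set (Tr X Y) := insert t1 (insert t2 (S \ {t})) with hS'
  have m1 : t1 ∈ S' := Or.inl rfl
  have m2 : t2 ∈ S' := Or.inr (Or.inl rfl)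
  have m3 : ∀ s ∈ S, s ≠ t → s ∈ S' := fun s hs hst => Or.inr (Or.inr ⟨hs, hst⟩)
  have hgr : gr S' ⊆ gr S ∪ Γ := by
    intro z hz
    simp only [gr, mem_iUnion] at hz
    obtain ⟨s, hs, hz⟩ := hz
    rcases hs with rfl | rfl | hs
    · exact hz.imp (fun h => hGg (hAG h)) id
    · exact hz.imp (fun h => hGg (hBG h)) id
    · exact Or.inl (mem_gr hs.1 hz)
  refine ⟨S', ?_, ?_, ?_, ?_⟩
  · refine ⟨?_, ?_, ?_, ?_, ?_, ?_, ?_, ?_, iE1.mono hgr, iE2.mono hgr⟩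
    · exact ((h.fin.subset sdiff_subset).insert _).insert _
    · rintro s (rfl | rfl | hs)
      exacts [hint A hAG hA, hint B hBG hB, h.loop s hs.1]
    · rintro s (rfl | rfl | hs)
      · simp only [ht1, image_union, hΓ1]; exact hU1
      · simp only [ht2, image_union, hΓ1]; exact hU2
      · exact h.fU s hs.1
    · rintro s (rfl | rfl | hs)
      · simp only [ht1, image_union, hΓ2]; exact hV1
      · simp only [ht2, image_union, hΓ2]; exact hV2
      · exact h.fV s hs.1
    · rintro s (rfl | rfl | hs) s' (rfl | rfl | hs') z hz hz'
      · rfl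
      · exact absurd hz' (Set.disjoint_left.1 hUd hz)
      · exact absurd (h.dU _ ht _ hs'.1 z (sU1 hz) hz').symm hs'.2
      · exact absurd hz (Set.disjoint_left.1 hUd hz')
      · rfl
      · exact absurd (h.dU _ ht _ hs'.1 z (sU2 hz) hz').symm hs'.2
      · exact absurd (h.dU _ ht _ hs.1 z (sU1 hz') hz).symm hs.2
      · exact absurd (h.dU _ ht _ hs.1 z (sU2 hz') hz).symm hs.2
      · exact h.dU _ hs.1 _ hs'.1 z hz hz'
    · rintro s (rfl | rfl | hs) s' (rfl | rfl | hs') z hz hz'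
      · rfl
      · exact absurd hz' (Set.disjoint_left.1 hVd hz)
      · exact absurd (h.dV _ ht _ hs'.1 z (sV1 hz) hz').symm hs'.2
      · exact absurd hz (Set.disjoint_left.1 hVd hz')
      · rfl
      · exact absurd (h.dV _ ht _ hs'.1 z (sV2 hz) hz').symm hs'.2
      · exact absurd (h.dV _ ht _ hs.1 z (sV1 hz') hz).symm hs.2
      · exact absurd (h.dV _ ht _ hs.1 z (sV2 hz') hz).symm hs.2
      · exact h.dV _ hs.1 _ hs'.1 z hz hz'
    · intro z
      obtain ⟨s, hs, hz⟩ := h.cU z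
      by_cases hst : s = t
      · rw [hst] at hz
        rcases clU hz with h' | h'
        exacts [⟨t1, m1, h'⟩, ⟨t2, m2, h'⟩]
      · exact ⟨s, m3 s hs hst, hz⟩
    · intro z
      obtain ⟨s, hs, hz⟩ := h.cV z
      by_cases hst : s = t
      · rw [hst] at hz
        rcases clV hz with h' | h'
        exacts [⟨t1, m1, h'⟩, ⟨t2, m2, h'⟩]
      · exact ⟨s, m3 s hs hst, hz⟩
  · rintro s (rfl | rfl | hs)
    · exact ⟨t, ht, sU1, sV1⟩
    · exact ⟨t, ht, sU2, sV2⟩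
    · exact ⟨s, hs.1, le_rfl, le_rfl⟩
  · rintro s (rfl | rfl | hs)
    · exact Set.disjoint_left.2 fun z hz => (hUu ▸ Or.inl hz : z ∈ t.U \ C).2
    · exact Set.disjoint_left.2 fun z hz => (hUu ▸ Or.inr hz : z ∈ t.U \ C).2
    · refine Set.disjoint_left.2 fun z hz hzC => ?_
      rcases cross_cases hCU hzC with rfl | rfl | h'
      · exact hx s hs.1 hz
      · exact hy s hs.1 hz
      · exact hs.2 (h.dU _ ht _ hs.1 z h' hz).symm
  · intro D hD s hs hDs hDC
    by_cases hst : s = t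
    · rw [hst] at hDs
      have hDu : D ⊆ U1 ∪ U2 := by
        rw [hUu]; exact fun z hz => ⟨hDs hz, Set.disjoint_left.1 hDC hz⟩
      rcases hD.subset_or_subset hU1.isOpen hU2.isOpen hUd hDu with h' | h'
      exacts [⟨t1, m1, h'⟩, ⟨t2, m2, h'⟩]
    · exact ⟨s, m3 s hs hst, hDs⟩

lemma State.cuts {𝒢 : Set (Set X)} (h𝒢 : 𝒢.Finite) : ∀ {S : Set (Tr X Y)}, State S →
    (∀ C ∈ 𝒢, ∃ x y, IsArc C x y ∧ (∃ t ∈ S, C \ {x, y} ⊆ t.U) ∧ (∀ t ∈ S, x ∉ t.U) ∧ ∀ t ∈ S, y ∉ t.U) →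
    (∀ C ∈ 𝒢, ∀ C' ∈ 𝒢, C ≠ C' → ∀ t ∈ S, ∀ z ∈ C, z ∈ C' → z ∉ t.U) →
    ∃ S' : Set (Tr X Y), State S' ∧ Ref S' S ∧ ∀ t ∈ S', ∀ C ∈ 𝒢, Disjoint t.U C := by
  induction 𝒢, h𝒢 using Set.Finite.induction_on with
  | empty =>
    intro S h _ _
    exact ⟨S, h, Ref.refl S, by simp⟩
  | @insert C 𝒢 hC𝒢 _ ih =>
    intro S h h1 h2
    obtain ⟨x, y, hC, ⟨t, ht, hCt⟩, hx, hy⟩ := h1 C (mem_insert _ _)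
    obtain ⟨S1, hS1, hr1, hd1, hc1⟩ := h.cut hC ht hCt hx hy
    have hnot : ∀ z, (∀ t ∈ S, z ∉ t.U) → ∀ t ∈ S1, z ∉ t.U := by
      intro z hz t ht hzt
      obtain ⟨t', ht', h', -⟩ := hr1 t ht
      exact hz t' ht' (h' hzt)
    obtain ⟨S2, hS2, hr2, hd2⟩ := ih hS1 (by
      intro C' hC'
      obtain ⟨x', y', hCa, ⟨t', ht', hCt'⟩, hx', hy'⟩ := h1 C' (mem_insert_of_mem _ hC')
      refine ⟨x', y', hCa, ?_, hnot x' hx', hnot y' hy'⟩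
      refine hc1 _ hCa.ioo_preconn t' ht' hCt' (Set.disjoint_left.2 fun z hz hzC => ?_)
      exact h2 C' (mem_insert_of_mem _ hC') C (mem_insert _ _) (fun e => hC𝒢 (e ▸ hC')) t' ht' z hz.1 hzC
        (hCt' hz))
      (by
        intro D hD D' hD' hne t ht z hz hz' hzt
        obtain ⟨t', ht', h', -⟩ := hr1 t ht
        exact h2 D (mem_insert_of_mem _ hD) D' (mem_insert_of_mem _ hD') hne t' ht' z hz hz' (h' hzt))
    refine ⟨S2, hS2, hr2.trans hr1, ?_⟩
    rintro s hs D (rfl | hD)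
    · obtain ⟨t', ht', h', -⟩ := hr2 s hs
      exact (hd1 t' ht').mono_left h'
    · exact hd2 s hs D hD

lemma State.avoid {S : Set (Tr X Y)} (h : State S) (p : X) :
    ∃ S' : Set (Tr X Y), State S' ∧ Ref S' S ∧ ∀ t ∈ S', p ∉ t.U := by
  by_cases hp : ∃ t ∈ S, p ∈ t.U
  · obtain ⟨t, ht, hpt⟩ := hp
    obtain ⟨x, y, C, hx, hy, hxy, hC, hCU, hpC⟩ := (h.fU t ht).cross_through hpt
    have hn : ∀ x ∈ Prod.fst '' t.G, ∀ t ∈ S, x ∉ t.U := by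
      rintro _ ⟨z, hz, rfl⟩ s hs
      exact h.gr_notMem (mem_gr ht hz) hs
    obtain ⟨S', h1, h2, h3, -⟩ := h.cut hC ht hCU (hn x hx) (hn y hy)
    exact ⟨S', h1, h2, fun t ht hpt => Set.disjoint_left.1 (h3 t ht) hpt hpC⟩
  · push Not at hp
    exact ⟨S, h, Ref.refl S, hp⟩

lemma State.mesh {S : Set (Tr X Y)} (h : State S) {Q K1 K2 : Set X} (hQ : IsLoop Q) (hK1 : IsClosed K1)
    (hK2 : IsClosed K2) (hsep : ∀ v ∈ K1, ∀ w ∈ K2, v ∉ Q ∧ w ∉ Q ∧ ¬ Jn Q v w) :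
    ∃ S' : Set (Tr X Y), State S' ∧ Ref S' S ∧ ∀ t ∈ S', ∀ v ∈ K1, ∀ w ∈ K2, v ∈ t.U → w ∉ t.U := by
  obtain ⟨p1, p2, hp, hp1, hp2⟩ : ∃ p1 p2, p1 ≠ p2 ∧ p1 ∈ Q ∧ p2 ∈ Q := by
    obtain ⟨a, b, A, B, hA, hB, -, rfl⟩ := hQ
    exact ⟨a, b, hA.ne, Or.inl hA.left, Or.inl hA.right⟩
  obtain ⟨S1, h1, r1, n1⟩ := h.avoid p1
  obtain ⟨S2, h2, r2, n2⟩ := h1.avoid p2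
  have n1' : ∀ t ∈ S2, p1 ∉ t.U := by
    intro t ht hpt
    obtain ⟨t', ht', h', -⟩ := r2 t ht
    exact n1 t' ht' (h' hpt)
  choose! 𝒢 g1 g2 g3 g4 using fun t (ht : t ∈ S2) =>
    exists_cuts (h2.fU t ht) hQ hK1 hK2 hsep hp hp1 hp2 (n1' t ht) (n2 t ht)
  have hout : ∀ t ∈ S2, ∀ C ∈ 𝒢 t, ∀ t' ∈ S2, t' ≠ t → ∀ z ∈ C, z ∉ t'.U := by
    intro t ht C hC t' ht' hne z hz hzt
    obtain ⟨x, y, hCa, hCU, hx, hy, -⟩ := g2 t ht C hC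
    have : C ⊆ closure t.U := hCa.subset_closure_ioo.trans (closure_mono hCU)
    obtain ⟨u, hu, hu'⟩ := mem_closure_iff.1 (this hz) _ (h2.fU t' ht').isOpen hzt
    exact hne (h2.dU _ ht' _ ht u hu hu')
  obtain ⟨S3, h3, r3, d3⟩ := State.cuts (𝒢 := ⋃ t ∈ S2, 𝒢 t) (h2.fin.biUnion g1) h2 (by
      intro C hC
      simp only [mem_iUnion] at hC
      obtain ⟨t, ht, hC⟩ := hC
      obtain ⟨x, y, hCa, hCU, hx, hy, -⟩ := g2 t ht C hC
      refine ⟨x, y, hCa, ⟨t, ht, hCU⟩, fun t' ht' => ?_, fun t' ht' => ?_⟩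
      · by_cases e : t' = t
        · rwa [e]
        · exact hout t ht C hC t' ht' e x hCa.left
      · by_cases e : t' = t
        · rwa [e]
        · exact hout t ht C hC t' ht' e y hCa.right)
    (by
      intro C hC C' hC' hne s hs z hz hz'
      simp only [mem_iUnion] at hC hC'
      obtain ⟨t, ht, hC⟩ := hC
      obtain ⟨t', ht', hC'⟩ := hC'
      by_cases e : s = t
      · by_cases e' : s = t'
        · rw [← e] at hC
          rw [← e'] at hC'
          exact g3 s hs C hC C' hC' hne z hz hz'
        · exact hout t' ht' C' hC' s hs e' z hz'
      · exact hout t ht C hC s hs e z hz)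
  refine ⟨S3, h3, r3.trans (r2.trans r1), fun t ht v hv w hw hvt hwt => ?_⟩
  obtain ⟨s, hs, hts, -⟩ := r3 t ht
  obtain ⟨C, hC, hCj⟩ := g4 s hs v hv w hw (hts hvt) (hts hwt)
  refine hCj ⟨t.U, (h3.fU t ht).preconn, hvt, hwt, ?_⟩
  rintro z hz (hz' | hz')
  · exact hz' (hts hz)
  · refine Set.disjoint_left.1 (d3 t ht C ?_) hz hz'
    simp only [mem_iUnion]
    exact ⟨s, hs, hC⟩

variable (X Y) in
lemma exists_state : ∃ S : Set (Tr X Y), State S := by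
  obtain ⟨J, hJ⟩ := exists_loop (X := X)
  obtain ⟨J', hJ'⟩ := exists_loop (X := Y)
  obtain ⟨q, -, hq, -⟩ := loop_sep hJ
  obtain ⟨q', -, hq', -⟩ := loop_sep hJ'
  obtain ⟨U1, hU1, -⟩ := face_comp hJ hq
  obtain ⟨V1, hV1, -⟩ := face_comp hJ' hq'
  obtain ⟨U2, hU2, dU, cU⟩ := hU1.other
  obtain ⟨V2, hV2, dV, cV⟩ := hV1.other
  obtain ⟨a, b, A, B, hA, hB, hAB, eJ⟩ := hJ
  obtain ⟨a', b', A', B', hA', hB', hAB', eJ'⟩ := hJ'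
  obtain ⟨Γ, hΓ, hΓ1, hΓ2, iΓ1, iΓ2⟩ := matched_arc hA hA'
  obtain ⟨Δ, hΔ, hΔ1, hΔ2, iΔ1, iΔ2⟩ := matched_arc hB hB'
  have m1 : ∀ z ∈ Γ, ∀ z' ∈ Δ, z.1 = z'.1 → z'.1 = (a, a').1 ∨ z'.1 = (b, b').1 := by
    intro z hz z' hz' e
    have h1 : z'.1 ∈ A := by rw [← e, ← hΓ1]; exact ⟨z, hz, rfl⟩
    have h2 : z'.1 ∈ B := by rw [← hΔ1]; exact ⟨z', hz', rfl⟩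
    have : z'.1 ∈ A ∩ B := ⟨h1, h2⟩
    rw [hAB] at this
    exact this
  have m2 : ∀ z ∈ Γ, ∀ z' ∈ Δ, z.2 = z'.2 → z'.2 = (a, a').2 ∨ z'.2 = (b, b').2 := by
    intro z hz z' hz' e
    have h1 : z'.2 ∈ A' := by rw [← e, ← hΓ2]; exact ⟨z, hz, rfl⟩
    have h2 : z'.2 ∈ B' := by rw [← hΔ2]; exact ⟨z', hz', rfl⟩
    have : z'.2 ∈ A' ∩ B' := ⟨h1, h2⟩
    rw [hAB'] at this
    exact this
  have i1 : InjOn Prod.fst (Γ ∪ Δ) := injOn_union iΓ1 iΔ1 hΓ.left hΓ.right hΔ.left hΔ.right m1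
  have i2 : InjOn Prod.snd (Γ ∪ Δ) := injOn_union iΓ2 iΔ2 hΓ.left hΓ.right hΔ.left hΔ.right m2
  have hloop : IsLoop (Γ ∪ Δ) := by
    refine ⟨_, _, Γ, Δ, hΓ, hΔ, ?_, rfl⟩
    apply Subset.antisymm
    · rintro z ⟨hz, hz'⟩
      rcases m1 z hz z hz' rfl with e | e
      · exact Or.inl (iΔ1 hz' hΔ.left e)
      · exact Or.inr (iΔ1 hz' hΔ.right e)
    · rintro z (rfl | rfl)
      exacts [⟨hΓ.left, hΔ.left⟩, ⟨hΓ.right, hΔ.right⟩]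
  have e1 : Prod.fst '' (Γ ∪ Δ) = J := by rw [image_union, hΓ1, hΔ1, eJ]
  have e2 : Prod.snd '' (Γ ∪ Δ) = J' := by rw [image_union, hΓ2, hΔ2, eJ']
  set t1 : Tr X Y := ⟨Γ ∪ Δ, U1, V1⟩
  set t2 : Tr X Y := ⟨Γ ∪ Δ, U2, V2⟩
  have hgr : gr {t1, t2} ⊆ Γ ∪ Δ := by
    intro z hz
    simp only [gr, mem_iUnion] at hz
    obtain ⟨s, rfl | rfl, hz⟩ := hz
    exacts [hz, hz]
  refine ⟨{t1, t2}, by simp, ?_, ?_, ?_, ?_, ?_, ?_, ?_, i1.mono hgr, i2.mono hgr⟩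
  · rintro s (rfl | rfl)
    exacts [hloop, hloop]
  · rintro s (rfl | rfl)
    exacts [e1 ▸ hU1, e1 ▸ hU2]
  · rintro s (rfl | rfl)
    exacts [e2 ▸ hV1, e2 ▸ hV2]
  · rintro s (rfl | rfl) s' (rfl | rfl) z hz hz'
    exacts [rfl, absurd hz' (Set.disjoint_left.1 dU hz), absurd hz (Set.disjoint_left.1 dU hz'), rfl]
  · rintro s (rfl | rfl) s' (rfl | rfl) z hz hz'
    exacts [rfl, absurd hz' (Set.disjoint_left.1 dV hz), absurd hz (Set.disjoint_left.1 dV hz'), rfl]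
  · intro z
    by_cases hz : z ∈ J
    · exact ⟨t1, Or.inl rfl, hU1.mem_closure hz⟩
    · rw [← mem_compl_iff, ← cU] at hz
      rcases hz with hz | hz
      exacts [⟨t1, Or.inl rfl, subset_closure hz⟩, ⟨t2, Or.inr rfl, subset_closure hz⟩]
  · intro z
    by_cases hz : z ∈ J'
    · exact ⟨t1, Or.inl rfl, hV1.mem_closure hz⟩
    · rw [← mem_compl_iff, ← cV] at hz
      rcases hz with hz | hz
      exacts [⟨t1, Or.inl rfl, subset_closure hz⟩, ⟨t2, Or.inr rfl, subset_closure hz⟩]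

end
end MQ


set_option linter.unusedSectionVars false
set_option linter.unusedVariables false
namespace MQ

section
variable {X : Type*} [TopologicalSpace X] {Y : Type*} [TopologicalSpace Y]

lemma limit_half [CompactSpace Y] [T2Space X] [T2Space Y] {R : ℕ → Set (X × Y)} {D : ℕ → Set (Y × Y)}
    (hR : ∀ n, IsClosed (R n)) (hRa : ∀ n, R (n + 1) ⊆ R n)
    (hD : ∀ n, IsClosed (D n)) (hDa : ∀ n, D (n + 1) ⊆ D n)
    (hDd : ∀ a b, (∀ n, (a, b) ∈ D n) → a = b) (hne : ∀ n x, ∃ y, (x, y) ∈ R n)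
    (huq : ∀ n x y y', (x, y) ∈ R n → (x, y') ∈ R n → ∃ z, (y, z) ∈ D n ∧ (z, y') ∈ D n) (x : X) :
    ∃! y, ∀ n, (x, y) ∈ R n := by
  have hc1 : ∀ n, IsClosed {y | (x, y) ∈ R n} := fun n =>
    (hR n).preimage (by fun_prop : Continuous fun y : Y => (x, y))
  obtain ⟨y, hy⟩ := IsCompact.nonempty_iInter_of_sequence_nonempty_isCompact_isClosed
    (fun n => {y | (x, y) ∈ R n}) (fun n y hy => hRa n hy) (fun n => hne n x) (hc1 0).isCompact hc1
  have hy' : ∀ n, (x, y) ∈ R n := fun n => mem_iInter.1 hy n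
  refine ⟨y, hy', fun y' hy'' => ?_⟩
  have hc2 : ∀ n, IsClosed {z | (y, z) ∈ D n ∧ (z, y') ∈ D n} := fun n =>
    ((hD n).preimage (by fun_prop : Continuous fun z : Y => (y, z))).inter
      ((hD n).preimage (by fun_prop : Continuous fun z : Y => (z, y')))
  obtain ⟨z, hz⟩ := IsCompact.nonempty_iInter_of_sequence_nonempty_isCompact_isClosed
    (fun n => {z | (y, z) ∈ D n ∧ (z, y') ∈ D n}) (fun n z hz => ⟨hDa n hz.1, hDa n hz.2⟩)
    (fun n => huq n x y y' (hy' n) (hy'' n)) (hc2 0).isCompact hc2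
  have hz' := fun n => mem_iInter.1 hz n
  exact ((hDd y z fun n => (hz' n).1).trans (hDd z y' fun n => (hz' n).2)).symm

def DU (S : Set (Tr X Y)) : Set (X × X) := {p | ∃ t ∈ S, p.1 ∈ closure t.U ∧ p.2 ∈ closure t.U}
def DV (S : Set (Tr X Y)) : Set (Y × Y) := {p | ∃ t ∈ S, p.1 ∈ closure t.V ∧ p.2 ∈ closure t.V}
def RR (S : Set (Tr X Y)) : Set (X × Y) := {p | ∃ t ∈ S, p.1 ∈ closure t.U ∧ p.2 ∈ closure t.V}

lemma fin_closed {ι A B : Type*} [TopologicalSpace A] [TopologicalSpace B] {S : Set ι} (hS : S.Finite)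
    (f : ι → Set A) (g : ι → Set B) : IsClosed {p : A × B | ∃ t ∈ S, p.1 ∈ closure (f t) ∧ p.2 ∈ closure (g t)} := by
  have : {p : A × B | ∃ t ∈ S, p.1 ∈ closure (f t) ∧ p.2 ∈ closure (g t)} =
      ⋃ t ∈ S, closure (f t) ×ˢ closure (g t) := by
    ext p; simp only [mem_setOf_eq, mem_iUnion, mem_prod, exists_prop]
  rw [this]
  exact hS.isClosed_biUnion fun t _ => isClosed_closure.prod isClosed_closure

lemma Ref.DU {S S' : Set (Tr X Y)} (h : Ref S' S) : DU S' ⊆ DU S := by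
  rintro p ⟨t, ht, h1, h2⟩
  obtain ⟨t', ht', hU, hV⟩ := h t ht
  exact ⟨t', ht', closure_mono hU h1, closure_mono hU h2⟩

lemma Ref.DV {S S' : Set (Tr X Y)} (h : Ref S' S) : DV S' ⊆ DV S := by
  rintro p ⟨t, ht, h1, h2⟩
  obtain ⟨t', ht', hU, hV⟩ := h t ht
  exact ⟨t', ht', closure_mono hV h1, closure_mono hV h2⟩

lemma Ref.RR {S S' : Set (Tr X Y)} (h : Ref S' S) : RR S' ⊆ RR S := by
  rintro p ⟨t, ht, h1, h2⟩
  obtain ⟨t', ht', hU, hV⟩ := h t ht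
  exact ⟨t', ht', closure_mono hU h1, closure_mono hV h2⟩

variable [Moore X] [Moore Y]

lemma State.uniq {S : Set (Tr X Y)} (h : State S) {x : X} {y y' : Y} (h1 : (x, y) ∈ RR S) (h2 : (x, y') ∈ RR S) :
    ∃ z, (y, z) ∈ DV S ∧ (z, y') ∈ DV S := by
  obtain ⟨t, ht, hx, hy⟩ := h1
  obtain ⟨t', ht', hx', hy'⟩ := h2
  simp only at hx hy hx' hy'
  by_cases e : t = t'
  · subst e
    exact ⟨y, ⟨t, ht, hy, hy⟩, ⟨t, ht, hy, hy'⟩⟩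
  · have hxU : x ∉ t.U := by
      intro hxU
      obtain ⟨u, hu, hu'⟩ := mem_closure_iff.1 hx' _ (h.fU t ht).isOpen hxU
      exact e (h.dU t ht t' ht' u hu hu')
    have hx2 := hx
    rw [(h.fU t ht).closure_eq] at hx2
    obtain ⟨z, hz, rfl⟩ := hx2.resolve_left hxU
    have hzg := mem_gr ht hz
    exact ⟨z.2, ⟨t, ht, hy, h.coh hzg ht hx⟩, ⟨t', ht', h.coh hzg ht' hx', hy'⟩⟩

def GoodP (N1 N2 : Set X) : Prop :=
  ∃ Q, IsLoop Q ∧ ∀ v ∈ closure N1, ∀ w ∈ closure N2, v ∉ Q ∧ w ∉ Q ∧ ¬ Jn Q v w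

lemma State.stepX {S : Set (Tr X Y)} (h : State S) (N1 N2 : Set X) :
    ∃ S' : Set (Tr X Y), State S' ∧ Ref S' S ∧
      (GoodP N1 N2 → ∀ t ∈ S', ∀ v ∈ N1, ∀ w ∈ N2, v ∈ t.U → w ∉ t.U) := by
  by_cases hg : GoodP N1 N2
  · obtain ⟨Q, hQ, hs⟩ := hg
    obtain ⟨S', h1, h2, h3⟩ := h.mesh hQ isClosed_closure isClosed_closure hs
    exact ⟨S', h1, h2, fun _ t ht v hv w hw => h3 t ht v (subset_closure hv) w (subset_closure hw)⟩
  · exact ⟨S, h, Ref.refl S, fun h' => absurd h' hg⟩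

lemma State.stepY {S : Set (Tr X Y)} (h : State S) (N1 N2 : Set Y) :
    ∃ S' : Set (Tr X Y), State S' ∧ Ref S' S ∧
      (GoodP N1 N2 → ∀ t ∈ S', ∀ v ∈ N1, ∀ w ∈ N2, v ∈ t.V → w ∉ t.V) := by
  obtain ⟨S', h1, h2, h3⟩ := h.swap.stepX N1 N2
  refine ⟨Tr.swap '' S', h1.swap, ?_, ?_⟩
  · have := h2.swap
    rwa [swap_image] at this
  · rintro hg _ ⟨t, ht, rfl⟩
    exact h3 hg t ht

variable (X) in
lemma exists_nbhds : ∃ b : ℕ → Set X, (∀ n, IsOpen (b n)) ∧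
    ∀ x s, s ∈ 𝓝 x → ∃ n, x ∈ b n ∧ closure (b n) ⊆ s := by
  have hB := TopologicalSpace.isBasis_countableBasis X
  obtain ⟨x0⟩ : Nonempty X := inferInstance
  obtain ⟨t, ht, -⟩ := hB.exists_closure_subset (x := x0) univ_mem
  obtain ⟨b, hb⟩ := (TopologicalSpace.countable_countableBasis X).exists_eq_range ⟨t, ht⟩
  refine ⟨b, fun n => hB.isOpen (hb ▸ mem_range_self n), fun x s hs => ?_⟩
  obtain ⟨t, ht, hxt, hts⟩ := hB.exists_closure_subset hs
  rw [hb] at ht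
  obtain ⟨n, rfl⟩ := ht
  exact ⟨n, hxt, hts⟩

lemma exists_good {b : ℕ → Set X} (hb : ∀ x s, s ∈ 𝓝 x → ∃ n, x ∈ b n ∧ closure (b n) ⊆ s) {x y : X} (hxy : x ≠ y) :
    ∃ i j, x ∈ b i ∧ y ∈ b j ∧ GoodP (b i) (b j) := by
  obtain ⟨Q, hQ, hx, hy, hj⟩ := sep_loop x y hxy
  have ho : ∀ z, IsOpen (connectedComponentIn Qᶜ z) := fun z => hQ.isClosed.isOpen_compl.connectedComponentIn
  obtain ⟨i, hi, hi'⟩ := hb x _ ((ho x).mem_nhds (mem_connectedComponentIn hx))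
  obtain ⟨j, hj1, hj'⟩ := hb y _ ((ho y).mem_nhds (mem_connectedComponentIn hy))
  refine ⟨i, j, hi, hj1, Q, hQ, fun v hv w hw => ?_⟩
  have h1 := Jn_iff.2 (hi' hv)
  have h2 := Jn_iff.2 (hj' hw)
  exact ⟨h1.right, h2.right, fun h => hj ((h1.trans h).trans h2.symm)⟩

variable (X Y) in
theorem moore_homeo : Nonempty (X ≃ₜ Y) := by
  obtain ⟨S0, hS0⟩ := exists_state X Y
  obtain ⟨b, hbo, hb⟩ := exists_nbhds X
  obtain ⟨c, hco, hc⟩ := exists_nbhds Y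
  have step : ∀ (n : ℕ) (S : {S : Set (Tr X Y) // State S}), ∃ S' : {S : Set (Tr X Y) // State S}, Ref S'.1 S.1 ∧
      (GoodP (b n.unpair.1) (b n.unpair.2) → ∀ t ∈ S'.1, ∀ v ∈ b n.unpair.1, ∀ w ∈ b n.unpair.2, v ∈ t.U → w ∉ t.U) ∧
      (GoodP (c n.unpair.1) (c n.unpair.2) → ∀ t ∈ S'.1, ∀ v ∈ c n.unpair.1, ∀ w ∈ c n.unpair.2, v ∈ t.V → w ∉ t.V) := by
    rintro n ⟨S, hS⟩
    obtain ⟨S1, h1, r1, p1⟩ := hS.stepX (b n.unpair.1) (b n.unpair.2)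
    obtain ⟨S2, h2, r2, p2⟩ := h1.stepY (c n.unpair.1) (c n.unpair.2)
    refine ⟨⟨S2, h2⟩, r2.trans r1, fun hg t ht v hv w hw hvt hwt => ?_, p2⟩
    obtain ⟨t', ht', hU, -⟩ := r2 t ht
    exact p1 hg t' ht' v hv w hw (hU hvt) (hU hwt)
  choose next hn1 hn2 hn3 using step
  let sq : ℕ → {S : Set (Tr X Y) // State S} := fun n => Nat.rec ⟨S0, hS0⟩ (fun n S => next n S) n
  have hsq : ∀ n, sq (n + 1) = next n (sq n) := fun n => rfl
  have href : ∀ n, Ref (sq (n + 1)).1 (sq n).1 := fun n => hn1 n (sq n)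
  have hDU : ∀ x y, (∀ n, (x, y) ∈ DU (sq n).1) → x = y := by
    intro x y h
    by_contra hxy
    obtain ⟨i, j, hi, hj, hg⟩ := exists_good hb hxy
    obtain ⟨t, ht, h1, h2⟩ := h (Nat.pair i j + 1)
    have := hn2 (Nat.pair i j) (sq (Nat.pair i j))
    rw [Nat.unpair_pair] at this
    obtain ⟨u, hu, hu'⟩ := mem_closure_iff.1 h1 _ (hbo i) hi
    obtain ⟨v, hv, hv'⟩ := mem_closure_iff.1 h2 _ (hbo j) hj
    exact this hg t ht u hu v hv hu' hv'
  have hDV : ∀ x y, (∀ n, (x, y) ∈ DV (sq n).1) → x = y := by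
    intro x y h
    by_contra hxy
    obtain ⟨i, j, hi, hj, hg⟩ := exists_good hc hxy
    obtain ⟨t, ht, h1, h2⟩ := h (Nat.pair i j + 1)
    have := hn3 (Nat.pair i j) (sq (Nat.pair i j))
    rw [Nat.unpair_pair] at this
    obtain ⟨u, hu, hu'⟩ := mem_closure_iff.1 h1 _ (hco i) hi
    obtain ⟨v, hv, hv'⟩ := mem_closure_iff.1 h2 _ (hco j) hj
    exact this hg t ht u hu v hv hu' hv'
  have hRc : ∀ n, IsClosed (RR (sq n).1) := fun n => fin_closed (sq n).2.fin _ _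
  have hf := fun x => limit_half (R := fun n => RR (sq n).1) (D := fun n => DV (sq n).1)
    hRc (fun n => (href n).RR)
    (fun n => fin_closed (sq n).2.fin _ _) (fun n => (href n).DV) hDV
    (fun n x => by
      obtain ⟨t, ht, hx⟩ := (sq n).2.cU x
      obtain ⟨y, hy⟩ := ((sq n).2.fV t ht).nonempty
      exact ⟨y, t, ht, hx, subset_closure hy⟩)
    (fun n x y y' => (sq n).2.uniq) x
  have hsw : ∀ n (p : Y × X), p ∈ RR (Tr.swap '' (sq n).1) ↔ p.swap ∈ RR (sq n).1 := by
    intro n p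
    constructor
    · rintro ⟨_, ⟨t, ht, rfl⟩, h1, h2⟩
      exact ⟨t, ht, h2, h1⟩
    · rintro ⟨t, ht, h1, h2⟩
      exact ⟨_, ⟨t, ht, rfl⟩, h2, h1⟩
  have hg := fun y => limit_half (R := fun n => RR (Tr.swap '' (sq n).1)) (D := fun n => DV (Tr.swap '' (sq n).1))
    (fun n => fin_closed (sq n).2.swap.fin _ _) (fun n => (href n).swap.RR)
    (fun n => fin_closed (sq n).2.swap.fin _ _) (fun n => (href n).swap.DV)
    (fun x y h => hDU x y fun n => by
      obtain ⟨_, ⟨t, ht, rfl⟩, h1, h2⟩ := h n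
      exact ⟨t, ht, h1, h2⟩)
    (fun n y => by
      obtain ⟨t, ht, hy⟩ := (sq n).2.cV y
      obtain ⟨x, hx⟩ := ((sq n).2.fU t ht).nonempty
      exact ⟨x, t.swap, ⟨t, ht, rfl⟩, hy, subset_closure hx⟩)
    (fun n x y y' => (sq n).2.swap.uniq) y
  choose f hf1 hf2 using hf
  choose g hg1 hg2 using hg
  have hg1' : ∀ y n, (g y, y) ∈ RR (sq n).1 := fun y n => (hsw n _).1 (hg1 y n)
  have hfg : ∀ y, f (g y) = y := fun y => (hf2 (g y) y (hg1' y)).symm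
  have hgf : ∀ x, g (f x) = x := fun x => (hg2 (f x) x fun n => (hsw n _).2 (hf1 x n)).symm
  let E : X ≃ Y := ⟨f, g, hgf, hfg⟩
  have hcont : Continuous E := by
    rw [continuous_iff_isClosed]
    intro C hC
    have : E ⁻¹' C = Prod.fst '' ((⋂ n, RR (sq n).1) ∩ Prod.snd ⁻¹' C) := by
      ext x
      constructor
      · intro hx
        exact ⟨(x, f x), ⟨mem_iInter.2 fun n => hf1 x n, hx⟩, rfl⟩
      · rintro ⟨⟨x, y⟩, ⟨h1, h2⟩, rfl⟩
        have : y = f x := hf2 x y fun n => mem_iInter.1 h1 n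
        show f x ∈ C
        rw [← this]
        exact h2
    rw [this]
    exact isClosedMap_fst_of_compactSpace _ ((isClosed_iInter hRc).inter (hC.preimage continuous_snd))
  exact ⟨hcont.homeoOfEquivCompactToT2⟩

end
end MQ

/-- **Moore's theorem.** If `∼` is an equivalence relation on `S²` whose classes
are compact, connected, have connected complements, form an upper semicontinuous family, and
not all points are equivalent, then the quotient `S²/∼` is homeomorphic to `S²`. -/
theorem moore_quotient_homeomorphic_sphere (s : Setoid Sph)
    (hcompact : ∀ C ∈ s.classes, IsCompact C)
    (hconn : ∀ C ∈ s.classes, IsConnected C)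
    (hcompl : ∀ C ∈ s.classes, IsConnected Cᶜ)
    (husc : USCFamily s.classes)
    (hnontriv : ¬ ∀ x y : Sph, s.r x y) :
    Nonempty (Quotient s ≃ₜ Sph) := by
  haveI := MQ.quot_moore s hcompact hconn hcompl husc hnontriv
  haveI := MQ.sph_moore
  exact MQ.moore_homeo (Quotient s) Sph
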